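/- Let [Δ, c⃗, ε⃗] be a semitoric polygon. Then the semitoric packing density satisfies ρ_ST([Δ,c⃗,ε⃗]) = max { ‖q‖² / (2·area(Δ)) : q a vertex (extreme point) of 𝒫̃_ST([Δ,c⃗,ε⃗]) }, where 𝒫̃_ST([Δ,c⃗,ε⃗]) = {(λ₁, …, λ_d) ∈ ℝᵈ : λᵢ ≥ 0, λᵢ + λᵢ₊₁ ≤ ℓᵢ, and λᵢ ≤ αᵢ for all i (indices cyclic)}, with ℓᵢ the SL₂(ℤ)-length of the i-th semitoric edge and αᵢ the marked-point bound at the i-th hidden or Delzant corner. -/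

import Mathlib

open Matrix MeasureTheory Set

/-- Points of the plane. -/
abbrev Pt := Fin 2 → ℝ

/-- The action of `SL₂(ℤ)` on `ℝ²` by matrix-vector multiplication. -/
noncomputable def sl2Apply (M : Matrix.SpecialLinearGroup (Fin 2) ℤ) (x : Pt) : Pt :=
  ((M : Matrix (Fin 2) (Fin 2) ℤ).map (Int.cast : ℤ → ℝ)).mulVec x

/-- The model triangle `B(λ) = {(x,y) : x ≥ 0, y ≥ 0, x + y < λ}`. -/
def modelTriangle (lam : ℝ) : Set Pt :=
  {x | 0 ≤ x 0 ∧ 0 ≤ x 1 ∧ x 0 + x 1 < lam}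

/-- The area (Lebesgue measure) of a subset of the plane. -/
noncomputable def area (S : Set Pt) : ℝ := (volume S).toReal

/-- The element of the group `𝒯 × G_m` determined by a global power `n` of
`T = [[1,0],[1,1]]`, a vertical translation `t`, and cut flips `u` (with `u j ∈ {0, ε_j}`;
flipping the cut at the marked point `c j` applies `T^{± 1}` on the half-plane to its
right), as a piecewise affine map of the plane. -/
noncomputable def stMap {m : ℕ} (c : Fin m → Pt) (n : ℤ) (t : ℝ) (u : Fin m → ℤ)
    (x : Pt) : Pt :=
  ![x 0, x 1 + (n : ℝ) * x 0 + t + ∑ j, (u j : ℝ) * max (x 0 - c j 0) 0]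

/-- `B` is an admissibly packed triangle of `SL₂(ℤ)`-size `lam` at the point `p` of the
semitoric polygon with underlying set `Δ`, marked points `c` and cut directions `eps`:
in some equivalent representative (image under an element `σ` of `𝒯 × G_m`), `σ(B)` has
the form `M(B(lam)) + σ(p)` with `M ∈ SL₂(ℤ)`, coincides with the polygon near `σ(p)`,
and contains no marked point. -/
def IsSTPackedTriangleIn {m : ℕ} (Δ : Set Pt) (c : Fin m → Pt) (eps : Fin m → ℤ)
    (p : Pt) (lam : ℝ) (B : Set Pt) : Prop :=
  0 < lam ∧ B ⊆ Δ ∧ (∀ j, c j ∉ B) ∧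
  ∃ (n : ℤ) (t : ℝ) (u : Fin m → ℤ), (∀ j, u j = 0 ∨ u j = eps j) ∧
    (∃ M : Matrix.SpecialLinearGroup (Fin 2) ℤ,
        stMap c n t u '' B =
          (fun x => sl2Apply M x + stMap c n t u p) '' modelTriangle lam) ∧
    ∃ U : Set Pt, IsOpen U ∧ stMap c n t u p ∈ U ∧
      (stMap c n t u '' B) ∩ U = (stMap c n t u '' Δ) ∩ U

/-- `P` is a semitoric packing of the semitoric polygon `(Δ, c, eps)`: a finite union of
pairwise disjoint admissibly packed triangles, at most one at each vertex. -/
def IsSTPackingIn {m : ℕ} (Δ : Set Pt) (c : Fin m → Pt) (eps : Fin m → ℤ)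
    (P : Set Pt) : Prop :=
  ∃ (N : ℕ) (pt : Fin N → Pt) (lam : Fin N → ℝ) (tri : Fin N → Set Pt),
    P = (⋃ a, tri a) ∧ Function.Injective pt ∧
    (∀ a, pt a ∈ Set.extremePoints ℝ Δ) ∧
    (∀ a, IsSTPackedTriangleIn Δ c eps (pt a) (lam a) (tri a)) ∧
    Pairwise (Function.onFun Disjoint tri)

/-- The set of densities `area P / area Δ` of semitoric packings `P` of `(Δ, c, eps)`;
the semitoric packing density `ρ_ST` is its supremum. -/
def stDensitySet {m : ℕ} (Δ : Set Pt) (c : Fin m → Pt) (eps : Fin m → ℤ) : Set ℝ :=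
  {r : ℝ | ∃ P, IsSTPackingIn Δ c eps P ∧ r = area P / area Δ}

/-- The determinant of a pair of integer vectors in the plane. -/
def detZ (u v : Fin 2 → ℤ) : ℤ := u 0 * v 1 - u 1 * v 0

/-- The matrix `Tⁿ`, where `T = [[1,0],[1,1]]`. -/
def Tpow (n : ℤ) : Matrix (Fin 2) (Fin 2) ℤ := !![1, 0; n, 1]

/-- The combinatorial data of a semitoric polygon representative: a convex polygon with
vertices `V i` listed in clockwise order, the edge from `V i` to `V (i+1)` directed along
the primitive integer vector `dir i` with `SL₂(ℤ)`-length `len i`, together with marked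
points `c j` and cut directions `eps j ∈ {±1}`. -/
structure STRep (d m : ℕ) where
  V : Fin d → Pt
  dir : Fin d → Fin 2 → ℤ
  len : Fin d → ℝ
  c : Fin m → Pt
  eps : Fin m → ℤ

namespace STRep

variable {d m : ℕ}

/-- The underlying polygon (as a subset of the plane). -/
noncomputable def carrier (R : STRep d m) : Set Pt := convexHull ℝ (Set.range R.V)

/-- The cut of the marked point `c j` (the vertical ray from `c j` in the direction
`eps j`) meets the boundary of the polygon at the point `z`. -/
def CutHits (R : STRep d m) (j : Fin m) (z : Pt) : Prop :=
  z ∈ frontier R.carrier ∧ z 0 = R.c j 0 ∧ 0 ≤ (R.eps j : ℝ) * (z 1 - R.c j 1)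

/-- The number of cuts meeting the boundary of the polygon at the vertex `V i`. -/
noncomputable def numCuts (R : STRep d m) (i : Fin d) : ℕ :=
  Set.ncard {j | R.CutHits j (R.V i)}

/-- The first primitive integer vector emanating from the vertex `V i`
(so that `det (u1, u2) > 0` for a clockwise polygon). -/
def u1 [NeZero d] (R : STRep d m) (i : Fin d) : Fin 2 → ℤ := fun k => - R.dir (i - 1) k

/-- The second primitive integer vector emanating from the vertex `V i`. -/
def u2 (R : STRep d m) (i : Fin d) : Fin 2 → ℤ := R.dir i

/-- The vertex `V i` is a fake corner: at least one cut meets it and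
`det (u₁, Tᵏ u₂) = 0` where `k` is the number of cuts meeting it. -/
def IsFakeCorner [NeZero d] (R : STRep d m) (i : Fin d) : Prop :=
  0 < R.numCuts i ∧ detZ (R.u1 i) ((Tpow (R.numCuts i : ℤ)).mulVec (R.u2 i)) = 0

/-- The vertex `V i` is a hidden or Delzant corner (i.e. not a fake corner). -/
def IsHDCorner [NeZero d] (R : STRep d m) (i : Fin d) : Prop := ¬ R.IsFakeCorner i

/-- `R` is a valid semitoric polygon representative: the polygon is convex and rational
with vertices in clockwise order, the marked points lie in the interior, the cut
directions are `±1`, every point where exactly `k ≥ 1` cuts meet the boundary is a vertex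
satisfying the fake (`det (u₁, Tᵏ u₂) = 0`) or hidden (`det (u₁, Tᵏ u₂) = 1`) corner
condition, and every other vertex satisfies the Delzant condition
`det (u₁, u₂) = ±1`. -/
structure IsValid [NeZero d] (R : STRep d m) : Prop where
  three_le : 3 ≤ d
  len_pos : ∀ i, 0 < R.len i
  primitive : ∀ i, Int.gcd (R.dir i 0) (R.dir i 1) = 1
  edge_eq : ∀ i k, R.V (i + 1) k - R.V i k = R.len i * (R.dir i k : ℝ)
  clockwise : ∀ i, detZ (R.dir i) (R.dir (i + 1)) < 0
  edges_boundary : ∀ i, segment ℝ (R.V i) (R.V (i + 1)) ⊆ frontier R.carrier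
  marked_interior : ∀ j, R.c j ∈ interior R.carrier
  eps_pm : ∀ j, R.eps j = 1 ∨ R.eps j = -1
  cuts_at_vertices : ∀ j z, R.CutHits j z → ∃ i, z = R.V i
  corner_delzant : ∀ i, R.numCuts i = 0 →
    detZ (R.u1 i) (R.u2 i) = 1 ∨ detZ (R.u1 i) (R.u2 i) = -1
  corner_cut : ∀ i, 0 < R.numCuts i →
    detZ (R.u1 i) ((Tpow (R.numCuts i : ℤ)).mulVec (R.u2 i)) = 0 ∨
    detZ (R.u1 i) ((Tpow (R.numCuts i : ℤ)).mulVec (R.u2 i)) = 1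

end STRep

/-- An admissibly packed triangle in the semitoric polygon representative `R`. -/
def IsSTPackedTriangle {d m : ℕ} (R : STRep d m) (p : Pt) (lam : ℝ) (B : Set Pt) :
    Prop :=
  IsSTPackedTriangleIn R.carrier R.c R.eps p lam B

/-- `g` enumerates the hidden and Delzant corners of `R` in (clockwise) cyclic order:
`g` is strictly monotone and its range is exactly the set of hidden/Delzant corners. -/
def IsCornerEnum {d m D : ℕ} [NeZero d] (R : STRep d m) (g : Fin D → Fin d) : Prop :=
  StrictMono g ∧ ∀ i, R.IsHDCorner i ↔ ∃ a, g a = i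

/-- `P` is a semitoric packing of `R` whose triangle at the hidden/Delzant corner
`V (g a)` has `SL₂(ℤ)`-size `sz a` (with `sz a = 0` if no triangle is packed there). -/
def IsSTPacking {d m D : ℕ} (R : STRep d m) (g : Fin D → Fin d)
    (sz : Fin D → ℝ) (P : Set Pt) : Prop :=
  ∃ tri : Fin D → Set Pt,
    P = (⋃ a, tri a) ∧
    (∀ a, (sz a = 0 ∧ tri a = ∅) ∨
       IsSTPackedTriangle R (R.V (g a)) (sz a) (tri a)) ∧
    Pairwise (Function.onFun Disjoint tri)

/-- The number of steps from `s` to `i` going cyclically forwards in `Fin d`. -/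
def distCyc {d : ℕ} (s i : Fin d) : ℕ := (i.val + d - s.val) % d

/-- The number of edges in the cyclic chain of edges from vertex `s` to vertex `e`
(the whole cycle when `e = s`). -/
def chainLen {d : ℕ} (s e : Fin d) : ℕ := if e = s then d else distCyc s e

/-- The `SL₂(ℤ)`-length `ℓ_a` of the `a`-th semitoric edge: the sum of the
`SL₂(ℤ)`-lengths of the edges in the chain (joined at fake corners) connecting the
hidden/Delzant corner `V (g a)` to the next one `V (g (a+1))`. -/
noncomputable def stEdgeLen {d m D : ℕ} [NeZero D] (R : STRep d m) (g : Fin D → Fin d)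
    (a : Fin D) : ℝ :=
  ∑ i : Fin d, if distCyc (g a) i < chainLen (g a) (g (a + 1)) then R.len i else 0

/-- The point `q` lies on one of the two semitoric edges emanating from the
hidden/Delzant corner `V (g a)`, and `t` is the `SL₂(ℤ)`-length of the boundary path
(contained in that single semitoric edge) from `V (g a)` to `q`. -/
def OnEmanating {d m D : ℕ} [NeZero D] (R : STRep d m) (g : Fin D → Fin d)
    (a : Fin D) (q : Pt) (t : ℝ) : Prop :=
  (∃ (i : Fin d) (s : ℝ), distCyc (g a) i < chainLen (g a) (g (a + 1)) ∧
      0 ≤ s ∧ s ≤ R.len i ∧ (∀ k, q k = R.V i k + s * (R.dir i k : ℝ)) ∧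
      t = (∑ i' : Fin d, if distCyc (g a) i' < distCyc (g a) i then R.len i' else 0) + s) ∨
  (∃ (i : Fin d) (s : ℝ), distCyc (g (a - 1)) i < chainLen (g (a - 1)) (g a) ∧
      0 ≤ s ∧ s ≤ R.len i ∧ (∀ k, q k = R.V i k + s * (R.dir i k : ℝ)) ∧
      t = (∑ i' : Fin d, if distCyc (g (a - 1)) i < distCyc (g (a - 1)) i' ∧
              distCyc (g (a - 1)) i' < chainLen (g (a - 1)) (g a) then R.len i' else 0)
          + (R.len i - s))

/-- `lam ≤ α_a`, where `α_a` is the marked-point bound at the hidden/Delzant corner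
`V (g a)`: for each marked point `c j` whose vertical line meets a semitoric edge
emanating from `V (g a)`, taking the intersection point `q` whose boundary path from the
corner has minimal `SL₂(ℤ)`-length `t`, one has `lam ≤ t + b · |v₁ − w₁|`, where `b` is
the vertical distance from `c j` to `q` and `v, w` are the primitive integer vectors
directing the edges emanating from the corner. (`α_a = ∞` when there is no such marked
point, in which case this is no condition.) -/
def AlphaBound {d m D : ℕ} [NeZero d] [NeZero D] (R : STRep d m) (g : Fin D → Fin d)
    (a : Fin D) (lam : ℝ) : Prop :=
  ∀ (j : Fin m) (q : Pt) (t : ℝ),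
    OnEmanating R g a q t → q 0 = R.c j 0 →
    (∀ (q' : Pt) (t' : ℝ), OnEmanating R g a q' t' → q' 0 = R.c j 0 → t ≤ t') →
    lam ≤ t + |q 1 - R.c j 1| * |((R.dir (g a) 0 + R.dir (g a - 1) 0 : ℤ) : ℝ)|

/-- The polytope `𝒫̃_ST` of admissible size tuples:
`sz a ≥ 0`, `sz a + sz (a+1) ≤ ℓ_a` and `sz a ≤ α_a` for all `a` (cyclically). -/
def STPolytope {d m D : ℕ} [NeZero d] [NeZero D] (R : STRep d m)
    (g : Fin D → Fin d) : Set (Fin D → ℝ) :=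
  {sz | ∀ a, 0 ≤ sz a ∧ sz a + sz (a + 1) ≤ stEdgeLen R g a ∧ AlphaBound R g a (sz a)}

theorem Convex.interior_nonempty_of_triangle {S : Set Pt} (hS : Convex ℝ S) {A B C : Pt}
    (hA : A ∈ S) (hB : B ∈ S) (hC : C ∈ S)
    (h : (A 0 - C 0) * (B 1 - C 1) - (A 1 - C 1) * (B 0 - C 0) ≠ 0) :
    (interior S).Nonempty := by
  set Δ := (A 0 - C 0) * (B 1 - C 1) - (A 1 - C 1) * (B 0 - C 0) with hΔ
  let α : Pt → ℝ := fun y => ((y 0 - C 0) * (B 1 - C 1) - (y 1 - C 1) * (B 0 - C 0)) / Δ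
  let β : Pt → ℝ := fun y => ((A 0 - C 0) * (y 1 - C 1) - (A 1 - C 1) * (y 0 - C 0)) / Δ
  have hα : Continuous α := by fun_prop
  have hβ : Continuous β := by fun_prop
  have hopen : IsOpen {y | 0 < α y ∧ 0 < β y ∧ 0 < 1 - α y - β y} :=
    (isOpen_lt continuous_const hα).inter
      ((isOpen_lt continuous_const hβ).inter (isOpen_lt continuous_const ((continuous_const.sub hα).sub hβ)))
  have hsub : {y | 0 < α y ∧ 0 < β y ∧ 0 < 1 - α y - β y} ⊆ S := by
    rintro y ⟨h1, h2, h3⟩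
    have hy : y = (α y) • A + (β y) • B + (1 - α y - β y) • C := by
      ext k
      fin_cases k <;> simp [α, β] <;> field_simp <;> rw [hΔ] <;> ring
    rw [hy]
    have := hS.sum_mem (t := Finset.univ) (w := ![α y, β y, 1 - α y - β y]) (z := ![A, B, C])
      (by intro i _; fin_cases i <;> simp <;> linarith)
      (by simp [Fin.sum_univ_three]) (by intro i _; fin_cases i <;> simpa)
    simpa [Fin.sum_univ_three] using this
  refine ⟨(1 / 3 : ℝ) • A + (1 / 3 : ℝ) • B + (1 / 3 : ℝ) • C, interior_maximal hsub hopen ?_⟩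
  have e1 : α ((1 / 3 : ℝ) • A + (1 / 3 : ℝ) • B + (1 / 3 : ℝ) • C) = 1 / 3 := by
    simp [α]; field_simp; rw [hΔ]; ring
  have e2 : β ((1 / 3 : ℝ) • A + (1 / 3 : ℝ) • B + (1 / 3 : ℝ) • C) = 1 / 3 := by
    simp [β]; field_simp; rw [hΔ]; ring
  simp only [mem_ofPred_eq, e1, e2]
  norm_num

namespace STRep

variable {d m : ℕ} [NeZero d] {R : STRep d m}

theorem convex_carrier (R : STRep d m) : Convex ℝ R.carrier := convex_convexHull ℝ _

theorem V_mem (R : STRep d m) (i : Fin d) : R.V i ∈ R.carrier :=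
  subset_convexHull ℝ _ (mem_range_self i)

theorem V_succ (hR : R.IsValid) (i : Fin d) (k : Fin 2) :
    R.V (i + 1) k = R.V i k + R.len i * R.dir i k := by
  linarith [hR.edge_eq i k]

theorem V_eq_pred (hR : R.IsValid) (i : Fin d) (k : Fin 2) :
    R.V i k = R.V (i - 1) k + R.len (i - 1) * R.dir (i - 1) k := by
  have := V_succ hR (i - 1) k
  rwa [sub_add_cancel] at this

/-- The turning condition at a vertex, over the reals. -/
theorem turn (hR : R.IsValid) (i : Fin d) :
    (R.dir i 0 : ℝ) * R.dir (i + 1) 1 - R.dir i 1 * R.dir (i + 1) 0 < 0 := by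
  have := hR.clockwise i
  unfold detZ at this
  exact_mod_cast this

theorem turn_pred (hR : R.IsValid) (i : Fin d) :
    (R.dir (i - 1) 0 : ℝ) * R.dir i 1 - R.dir (i - 1) 1 * R.dir i 0 < 0 := by
  have := turn hR (i - 1)
  rwa [sub_add_cancel] at this

/-- Each edge spans a supporting line of the polygon. -/
theorem support (hR : R.IsValid) (i : Fin d) {z : Pt} (hz : z ∈ R.carrier) :
    (R.dir i 0 : ℝ) * (z 1 - R.V i 1) - R.dir i 1 * (z 0 - R.V i 0) ≤ 0 := by
  have ht := turn hR i
  have hl := hR.len_pos i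
  have hl' := hR.len_pos (i + 1)
  have e := V_succ hR i
  have e' := V_succ hR (i + 1)
  have hint : (interior R.carrier).Nonempty := by
    refine R.convex_carrier.interior_nonempty_of_triangle (R.V_mem i) (R.V_mem (i + 1 + 1))
      (R.V_mem (i + 1)) ?_
    rw [e' 0, e' 1, e 0, e 1]
    have : R.len i * R.len (i + 1) * ((R.dir i 0 : ℝ) * R.dir (i + 1) 1 -
      R.dir i 1 * R.dir (i + 1) 0) < 0 := mul_neg_of_pos_of_neg (by positivity) ht
    intro h
    nlinarith
  set M : Pt := midpoint ℝ (R.V i) (R.V (i + 1)) with hM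
  have hMf : M ∈ frontier R.carrier := hR.edges_boundary i (midpoint_mem_segment _ _)
  obtain ⟨f, u, hf0, hfu, hfM⟩ := geometric_hahn_banach_of_nonempty_interior R.convex_carrier
    (convex_singleton M) (disjoint_singleton_right.2 hMf.2) hint (singleton_nonempty M)
  have hfM := hfM M rfl
  have hlin : ∀ x : Pt, f x = x 0 * f (Pi.single 0 1) + x 1 * f (Pi.single 1 1) := by
    intro x
    have hx : x = x 0 • Pi.single 0 1 + x 1 • Pi.single 1 1 := by
      ext k; fin_cases k <;> simp
    conv_lhs => rw [hx]
    simp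
  set a := f (Pi.single 0 1)
  set b := f (Pi.single 1 1)
  have hab : a ≠ 0 ∨ b ≠ 0 := by
    by_contra! h
    apply hf0
    ext x
    rw [hlin, h.1, h.2]
    simp
  have m0 : M 0 = R.V i 0 + R.len i / 2 * R.dir i 0 := by
    simp [hM, midpoint_eq_smul_add, e 0]; ring
  have m1 : M 1 = R.V i 1 + R.len i / 2 * R.dir i 1 := by
    simp [hM, midpoint_eq_smul_add, e 1]; ring
  rw [hlin, m0, m1] at hfM
  have h1 := hfu _ (R.V_mem i)
  have h2 := hfu _ (R.V_mem (i + 1))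
  have h3 := hfu _ (R.V_mem (i + 1 + 1))
  have h4 := hfu _ hz
  rw [hlin] at h1 h2 h3 h4
  rw [e 0, e 1] at h2
  rw [e' 0, e' 1, e 0, e 1] at h3
  set p := (R.dir i 0 : ℝ)
  set q := (R.dir i 1 : ℝ)
  set p' := (R.dir (i + 1) 0 : ℝ)
  set q' := (R.dir (i + 1) 1 : ℝ)
  have hd : p * a + q * b = 0 := by
    have k1 : R.len i * (p * a + q * b) ≤ 0 := by nlinarith
    have k2 : 0 ≤ R.len i * (p * a + q * b) := by nlinarith
    have := le_antisymm k1 k2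
    exact (mul_eq_zero.1 this).resolve_left hl.ne'
  have hdl : R.len i * (p * a + q * b) = 0 := by rw [hd, mul_zero]
  have h5 : p' * a + q' * b ≤ 0 := by
    have : R.len (i + 1) * (p' * a + q' * b) ≤ 0 := by nlinarith
    exact nonpos_of_mul_nonpos_right this hl'
  have h6 : (z 0 - R.V i 0) * a + (z 1 - R.V i 1) * b ≤ 0 := by nlinarith
  by_contra! hcon
  set X := z 0 - R.V i 0
  set Y := z 1 - R.V i 1
  rcases hab with h | h
  · have : a ^ 2 * (p * Y - q * X) * (p * q' - q * p') ≥ 0 := by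
      have e1 : a * (p * Y - q * X) = -q * (X * a + Y * b) := by linear_combination Y * hd
      have e2 : a * (p * q' - q * p') = -q * (p' * a + q' * b) := by linear_combination q' * hd
      have : a ^ 2 * (p * Y - q * X) * (p * q' - q * p') =
        q ^ 2 * ((X * a + Y * b) * (p' * a + q' * b)) := by
        linear_combination (a * (p * q' - q * p')) * e1 + (-q * (X * a + Y * b)) * e2
      rw [this]
      exact mul_nonneg (sq_nonneg q) (mul_nonneg_of_nonpos_of_nonpos h6 h5)
    have : a ^ 2 * (p * Y - q * X) * (p * q' - q * p') < 0 :=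
      mul_neg_of_pos_of_neg (mul_pos (by positivity) hcon) ht
    linarith
  · have : b ^ 2 * (p * Y - q * X) * (p * q' - q * p') ≥ 0 := by
      have e1 : b * (p * Y - q * X) = p * (X * a + Y * b) := by linear_combination -X * hd
      have e2 : b * (p * q' - q * p') = p * (p' * a + q' * b) := by linear_combination -p' * hd
      have : b ^ 2 * (p * Y - q * X) * (p * q' - q * p') =
        p ^ 2 * ((X * a + Y * b) * (p' * a + q' * b)) := by
        linear_combination (b * (p * q' - q * p')) * e1 + (p * (X * a + Y * b)) * e2
      rw [this]
      exact mul_nonneg (sq_nonneg p) (mul_nonneg_of_nonpos_of_nonpos h6 h5)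
    have : b ^ 2 * (p * Y - q * X) * (p * q' - q * p') < 0 :=
      mul_neg_of_pos_of_neg (mul_pos (by positivity) hcon) ht
    linarith

/-- The supporting line of the edge ending at `V i`. -/
theorem support_pred (hR : R.IsValid) (i : Fin d) {z : Pt} (hz : z ∈ R.carrier) :
    (R.dir (i - 1) 0 : ℝ) * (z 1 - R.V i 1) - R.dir (i - 1) 1 * (z 0 - R.V i 0) ≤ 0 := by
  have h := support hR (i - 1) hz
  rw [V_eq_pred hR i 0, V_eq_pred hR i 1]
  linarith

theorem edge_mem (hR : R.IsValid) (i : Fin d) {s : ℝ} (h0 : 0 ≤ s) (h1 : s ≤ R.len i) {q : Pt}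
    (hq : ∀ k, q k = R.V i k + s * R.dir i k) : q ∈ segment ℝ (R.V i) (R.V (i + 1)) := by
  have hl := hR.len_pos i
  refine ⟨1 - s / R.len i, s / R.len i, ?_, by positivity, by ring, ?_⟩
  · rw [sub_nonneg, div_le_one hl]; exact h1
  · ext k
    simp only [Pi.add_apply, Pi.smul_apply, smul_eq_mul, hq k, V_succ hR i k]
    field_simp
    ring

theorem edge_mem_carrier (hR : R.IsValid) (i : Fin d) {s : ℝ} (h0 : 0 ≤ s) (h1 : s ≤ R.len i)
    {q : Pt} (hq : ∀ k, q k = R.V i k + s * R.dir i k) : q ∈ R.carrier :=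
  R.convex_carrier.segment_subset (R.V_mem i) (R.V_mem (i + 1)) (edge_mem hR i h0 h1 hq)

theorem edge_mem_frontier (hR : R.IsValid) (i : Fin d) {s : ℝ} (h0 : 0 ≤ s) (h1 : s ≤ R.len i)
    {q : Pt} (hq : ∀ k, q k = R.V i k + s * R.dir i k) : q ∈ frontier R.carrier :=
  hR.edges_boundary i (edge_mem hR i h0 h1 hq)

/-- Induction along the cyclic order. -/
theorem cyc_induction {P : Fin d → Prop} (i₀ : Fin d) (h0 : P i₀) (hs : ∀ i, P i → P (i + 1))
    (i : Fin d) : P i := by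
  have key : ∀ n : ℕ, P (i₀ + Fin.ofNat d n) := by
    intro n
    induction n with
    | zero => simpa using h0
    | succ n ih =>
      have := hs _ ih
      convert this using 1
      rw [add_assoc]
      congr 1
      ext
      simp [Fin.val_add, Fin.ofNat]
  have := key (i - i₀).val
  simpa using this

theorem exists_edge_right (hR : R.IsValid) {x : ℝ} {p q : Fin d} (hp : R.V p 0 ≤ x)
    (hq : x < R.V q 0) : ∃ i, 0 < R.dir i 0 ∧ R.V i 0 ≤ x ∧ x < R.V (i + 1) 0 := by
  by_contra! h
  have : ∀ i, R.V i 0 ≤ x := by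
    refine cyc_induction p hp fun i hi => ?_
    by_contra! h1
    have h2 : ¬ 0 < R.dir i 0 := fun h2 => absurd (h i h2 hi) (not_le.2 h1)
    have := V_succ hR i 0
    have h3 : (R.dir i 0 : ℝ) ≤ 0 := by exact_mod_cast not_lt.1 h2
    nlinarith [hR.len_pos i]
  exact absurd (this q) (not_le.2 hq)

theorem exists_edge_left (hR : R.IsValid) {x : ℝ} {p q : Fin d} (hp : R.V p 0 < x)
    (hq : x ≤ R.V q 0) : ∃ i, 0 < R.dir i 0 ∧ R.V i 0 < x ∧ x ≤ R.V (i + 1) 0 := by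
  by_contra! h
  have : ∀ i, R.V i 0 < x := by
    refine cyc_induction p hp fun i hi => ?_
    by_contra! h1
    have h2 : ¬ 0 < R.dir i 0 := fun h2 => absurd (h i h2 hi) (not_lt.2 h1)
    have := V_succ hR i 0
    have h3 : (R.dir i 0 : ℝ) ≤ 0 := by exact_mod_cast not_lt.1 h2
    nlinarith [hR.len_pos i]
  exact absurd (this q) (not_lt.2 hq)

/-- The first coordinate of a point of the polygon is bounded by that of a vertex. -/
theorem exists_V_le (R : STRep d m) {z : Pt} (hz : z ∈ R.carrier) : ∃ i, R.V i 0 ≤ z 0 := by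
  by_contra! h
  have : R.carrier ⊆ {y | z 0 < y 0} := convexHull_min (by rintro _ ⟨i, rfl⟩; exact h i)
    (convex_halfSpace_gt (LinearMap.proj (R := ℝ) (φ := fun _ : Fin 2 => ℝ) 0).isLinear _)
  have h2 : z 0 < z 0 := this hz
  exact lt_irrefl _ h2

theorem exists_le_V (R : STRep d m) {z : Pt} (hz : z ∈ R.carrier) : ∃ i, z 0 ≤ R.V i 0 := by
  by_contra! h
  have : R.carrier ⊆ {y | y 0 < z 0} := convexHull_min (by rintro _ ⟨i, rfl⟩; exact h i)
    (convex_halfSpace_lt (LinearMap.proj (R := ℝ) (φ := fun _ : Fin 2 => ℝ) 0).isLinear _)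
  have h2 : z 0 < z 0 := this hz
  exact lt_irrefl _ h2

/-- No vertex lies in the relative interior of an edge. -/
theorem V_ne_edge (hR : R.IsValid) (i k : Fin d) {s : ℝ} (h0 : 0 < s) (h1 : s < R.len i) :
    ¬ ∀ c, R.V k c = R.V i c + s * R.dir i c := by
  intro h
  have a1 := support hR k (R.V_mem i)
  have a2 := support hR k (R.V_mem (i + 1))
  have b1 := support_pred hR k (R.V_mem i)
  have b2 := support_pred hR k (R.V_mem (i + 1))
  rw [V_succ hR i 0, V_succ hR i 1] at a2 b2
  rw [h 0, h 1] at a1 a2 b1 b2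
  have ht := turn_pred hR k
  set p := (R.dir i 0 : ℝ)
  set q := (R.dir i 1 : ℝ)
  have hs : 0 < R.len i - s := by linarith
  have a3 : (R.dir k 0 : ℝ) * q - R.dir k 1 * p = 0 := by
    apply le_antisymm
    · have : (R.len i - s) * ((R.dir k 0 : ℝ) * q - R.dir k 1 * p) ≤ 0 := by linarith
      exact nonpos_of_mul_nonpos_right this hs
    · have : s * ((R.dir k 0 : ℝ) * q - R.dir k 1 * p) ≥ 0 := by linarith
      exact nonneg_of_mul_nonneg_right this h0
  have b3 : (R.dir (k - 1) 0 : ℝ) * q - R.dir (k - 1) 1 * p = 0 := by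
    apply le_antisymm
    · have : (R.len i - s) * ((R.dir (k - 1) 0 : ℝ) * q - R.dir (k - 1) 1 * p) ≤ 0 := by linarith
      exact nonpos_of_mul_nonpos_right this hs
    · have : s * ((R.dir (k - 1) 0 : ℝ) * q - R.dir (k - 1) 1 * p) ≥ 0 := by linarith
      exact nonneg_of_mul_nonneg_right this h0
  set D := (R.dir (k - 1) 0 : ℝ) * R.dir k 1 - R.dir (k - 1) 1 * R.dir k 0
  have hp : D * p = 0 := by
    simp only [D]; linear_combination (-(R.dir (k - 1) 0 : ℝ)) * a3 + (R.dir k 0 : ℝ) * b3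
  have hq : D * q = 0 := by
    simp only [D]; linear_combination (-(R.dir (k - 1) 1 : ℝ)) * a3 + (R.dir k 1 : ℝ) * b3
  have hp0 := (mul_eq_zero.1 hp).resolve_left ht.ne
  have hq0 := (mul_eq_zero.1 hq).resolve_left ht.ne
  have hg := hR.primitive i
  rw [Int.cast_eq_zero.1 hp0, Int.cast_eq_zero.1 hq0] at hg
  simp at hg

/-- A vertex at which the boundary does not turn back from right to left is not rightmost. -/
theorem le_V_of_turn (hR : R.IsValid) (i : Fin d) (h1 : 0 ≤ R.dir (i - 1) 0) (h2 : R.dir i 0 ≤ 0)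
    {z : Pt} (hz : z ∈ R.carrier) : z 0 ≤ R.V i 0 := by
  have a := support hR i hz
  have b := support_pred hR i hz
  have ht := turn_pred hR i
  have h1' : (0 : ℝ) ≤ R.dir (i - 1) 0 := by exact_mod_cast h1
  have h2' : (R.dir i 0 : ℝ) ≤ 0 := by exact_mod_cast h2
  by_contra! h
  set D := (R.dir (i - 1) 0 : ℝ) * R.dir i 1 - R.dir (i - 1) 1 * R.dir i 0
  have : D * (z 0 - R.V i 0) ≥ 0 := by
    have : D * (z 0 - R.V i 0) = (R.dir i 0 : ℝ) * ((R.dir (i - 1) 0 : ℝ) * (z 1 - R.V i 1) -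
      R.dir (i - 1) 1 * (z 0 - R.V i 0)) - R.dir (i - 1) 0 * ((R.dir i 0 : ℝ) * (z 1 - R.V i 1) -
      R.dir i 1 * (z 0 - R.V i 0)) := by simp only [D]; ring
    rw [this]
    have := mul_nonneg_of_nonpos_of_nonpos h2' b
    have := mul_nonpos_of_nonneg_of_nonpos h1' a
    linarith
  have := mul_neg_of_neg_of_pos ht (sub_pos.2 h)
  linarith

theorem V_le_of_turn (hR : R.IsValid) (i : Fin d) (h1 : R.dir (i - 1) 0 ≤ 0) (h2 : 0 ≤ R.dir i 0)
    {z : Pt} (hz : z ∈ R.carrier) : R.V i 0 ≤ z 0 := by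
  have a := support hR i hz
  have b := support_pred hR i hz
  have ht := turn_pred hR i
  have h1' : (R.dir (i - 1) 0 : ℝ) ≤ 0 := by exact_mod_cast h1
  have h2' : (0 : ℝ) ≤ R.dir i 0 := by exact_mod_cast h2
  by_contra! h
  set D := (R.dir (i - 1) 0 : ℝ) * R.dir i 1 - R.dir (i - 1) 1 * R.dir i 0
  have : D * (z 0 - R.V i 0) ≤ 0 := by
    have : D * (z 0 - R.V i 0) = (R.dir i 0 : ℝ) * ((R.dir (i - 1) 0 : ℝ) * (z 1 - R.V i 1) -
      R.dir (i - 1) 1 * (z 0 - R.V i 0)) - R.dir (i - 1) 0 * ((R.dir i 0 : ℝ) * (z 1 - R.V i 1) -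
      R.dir i 1 * (z 0 - R.V i 0)) := by simp only [D]; ring
    rw [this]
    have := mul_nonpos_of_nonneg_of_nonpos h2' b
    have := mul_nonneg_of_nonpos_of_nonpos h1' a
    linarith
  have := mul_pos_of_neg_of_neg ht (sub_neg.2 h)
  linarith

end STRep

theorem Set.mem_frontier_neg {S : Set Pt} {z : Pt} : z ∈ frontier (-S) ↔ -z ∈ frontier S := by
  have := (Homeomorph.neg Pt).preimage_frontier S
  have h : (Homeomorph.neg Pt) ⁻¹' S = -S := by ext; simp
  have h' : (Homeomorph.neg Pt) ⁻¹' frontier S = -frontier S := by ext; simp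
  rw [← h, ← this, h']
  simp

theorem Set.mem_interior_neg {S : Set Pt} {z : Pt} : z ∈ interior (-S) ↔ -z ∈ interior S := by
  have := (Homeomorph.neg Pt).preimage_interior S
  have h : (Homeomorph.neg Pt) ⁻¹' S = -S := by ext; simp
  have h' : (Homeomorph.neg Pt) ⁻¹' interior S = -interior S := by ext; simp
  rw [← h, ← this, h']
  simp

namespace STRep

variable {d m : ℕ} [NeZero d] {R : STRep d m}

/-- The image of a semitoric polygon under the rotation by a half turn. -/
def neg (R : STRep d m) : STRep d m where
  V i := -R.V i
  dir i k := -R.dir i k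
  len := R.len
  c j := -R.c j
  eps j := -R.eps j

theorem neg_neg (R : STRep d m) : R.neg.neg = R := by
  cases R
  simp [neg]

theorem mem_carrier_neg {z : Pt} : z ∈ R.neg.carrier ↔ -z ∈ R.carrier := by
  have : R.neg.carrier = -R.carrier := by
    unfold carrier neg
    rw [← convexHull_neg]
    congr 1
    ext x
    simp [neg_eq_iff_eq_neg]
  rw [this]; simp

theorem carrier_neg : R.neg.carrier = -R.carrier := by
  ext z; simp [mem_carrier_neg]

theorem cutHits_neg {j : Fin m} {z : Pt} : R.neg.CutHits j z ↔ R.CutHits j (-z) := by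
  unfold CutHits
  rw [carrier_neg, Set.mem_frontier_neg]
  simp only [neg, Pi.neg_apply, Int.cast_neg, neg_eq_iff_eq_neg]
  have : -(R.eps j : ℝ) * (z 1 - -R.c j 1) = R.eps j * (-z 1 - R.c j 1) := by ring
  rw [this]

theorem numCuts_neg (i : Fin d) : R.neg.numCuts i = R.numCuts i := by
  unfold numCuts
  simp only [cutHits_neg]
  simp [neg]

theorem detZ_corner (R : STRep d m) (i : Fin d) (n : ℤ) :
    detZ (R.u1 i) ((Tpow n).mulVec (R.u2 i)) =
      R.dir (i - 1) 1 * R.dir i 0 - R.dir (i - 1) 0 * R.dir i 1 -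
        n * (R.dir (i - 1) 0 * R.dir i 0) := by
  simp [detZ, Tpow, u1, u2, Matrix.mulVec, dotProduct, Fin.sum_univ_two]
  ring

theorem detZ_corner' (R : STRep d m) (i : Fin d) :
    detZ (R.u1 i) (R.u2 i) =
      R.dir (i - 1) 1 * R.dir i 0 - R.dir (i - 1) 0 * R.dir i 1 := by
  simp [detZ, u1, u2]
  ring

theorem isFakeCorner_neg (i : Fin d) : R.neg.IsFakeCorner i ↔ R.IsFakeCorner i := by
  unfold IsFakeCorner
  rw [numCuts_neg, detZ_corner, detZ_corner]
  simp [neg]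

theorem IsValid.neg (hR : R.IsValid) : R.neg.IsValid where
  three_le := hR.three_le
  len_pos := hR.len_pos
  primitive i := by simpa [STRep.neg] using hR.primitive i
  edge_eq i k := by
    have := hR.edge_eq i k
    simp only [STRep.neg, Pi.neg_apply, Int.cast_neg]
    linarith
  clockwise i := by simpa [STRep.neg, detZ] using hR.clockwise i
  edges_boundary i z hz := by
    rw [carrier_neg, Set.mem_frontier_neg]
    refine hR.edges_boundary i ?_
    obtain ⟨a, b, ha, hb, hab, rfl⟩ := hz
    refine ⟨a, b, ha, hb, hab, ?_⟩
    simp [STRep.neg]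
    abel
  marked_interior j := by
    rw [carrier_neg, Set.mem_interior_neg]
    simpa [STRep.neg] using hR.marked_interior j
  eps_pm j := by
    rcases hR.eps_pm j with h | h <;> simp [STRep.neg, h]
  cuts_at_vertices j z hz := by
    obtain ⟨i, hi⟩ := hR.cuts_at_vertices j _ (cutHits_neg.1 hz)
    exact ⟨i, by simp [STRep.neg, ← hi]⟩
  corner_delzant i h := by
    rw [numCuts_neg] at h
    have := hR.corner_delzant i h
    rw [detZ_corner'] at this ⊢
    simpa [STRep.neg] using this
  corner_cut i h := by
    rw [numCuts_neg] at h
    have := hR.corner_cut i h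
    rw [detZ_corner, ← numCuts_neg] at this
    rw [detZ_corner]
    simpa [STRep.neg] using this

end STRep

/-- A continuous function which is piecewise affine with decreasing slopes near each interior
point is concave. -/
theorem concaveOn_of_germs {F : ℝ → ℝ} {a b : ℝ} (hc : ContinuousOn F (Icc a b))
    (h : ∀ x ∈ Ioo a b, ∃ ml mr : ℝ, mr ≤ ml ∧ ∃ δ > 0, ∀ s, 0 ≤ s → s ≤ δ →
      F (x + s) = F x + mr * s ∧ F (x - s) = F x - ml * s) : ConcaveOn ℝ (Icc a b) F := by
  refine LinearOrder.concaveOn_of_lt (convex_Icc a b) ?_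
  intro x hx y hy hxy p q hp hq hpq
  by_contra! hlt
  simp only [smul_eq_mul] at hlt
  set c := (F y - F x) / (y - x) with hcdef
  have hyx : 0 < y - x := sub_pos.2 hxy
  have hcm : c * (y - x) = F y - F x := div_mul_cancel₀ _ hyx.ne'
  set G : ℝ → ℝ := fun z => F z - F x - c * (z - x) with hG
  have hsub : Icc x y ⊆ Icc a b := Icc_subset_Icc hx.1 hy.2
  have hGc : ContinuousOn G (Icc x y) :=
    ((hc.mono hsub).sub continuousOn_const).sub (by fun_prop)
  set w := p * x + q * y with hw
  have hwI : w ∈ Icc x y := by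
    have hp' : p = 1 - q := by linarith
    constructor <;> simp only [hw, hp'] <;> nlinarith
  have hGw : G w < 0 := by
    have e : w - x = q * (y - x) := by rw [hw]; linear_combination x * hpq
    have : c * (w - x) = q * (F y - F x) := by rw [e]; linear_combination q * hcm
    simp only [hG, this]
    have hp' : p = 1 - q := by linarith
    rw [hp'] at hlt
    linarith
  obtain ⟨z₀, hz₀, hmin⟩ := isCompact_Icc.exists_isMinOn ⟨w, hwI⟩ hGc
  have hK : IsCompact (Icc x y ∩ G ⁻¹' {G z₀}) :=
    isCompact_Icc.of_isClosed_subset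
      (hGc.preimage_isClosed_of_isClosed isClosed_Icc isClosed_singleton) inter_subset_left
  obtain ⟨z, hz, hzmax⟩ := hK.exists_isGreatest ⟨z₀, hz₀, rfl⟩
  have hGz : G z = G z₀ := hz.2
  have hneg : G z < 0 := by rw [hGz]; exact (hmin hwI).trans_lt hGw
  have hGx : G x = 0 := by simp [hG]
  have hGy : G y = 0 := by simp only [hG]; linarith
  have hzx : x < z := lt_of_le_of_ne hz.1.1 (by rintro rfl; linarith)
  have hzy : z < y := lt_of_le_of_ne hz.1.2 (by rintro rfl; linarith)
  obtain ⟨ml, mr, hm, δ, hδ, hs⟩ := h z ⟨hx.1.trans_lt hzx, hzy.trans_le hy.2⟩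
  set s := min δ (min (z - x) (y - z)) with hsdef
  have hs0 : 0 < s := by
    simp only [hsdef, lt_min_iff]; exact ⟨hδ, by linarith, by linarith⟩
  have hs1 : s ≤ δ := min_le_left _ _
  have hs2 : s ≤ z - x := (min_le_right _ _).trans (min_le_left _ _)
  have hs3 : s ≤ y - z := (min_le_right _ _).trans (min_le_right _ _)
  obtain ⟨e1, e2⟩ := hs s hs0.le hs1
  have i1 : z + s ∈ Icc x y := ⟨by linarith, by linarith⟩
  have i2 : z - s ∈ Icc x y := ⟨by linarith, by linarith⟩
  have g1 : G (z + s) = G z + (mr - c) * s := by simp only [hG, e1]; ring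
  have g2 : G (z - s) = G z - (ml - c) * s := by simp only [hG, e2]; ring
  have k1 : G z₀ ≤ G (z + s) := hmin i1
  have k2 : G z₀ ≤ G (z - s) := hmin i2
  have k3 : G (z + s) ≠ G z₀ := by
    intro h
    have : z + s ≤ z := hzmax ⟨i1, h⟩
    linarith
  have k4 : G z₀ < G (z + s) := lt_of_le_of_ne k1 (Ne.symm k3)
  rw [g1, hGz] at k4
  rw [g2, hGz] at k2
  nlinarith

namespace STRep

variable {d m : ℕ} [NeZero d] {R : STRep d m}

/-- The range of the first coordinate on the polygon. -/
def xRange (R : STRep d m) : Set ℝ := {x | (∃ p, R.V p 0 ≤ x) ∧ ∃ q, x ≤ R.V q 0}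

theorem mem_xRange {z : Pt} (hz : z ∈ R.carrier) : z 0 ∈ R.xRange :=
  ⟨R.exists_V_le hz, R.exists_le_V hz⟩

theorem V_mem_xRange (R : STRep d m) (i : Fin d) : R.V i 0 ∈ R.xRange := ⟨⟨i, le_rfl⟩, ⟨i, le_rfl⟩⟩

theorem ordConnected_xRange (R : STRep d m) : OrdConnected R.xRange :=
  ⟨fun _ ⟨⟨p, hp⟩, _⟩ _ ⟨_, ⟨q, hq⟩⟩ _ hz => ⟨⟨p, hp.trans hz.1⟩, ⟨q, hz.2.trans hq⟩⟩⟩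

theorem neg_mem_xRange_neg {x : ℝ} : -x ∈ R.neg.xRange ↔ x ∈ R.xRange := by
  simp [xRange, neg, and_comm]

/-- The line spanned by an edge, as a function of the first coordinate. -/
noncomputable def edgeLine (R : STRep d m) (i : Fin d) (x : ℝ) : ℝ :=
  R.V i 1 + R.dir i 1 / R.dir i 0 * (x - R.V i 0)

open Classical in
/-- The upper boundary of the polygon, as a function of the first coordinate. -/
noncomputable def topF (R : STRep d m) (x : ℝ) : ℝ :=
  if h : (Finset.univ.filter fun i => 0 < R.dir i 0).Nonempty then
    (Finset.univ.filter fun i => 0 < R.dir i 0).inf' h fun i => R.edgeLine i x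
  else 0

/-- The lower boundary of the polygon, as a function of the first coordinate. -/
noncomputable def botF (R : STRep d m) (x : ℝ) : ℝ := -R.neg.topF (-x)

theorem topF_neg (x : ℝ) : R.neg.topF x = -R.botF (-x) := by
  simp [botF]

theorem continuous_topF (R : STRep d m) : Continuous R.topF := by
  classical
  unfold topF
  split_ifs with h
  · exact Continuous.finset_inf'_apply h fun i _ => by unfold edgeLine; fun_prop
  · exact continuous_const

theorem dir_zero_pos_cast {i : Fin d} (h : 0 < R.dir i 0) : (0 : ℝ) < R.dir i 0 := by
  exact_mod_cast h

theorem exists_dir_pos (hR : R.IsValid) : ∃ i, 0 < R.dir i 0 := by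
  by_contra! h
  have h1 : ∀ i, R.V (i + 1) 0 ≤ R.V i 0 := fun i => by
    have := V_succ hR i 0
    have h3 : (R.dir i 0 : ℝ) ≤ 0 := by exact_mod_cast h i
    nlinarith [hR.len_pos i]
  obtain ⟨p, hp⟩ := Finite.exists_min fun i => R.V i 0
  have h2 : ∀ i, R.V i 0 = R.V p 0 :=
    cyc_induction p rfl fun i hi => le_antisymm (hi ▸ h1 i) (hp _)
  have h3 : ∀ i, R.dir i 0 = 0 := fun i => by
    have := V_succ hR i 0
    rw [h2, h2 i] at this
    have : R.len i * (R.dir i 0 : ℝ) = 0 := by linarith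
    exact_mod_cast (mul_eq_zero.1 this).resolve_left (hR.len_pos i).ne'
  have := hR.clockwise 0
  simp [detZ, h3] at this

theorem le_topF (hR : R.IsValid) {z : Pt} (hz : z ∈ R.carrier) : z 1 ≤ R.topF (z 0) := by
  classical
  obtain ⟨i, hi⟩ := exists_dir_pos hR
  have h : (Finset.univ.filter fun i => 0 < R.dir i 0).Nonempty := ⟨i, by simpa⟩
  rw [topF, dif_pos h]
  refine Finset.le_inf' _ _ fun k hk => ?_
  have hk := dir_zero_pos_cast (Finset.mem_filter.1 hk).2
  have := support hR k hz
  unfold edgeLine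
  rw [div_mul_eq_mul_div, ← sub_le_iff_le_add', le_div_iff₀ hk]
  linarith

theorem topF_edge (hR : R.IsValid) {i : Fin d} (hi : 0 < R.dir i 0) {s : ℝ} (h0 : 0 ≤ s)
    (h1 : s ≤ R.len i) : R.topF (R.V i 0 + s * R.dir i 0) = R.V i 1 + s * R.dir i 1 := by
  classical
  apply le_antisymm
  · have h : (Finset.univ.filter fun i => 0 < R.dir i 0).Nonempty := ⟨i, by simpa⟩
    rw [topF, dif_pos h]
    refine (Finset.inf'_le _ (b := i) (by simpa)).trans_eq ?_
    have := dir_zero_pos_cast hi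
    unfold edgeLine
    field_simp
    ring
  · have := le_topF hR (edge_mem_carrier hR i h0 h1
      (q := fun k => R.V i k + s * R.dir i k) fun _ => rfl)
    exact this

theorem topF_V (hR : R.IsValid) {i : Fin d} (hi : 0 < R.dir i 0) : R.topF (R.V i 0) = R.V i 1 := by
  simpa using topF_edge hR hi le_rfl (hR.len_pos i).le

theorem topF_V_succ (hR : R.IsValid) {i : Fin d} (hi : 0 < R.dir (i - 1) 0) :
    R.topF (R.V i 0) = R.V i 1 := by
  have := topF_edge hR hi (hR.len_pos (i - 1)).le le_rfl
  rwa [← V_eq_pred hR, ← V_eq_pred hR] at this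

theorem exists_param (hR : R.IsValid) {i : Fin d} (hi : 0 < R.dir i 0) {x : ℝ}
    (h0 : R.V i 0 ≤ x) (h1 : x ≤ R.V (i + 1) 0) :
    ∃ s, 0 ≤ s ∧ s ≤ R.len i ∧ x = R.V i 0 + s * R.dir i 0 := by
  have hi := dir_zero_pos_cast hi
  refine ⟨(x - R.V i 0) / R.dir i 0, div_nonneg (by linarith) hi.le, ?_, by field_simp; ring⟩
  rw [div_le_iff₀ hi]
  linarith [V_succ hR i 0]

theorem exists_edge (hR : R.IsValid) {x : ℝ} (hx : x ∈ R.xRange) :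
    ∃ i s, 0 < R.dir i 0 ∧ 0 ≤ s ∧ s ≤ R.len i ∧ x = R.V i 0 + s * R.dir i 0 := by
  obtain ⟨⟨p, hp⟩, ⟨q, hq⟩⟩ := hx
  obtain ⟨k, hk⟩ := exists_dir_pos hR
  have hk' : R.V k 0 < R.V (k + 1) 0 := by
    have := mul_pos (hR.len_pos k) (dir_zero_pos_cast hk)
    linarith [V_succ hR k 0]
  rcases lt_or_ge x (R.V (k + 1) 0) with h | h
  · obtain ⟨i, hi, h1, h2⟩ := exists_edge_right hR hp h
    obtain ⟨s, hs⟩ := exists_param hR hi h1 h2.le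
    exact ⟨i, s, hi, hs⟩
  · obtain ⟨i, hi, h1, h2⟩ := exists_edge_left hR (hk'.trans_le h) hq
    obtain ⟨s, hs⟩ := exists_param hR hi h1.le h2
    exact ⟨i, s, hi, hs⟩

theorem topF_mem_frontier (hR : R.IsValid) {x : ℝ} (hx : x ∈ R.xRange) :
    ![x, R.topF x] ∈ frontier R.carrier := by
  obtain ⟨i, s, hi, h0, h1, rfl⟩ := exists_edge hR hx
  refine edge_mem_frontier hR i h0 h1 fun k => ?_
  fin_cases k
  · simp
  · simp [topF_edge hR hi h0 h1]

theorem topF_mem (hR : R.IsValid) {x : ℝ} (hx : x ∈ R.xRange) :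
    ![x, R.topF x] ∈ R.carrier := by
  obtain ⟨i, s, hi, h0, h1, rfl⟩ := exists_edge hR hx
  refine edge_mem_carrier hR i h0 h1 fun k => ?_
  fin_cases k
  · simp
  · simp [topF_edge hR hi h0 h1]

theorem botF_mem (hR : R.IsValid) {x : ℝ} (hx : x ∈ R.xRange) :
    ![x, R.botF x] ∈ R.carrier := by
  have := topF_mem hR.neg (neg_mem_xRange_neg.2 hx)
  rw [mem_carrier_neg, topF_neg] at this
  convert this using 1
  ext k; fin_cases k <;> simp

theorem botF_le (hR : R.IsValid) {z : Pt} (hz : z ∈ R.carrier) : R.botF (z 0) ≤ z 1 := by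
  have := le_topF hR.neg (z := -z) (by simpa [mem_carrier_neg] using hz)
  rw [topF_neg] at this
  simp at this
  exact this

theorem mem_carrier_iff (hR : R.IsValid) {z : Pt} :
    z ∈ R.carrier ↔ z 0 ∈ R.xRange ∧ R.botF (z 0) ≤ z 1 ∧ z 1 ≤ R.topF (z 0) := by
  refine ⟨fun h => ⟨mem_xRange h, botF_le hR h, le_topF hR h⟩, fun ⟨hx, h1, h2⟩ => ?_⟩
  have hconv := R.convex_carrier.segment_subset (botF_mem hR hx) (topF_mem hR hx)
  rcases eq_or_lt_of_le (h1.trans h2) with h | h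
  · convert topF_mem hR hx using 1
    ext k; fin_cases k
    · simp
    · simp; linarith
  · apply hconv
    have hd : 0 < R.topF (z 0) - R.botF (z 0) := by linarith
    refine ⟨(R.topF (z 0) - z 1) / (R.topF (z 0) - R.botF (z 0)),
      (z 1 - R.botF (z 0)) / (R.topF (z 0) - R.botF (z 0)),
      div_nonneg (by linarith) hd.le, div_nonneg (by linarith) hd.le, ?_, ?_⟩
    · rw [← add_div]; rw [div_eq_one_iff_eq hd.ne']; ring
    · ext k; fin_cases k
      · simp; rw [← add_mul, ← add_div, div_mul_eq_mul_div, div_eq_iff hd.ne']; ring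
      · simp; rw [div_mul_eq_mul_div, div_mul_eq_mul_div, ← add_div, div_eq_iff hd.ne']; ring

theorem exists_ball_subset (hR : R.IsValid) (j : Fin m) : ∃ ε > 0, ∀ z : Pt,
    |z 0 - R.c j 0| < ε → |z 1 - R.c j 1| < ε → z ∈ R.carrier := by
  obtain ⟨ε, hε, h⟩ := Metric.mem_nhds_iff.1 (mem_interior_iff_mem_nhds.1 (hR.marked_interior j))
  refine ⟨ε, hε, fun z h0 h1 => h ?_⟩
  rw [Metric.mem_ball, dist_pi_lt_iff hε]
  intro k
  fin_cases k
  · simpa [Real.dist_eq] using h0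
  · simpa [Real.dist_eq] using h1

theorem c_lt_topF (hR : R.IsValid) (j : Fin m) : R.c j 1 < R.topF (R.c j 0) := by
  obtain ⟨ε, hε, h⟩ := exists_ball_subset hR j
  have := le_topF hR (h ![R.c j 0, R.c j 1 + ε / 2] (by simpa)
    (by simp [abs_of_pos (half_pos hε)]; linarith))
  simp at this
  linarith

theorem exists_lt_c (hR : R.IsValid) (j : Fin m) : ∃ p, R.V p 0 < R.c j 0 := by
  obtain ⟨ε, hε, h⟩ := exists_ball_subset hR j
  obtain ⟨p, hp⟩ := R.exists_V_le (h ![R.c j 0 - ε / 2, R.c j 1] 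
    (by simp [abs_of_pos (half_pos hε)]; linarith) (by simpa))
  refine ⟨p, ?_⟩
  simp at hp
  linarith

theorem exists_c_lt (hR : R.IsValid) (j : Fin m) : ∃ p, R.c j 0 < R.V p 0 := by
  obtain ⟨p, hp⟩ := exists_lt_c hR.neg j
  exact ⟨p, by simpa [neg] using hp⟩

theorem c_mem_xRange (hR : R.IsValid) (j : Fin m) : R.c j 0 ∈ R.xRange :=
  mem_xRange (interior_subset (hR.marked_interior j))

/-- A cut going up hits the upper boundary. -/
theorem cutHits_top (hR : R.IsValid) {j : Fin m} (hj : R.eps j = 1) {z : Pt}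
    (h0 : z 0 = R.c j 0) (h1 : z 1 = R.topF (z 0)) : R.CutHits j z := by
  refine ⟨?_, h0, ?_⟩
  · convert topF_mem_frontier hR (c_mem_xRange hR j) using 1
    ext k; fin_cases k
    · simpa using h0
    · simp [h1, h0]
  · rw [hj, h1, h0]
    have := c_lt_topF hR j
    simp; linarith

/-- A cut hitting the upper boundary goes up. -/
theorem eps_of_cutHits_top (hR : R.IsValid) {j : Fin m} {z : Pt} (h : R.CutHits j z)
    (h1 : z 1 = R.topF (z 0)) : R.eps j = 1 := by
  rcases hR.eps_pm j with he | he
  · exact he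
  · have h2 := h.2.2
    rw [h1, h.2.1, he] at h2
    have := c_lt_topF hR j
    simp at h2; linarith

/-- The sum of the slope changes `u j` of the marked points, as a function of the first
coordinate. -/
noncomputable def phi (R : STRep d m) (u : Fin m → ℤ) (x : ℝ) : ℝ :=
  ∑ j, (u j : ℝ) * max (x - R.c j 0) 0

open Classical in
/-- The right slope of `phi`. -/
noncomputable def rhoR (R : STRep d m) (u : Fin m → ℤ) (x : ℝ) : ℤ :=
  ∑ j, if R.c j 0 ≤ x then u j else 0

open Classical in
/-- The left slope of `phi`. -/
noncomputable def rhoL (R : STRep d m) (u : Fin m → ℤ) (x : ℝ) : ℤ :=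
  ∑ j, if R.c j 0 < x then u j else 0

open Classical in
/-- The change of slope of `phi`. -/
noncomputable def jump (R : STRep d m) (u : Fin m → ℤ) (x : ℝ) : ℤ :=
  ∑ j, if R.c j 0 = x then u j else 0

theorem rhoR_eq (u : Fin m → ℤ) (x : ℝ) : R.rhoR u x = R.rhoL u x + R.jump u x := by
  unfold rhoR rhoL jump
  rw [← Finset.sum_add_distrib]
  refine Finset.sum_congr rfl fun j _ => ?_
  rcases lt_trichotomy (R.c j 0) x with h | h | h
  · simp [h, h.le, h.ne]
  · simp [h]
  · simp [h.le, h.not_ge, h.ne']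

theorem continuous_phi (u : Fin m → ℤ) : Continuous (R.phi u) := by
  unfold phi; fun_prop

theorem phi_right (u : Fin m → ℤ) {x s : ℝ} (hs : 0 ≤ s)
    (h : ∀ j, u j ≠ 0 → ¬ (x < R.c j 0 ∧ R.c j 0 < x + s)) :
    R.phi u (x + s) = R.phi u x + R.rhoR u x * s := by
  unfold phi rhoR
  push_cast
  rw [Finset.sum_mul, ← Finset.sum_add_distrib]
  refine Finset.sum_congr rfl fun j _ => ?_
  rcases eq_or_ne (u j) 0 with hu | hu
  · simp [hu]
  split_ifs with hj
  · rw [max_eq_left (by linarith), max_eq_left (by linarith)]; ring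
  · have := h j hu
    push Not at this hj
    rw [max_eq_right (by linarith [this hj]), max_eq_right (by linarith)]; simp

theorem phi_left (u : Fin m → ℤ) {x s : ℝ} (hs : 0 ≤ s)
    (h : ∀ j, u j ≠ 0 → ¬ (x - s < R.c j 0 ∧ R.c j 0 < x)) :
    R.phi u (x - s) = R.phi u x - R.rhoL u x * s := by
  unfold phi rhoL
  push_cast
  rw [Finset.sum_mul, ← Finset.sum_sub_distrib]
  refine Finset.sum_congr rfl fun j _ => ?_
  rcases eq_or_ne (u j) 0 with hu | hu
  · simp [hu]
  split_ifs with hj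
  · have := not_lt.1 fun h1 => h j hu ⟨h1, hj⟩
    rw [max_eq_left (by linarith), max_eq_left (by linarith)]; ring
  · push Not at hj
    rw [max_eq_right (by linarith), max_eq_right (by linarith)]; simp

theorem exists_delta (R : STRep d m) (x : ℝ) : ∃ δ > 0, ∀ s, 0 ≤ s → s ≤ δ →
    (∀ j, ¬ (x < R.c j 0 ∧ R.c j 0 < x + s)) ∧ ∀ j, ¬ (x - s < R.c j 0 ∧ R.c j 0 < x) := by
  have hfin : (R.c · 0) '' univ \ {x} |>.Finite := (toFinite _)
  have hopen : (((R.c · 0) '' univ) \ {x})ᶜ ∈ nhds x :=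
    hfin.isClosed.isOpen_compl.mem_nhds (by simp)
  obtain ⟨δ, hδ, h⟩ := Metric.mem_nhds_iff.1 hopen
  refine ⟨δ, hδ, fun s h0 h1 => ⟨fun j ⟨h2, h3⟩ => ?_, fun j ⟨h2, h3⟩ => ?_⟩⟩
  · have : R.c j 0 ∈ Metric.ball x δ := by
      rw [Metric.mem_ball, Real.dist_eq, abs_lt]; constructor <;> linarith
    exact h this ⟨mem_image_of_mem _ (mem_univ j), h2.ne'⟩
  · have : R.c j 0 ∈ Metric.ball x δ := by
      rw [Metric.mem_ball, Real.dist_eq, abs_lt]; constructor <;> linarith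
    exact h this ⟨mem_image_of_mem _ (mem_univ j), h3.ne⟩

theorem phi_neg (u : Fin m → ℤ) (x : ℝ) :
    R.neg.phi (fun j => -u j) (-x) = -R.phi u x + ∑ j, (u j : ℝ) * (x - R.c j 0) := by
  unfold phi
  rw [← Finset.sum_neg_distrib, ← Finset.sum_add_distrib]
  refine Finset.sum_congr rfl fun j _ => ?_
  simp only [neg, Pi.neg_apply, Int.cast_neg]
  rcases le_total (R.c j 0) x with h | h
  · rw [max_eq_right (by linarith), max_eq_left (by linarith)]; ring
  · rw [max_eq_left (by linarith), max_eq_right (by linarith)]; ring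

end STRep

theorem ConcaveOn.le_of_right_germ {F : ℝ → ℝ} {S : Set ℝ} (hF : ConcaveOn ℝ S F) {x m δ : ℝ}
    (hx : x ∈ S) (hδ : 0 < δ) (hxδ : x + δ ∈ S)
    (hm : ∀ s, 0 ≤ s → s ≤ δ → F (x + s) = F x + m * s) {z : ℝ} (hz : z ∈ S) :
    F z ≤ F x + m * (z - x) := by
  rcases lt_trichotomy z x with h | rfl | h
  · have hp : 0 < δ + (x - z) := by linarith
    have h1 := hF.2 hz hxδ (show 0 ≤ δ / (δ + (x - z)) by positivity)
      (show 0 ≤ (x - z) / (δ + (x - z)) from div_nonneg (by linarith) hp.le) (by field_simp)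
    have e : (δ / (δ + (x - z))) • z + ((x - z) / (δ + (x - z))) • (x + δ) = x := by
      simp only [smul_eq_mul]; field_simp; ring
    rw [e, hm δ hδ.le le_rfl] at h1
    simp only [smul_eq_mul] at h1
    rw [div_mul_eq_mul_div, div_mul_eq_mul_div, ← add_div, div_le_iff₀ hp] at h1
    nlinarith
  · simp
  · set s := min δ (z - x)
    have hs : 0 < s := lt_min hδ (by linarith)
    have hs2 : s ≤ z - x := min_le_right _ _
    have hp : 0 < z - x := by linarith
    have h1 := hF.2 hx hz (show 0 ≤ (z - x - s) / (z - x) from div_nonneg (by linarith) hp.le)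
      (show 0 ≤ s / (z - x) by positivity) (by field_simp; ring)
    have e : ((z - x - s) / (z - x)) • x + (s / (z - x)) • z = x + s := by
      simp only [smul_eq_mul]; field_simp; ring
    rw [e, hm s hs.le (min_le_left _ _)] at h1
    simp only [smul_eq_mul] at h1
    rw [div_mul_eq_mul_div, div_mul_eq_mul_div, ← add_div, div_le_iff₀ hp] at h1
    nlinarith

theorem ConcaveOn.le_of_left_germ {F : ℝ → ℝ} {S : Set ℝ} (hF : ConcaveOn ℝ S F) {x m δ : ℝ}
    (hx : x ∈ S) (hδ : 0 < δ) (hxδ : x - δ ∈ S)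
    (hm : ∀ s, 0 ≤ s → s ≤ δ → F (x - s) = F x - m * s) {z : ℝ} (hz : z ∈ S) :
    F z ≤ F x + m * (z - x) := by
  have hF' : ConcaveOn ℝ (Neg.neg ⁻¹' S) fun x => F (-x) :=
    hF.comp_linearMap (-LinearMap.id : ℝ →ₗ[ℝ] ℝ)
  have := hF'.le_of_right_germ (x := -x) (m := -m) (δ := δ) (z := -z) (by simpa) hδ
    (by simpa [sub_eq_add_neg, add_comm] using hxδ) (fun s h0 h1 => by
      have := hm s h0 h1
      simp only [neg_add, neg_neg]
      rw [← sub_eq_add_neg, this]; ring) (by simpa)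
  simp only [neg_neg] at this
  linarith

namespace STRep

variable {d m : ℕ} [NeZero d] {R : STRep d m}

/-- `u` is an admissible choice of cut flips. -/
def IsFlip (R : STRep d m) (u : Fin m → ℤ) : Prop := ∀ j, u j = 0 ∨ u j = R.eps j

theorem IsFlip.neg {u : Fin m → ℤ} (hu : R.IsFlip u) : R.neg.IsFlip fun j => -u j := by
  intro j
  rcases hu j with h | h <;> simp [STRep.neg, h]

theorem jump_le_numCuts (hR : R.IsValid) {u : Fin m → ℤ} (hu : R.IsFlip u) {i : Fin d}
    (hi : R.V i 1 = R.topF (R.V i 0)) : R.jump u (R.V i 0) ≤ R.numCuts i := by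
  classical
  have e : (R.numCuts i : ℤ) = ∑ j, if R.CutHits j (R.V i) then 1 else 0 := by
    rw [Finset.sum_boole, numCuts, Set.ncard_eq_toFinset_card']
    simp
  rw [e, jump]
  refine Finset.sum_le_sum fun j _ => ?_
  by_cases h : R.eps j = 1
  · split_ifs with h1 h2 h2
    · rcases hu j with h | h <;> omega
    · exact absurd (cutHits_top hR h h1.symm hi) h2
    · simp
    · simp
  · have h := (hR.eps_pm j).resolve_left h
    have : u j ≤ 0 := by rcases hu j with h | h <;> omega
    split_ifs <;> omega

theorem jump_nonpos (hR : R.IsValid) {u : Fin m → ℤ} (hu : R.IsFlip u) {x : ℝ}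
    (hx : ∀ i, R.V i ≠ ![x, R.topF x]) : R.jump u x ≤ 0 := by
  refine Finset.sum_nonpos fun j _ => ?_
  split_ifs with h1
  · by_contra! h2
    have h : R.eps j = 1 := by
      rcases hR.eps_pm j with h | h
      · exact h
      · rcases hu j with h | h <;> omega
    obtain ⟨i, hi⟩ := hR.cuts_at_vertices j ![x, R.topF x]
      (cutHits_top hR h (by simp [h1]) (by simp))
    exact hx i hi.symm
  · simp

/-- The boundary turns clockwise at a vertex of the upper boundary, in every frame. -/
theorem corner_nonneg (hR : R.IsValid) (i : Fin d) :
    0 ≤ detZ (R.u1 i) ((Tpow (R.numCuts i : ℤ)).mulVec (R.u2 i)) := by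
  rcases Nat.eq_zero_or_pos (R.numCuts i) with h | h
  · have h1 := hR.clockwise (i - 1)
    rw [sub_add_cancel] at h1
    rw [detZ_corner, h]
    simp [detZ] at h1 ⊢
    linarith
  · rcases hR.corner_cut i h with h | h <;> omega

theorem topF_right_germ (hR : R.IsValid) {i : Fin d} (hi : 0 < R.dir i 0) {x : ℝ}
    (h0 : R.V i 0 ≤ x) {s : ℝ} (hs : 0 ≤ s) (h1 : x + s ≤ R.V (i + 1) 0) :
    R.topF (x + s) = R.topF x + R.dir i 1 / R.dir i 0 * s := by
  have hp := dir_zero_pos_cast hi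
  obtain ⟨a, a0, a1, ha⟩ := exists_param hR hi h0 (by linarith)
  obtain ⟨b, b0, b1, hb⟩ := exists_param hR hi (by linarith) h1
  have : s = (b - a) * R.dir i 0 := by linarith
  rw [hb, topF_edge hR hi b0 b1, ha, topF_edge hR hi a0 a1, this]
  field_simp
  ring

/-- The polygon remains convex from above after flipping cuts. -/
theorem concaveOn_top (hR : R.IsValid) {u : Fin m → ℤ} (hu : R.IsFlip u) :
    ConcaveOn ℝ R.xRange fun x => R.topF x + R.phi u x := by
  have key : ∀ p q, ConcaveOn ℝ (Icc (R.V p 0) (R.V q 0)) fun x => R.topF x + R.phi u x := by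
    intro p q
    refine concaveOn_of_germs (R.continuous_topF.add (continuous_phi u)).continuousOn ?_
    rintro x ⟨hxp, hxq⟩
    obtain ⟨i, hi, h0, h1⟩ := exists_edge_right hR hxp.le hxq
    obtain ⟨δ, hδ, hd⟩ := R.exists_delta x
    rcases eq_or_lt_of_le h0 with h | h
    · have hi' : 0 < R.dir (i - 1) 0 := by
        by_contra! hc
        have := V_le_of_turn hR i hc hi.le (R.V_mem p)
        linarith
      have hl : R.V (i - 1) 0 < x := by
        have := V_eq_pred hR i 0
        have h2 := dir_zero_pos_cast hi'
        have := mul_pos (hR.len_pos (i - 1)) h2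
        linarith
      refine ⟨R.dir (i - 1) 1 / R.dir (i - 1) 0 + R.rhoL u x, R.dir i 1 / R.dir i 0 + R.rhoR u x,
        ?_, min δ (min (x - R.V (i - 1) 0) (R.V (i + 1) 0 - x)),
        lt_min hδ (lt_min (by linarith) (by linarith)), ?_⟩
      · have hj := jump_le_numCuts hR hu (i := i) (topF_V hR hi).symm
        have hc := corner_nonneg hR i
        rw [detZ_corner] at hc
        rw [rhoR_eq, ← h]
        have hc' : (0 : ℝ) ≤ R.dir (i - 1) 1 * R.dir i 0 - R.dir (i - 1) 0 * R.dir i 1 -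
          (R.numCuts i : ℤ) * (R.dir (i - 1) 0 * R.dir i 0) := by exact_mod_cast hc
        have hj' : (R.jump u (R.V i 0) : ℝ) ≤ (R.numCuts i : ℤ) := by exact_mod_cast hj
        have a := dir_zero_pos_cast hi
        have a' := dir_zero_pos_cast hi'
        have : (R.dir i 1 : ℝ) / R.dir i 0 + (R.numCuts i : ℤ) ≤
            R.dir (i - 1) 1 / R.dir (i - 1) 0 := by
          rw [le_div_iff₀ a', add_mul, div_mul_eq_mul_div, ← le_sub_iff_add_le, div_le_iff₀ a]
          nlinarith
        push_cast at this hj' ⊢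
        linarith
      · intro s hs0 hs
        obtain ⟨d1, d2⟩ := hd s hs0 (hs.trans (min_le_left _ _))
        have hs' := hs.trans (min_le_right _ _)
        constructor
        · have := hs'.trans (min_le_right _ _)
          rw [phi_right u hs0 fun j _ => d1 j, topF_right_germ hR hi h0 hs0 (by linarith)]
          ring
        · have := hs'.trans (min_le_left _ _)
          have e := topF_right_germ hR hi' (x := x - s) (by linarith) hs0
            (by rw [sub_add_cancel i 1]; linarith)
          rw [sub_add_cancel] at e
          rw [phi_left u hs0 fun j _ => d2 j, e]
          ring
    · refine ⟨R.dir i 1 / R.dir i 0 + R.rhoL u x, R.dir i 1 / R.dir i 0 + R.rhoR u x,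
        ?_, min δ (min (x - R.V i 0) (R.V (i + 1) 0 - x)),
        lt_min hδ (lt_min (by linarith) (by linarith)), ?_⟩
      · have : R.jump u x ≤ 0 := by
          refine jump_nonpos hR hu fun k hk => ?_
          obtain ⟨s, s0, s1, hs⟩ := exists_param hR hi h0 h1.le
          have a := dir_zero_pos_cast hi
          have b0 : 0 < s := by
            refine lt_of_le_of_ne s0 ?_
            rintro rfl
            linarith
          have b1 : s < R.len i := by
            refine lt_of_le_of_ne s1 ?_
            rintro rfl
            linarith [V_succ hR i 0]
          refine V_ne_edge hR i k b0 b1 fun c => ?_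
          rw [hk]
          fin_cases c
          · simpa using hs
          · simp [hs, topF_edge hR hi s0 s1]
        rw [rhoR_eq]
        push_cast
        have : (R.jump u x : ℝ) ≤ 0 := by exact_mod_cast this
        linarith
      · intro s hs0 hs
        obtain ⟨d1, d2⟩ := hd s hs0 (hs.trans (min_le_left _ _))
        have hs' := hs.trans (min_le_right _ _)
        constructor
        · have := hs'.trans (min_le_right _ _)
          rw [phi_right u hs0 fun j _ => d1 j, topF_right_germ hR hi h0 hs0 (by linarith)]
          ring
        · have := hs'.trans (min_le_left _ _)
          have e := topF_right_germ hR hi (x := x - s) (by linarith) hs0 (by linarith)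
          rw [sub_add_cancel] at e
          rw [phi_left u hs0 fun j _ => d2 j, e]
          ring
  refine ⟨R.ordConnected_xRange.convex, fun x hx y hy a b ha hb hab => ?_⟩
  obtain ⟨⟨p, hp⟩, ⟨p', hp'⟩⟩ := hx
  obtain ⟨⟨q, hq⟩, ⟨q', hq'⟩⟩ := hy
  rcases le_total x y with h | h
  · exact (key p q').2 ⟨hp, h.trans hq'⟩ ⟨hp.trans h, hq'⟩ ha hb hab
  · exact (key q p').2 ⟨hq.trans h, hp'⟩ ⟨hq, h.trans hp'⟩ ha hb hab

theorem convexOn_bot (hR : R.IsValid) {u : Fin m → ℤ} (hu : R.IsFlip u) :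
    ConvexOn ℝ R.xRange fun x => R.botF x + R.phi u x := by
  have h := concaveOn_top hR.neg hu.neg
  refine ⟨R.ordConnected_xRange.convex, fun x hx y hy a b ha hb hab => ?_⟩
  have := h.2 (neg_mem_xRange_neg.2 hx) (neg_mem_xRange_neg.2 hy) ha hb hab
  simp only [smul_eq_mul] at this ⊢
  have e : a * -x + b * -y = -(a * x + b * y) := by ring
  rw [e] at this
  simp only [phi_neg, topF_neg, _root_.neg_neg] at this
  have e2 : ∑ j, (u j : ℝ) * (a * x + b * y - R.c j 0) =
      a * ∑ j, (u j : ℝ) * (x - R.c j 0) + b * ∑ j, (u j : ℝ) * (y - R.c j 0) := by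
    rw [Finset.mul_sum, Finset.mul_sum, ← Finset.sum_add_distrib]
    refine Finset.sum_congr rfl fun j _ => ?_
    linear_combination ((u j : ℝ) * R.c j 0) * hab
  rw [e2] at this
  linarith

open Classical in
/-- The germ at the abscissa `x` of the image of the integer vector `w` after flipping cuts. -/
noncomputable def germ (R : STRep d m) (u : Fin m → ℤ) (x : ℝ) (w : Fin 2 → ℤ) : Fin 2 → ℤ :=
  ![w 0, w 1 + (if 0 ≤ w 0 then R.rhoR u x else R.rhoL u x) * w 0]

theorem germ_neg (u : Fin m → ℤ) (x : ℝ) {w : Fin 2 → ℤ} :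
    R.neg.germ (fun j => -u j) (-x) (fun k => -w k) =
      ![-w 0, -(R.germ u x w 1) + (∑ j, u j) * w 0] := by
  have e1 : R.neg.rhoR (fun j => -u j) (-x) = R.rhoL u x - ∑ j, u j := by
    unfold rhoR rhoL
    rw [← Finset.sum_sub_distrib]
    refine Finset.sum_congr rfl fun j _ => ?_
    simp only [neg, Pi.neg_apply, neg_le_neg_iff]
    by_cases h : x ≤ R.c j 0
    · simp [h, h.not_gt]
    · simp [h, not_le.1 h]
  have e2 : R.neg.rhoL (fun j => -u j) (-x) = R.rhoR u x - ∑ j, u j := by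
    unfold rhoR rhoL
    rw [← Finset.sum_sub_distrib]
    refine Finset.sum_congr rfl fun j _ => ?_
    simp only [neg, Pi.neg_apply, neg_lt_neg_iff]
    by_cases h : x < R.c j 0
    · simp [h, h.not_ge]
    · simp [h, not_lt.1 h]
  unfold germ
  rw [e1, e2]
  ext k
  fin_cases k
  · simp
  · simp
    rcases lt_trichotomy (w 0) 0 with h | h | h
    · simp [h.le, h.not_ge]; ring
    · simp [h]
    · simp [h.le, h.not_ge]; ring

/-- Flipping of cuts, as a piecewise affine map of the plane. -/
noncomputable def flip (R : STRep d m) (u : Fin m → ℤ) (z : Pt) : Pt :=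
  ![z 0, z 1 + R.phi u (z 0)]

@[simp] theorem flip_zero (u : Fin m → ℤ) (z : Pt) : R.flip u z 0 = z 0 := rfl

@[simp] theorem flip_one (u : Fin m → ℤ) (z : Pt) : R.flip u z 1 = z 1 + R.phi u (z 0) := rfl

theorem support_flip_of_pos (hR : R.IsValid) {u : Fin m → ℤ} (hu : R.IsFlip u) {i : Fin d}
    (hi : 0 < R.dir i 0) {z : Pt} (hz : z ∈ R.carrier) :
    (R.dir i 0 : ℝ) * (R.flip u z 1 - R.flip u (R.V i) 1) -
      R.germ u (R.V i 0) (R.dir i) 1 * (z 0 - R.V i 0) ≤ 0 := by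
  have hp := dir_zero_pos_cast hi
  obtain ⟨δ, hδ, hd⟩ := R.exists_delta (R.V i 0)
  have e := V_succ hR i 0
  have hlt : 0 < R.V (i + 1) 0 - R.V i 0 := by rw [e]; linarith [mul_pos (hR.len_pos i) hp]
  have := (concaveOn_top hR hu).le_of_right_germ (x := R.V i 0)
    (m := R.dir i 1 / R.dir i 0 + R.rhoR u (R.V i 0)) (δ := min δ (R.V (i + 1) 0 - R.V i 0))
    (R.V_mem_xRange i) (lt_min hδ hlt)
    (R.ordConnected_xRange.out (R.V_mem_xRange i) (R.V_mem_xRange (i + 1))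
      ⟨by linarith [lt_min hδ hlt], by linarith [min_le_right δ (R.V (i + 1) 0 - R.V i 0)]⟩)
    (fun s h0 h1 => by
      obtain ⟨d1, d2⟩ := hd s h0 (h1.trans (min_le_left _ _))
      have := h1.trans (min_le_right _ _)
      rw [phi_right u h0 fun j _ => d1 j, topF_right_germ hR hi le_rfl h0 (by linarith)]
      ring) (mem_xRange hz)
  rw [topF_V hR hi] at this
  have h2 := le_topF hR hz
  simp only [flip_one, germ, hi.le, if_true, cons_val_one, cons_val_zero]
  have h3 : z 1 + R.phi u (z 0) - (R.V i 1 + R.phi u (R.V i 0)) ≤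
    (R.dir i 1 / R.dir i 0 + R.rhoR u (R.V i 0)) * (z 0 - R.V i 0) := by linarith
  have h4 := mul_le_mul_of_nonneg_left h3 hp.le
  have h5 : (R.dir i 0 : ℝ) * ((R.dir i 1 / R.dir i 0 + R.rhoR u (R.V i 0)) * (z 0 - R.V i 0)) =
    (R.dir i 1 + R.rhoR u (R.V i 0) * R.dir i 0) * (z 0 - R.V i 0) := by
    field_simp
  push_cast
  linarith

theorem support_flip_pred_of_pos (hR : R.IsValid) {u : Fin m → ℤ} (hu : R.IsFlip u) {i : Fin d}
    (hi : 0 < R.dir (i - 1) 0) {z : Pt} (hz : z ∈ R.carrier) :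
    0 ≤ (R.u1 i 0 : ℝ) * (R.flip u z 1 - R.flip u (R.V i) 1) -
      R.germ u (R.V i 0) (R.u1 i) 1 * (z 0 - R.V i 0) := by
  have hp := dir_zero_pos_cast hi
  obtain ⟨δ, hδ, hd⟩ := R.exists_delta (R.V i 0)
  have e := V_eq_pred hR i 0
  have hlt : 0 < R.V i 0 - R.V (i - 1) 0 := by rw [e]; linarith [mul_pos (hR.len_pos (i - 1)) hp]
  have := (concaveOn_top hR hu).le_of_left_germ (x := R.V i 0)
    (m := R.dir (i - 1) 1 / R.dir (i - 1) 0 + R.rhoL u (R.V i 0))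
    (δ := min δ (R.V i 0 - R.V (i - 1) 0))
    (R.V_mem_xRange i) (lt_min hδ hlt)
    (R.ordConnected_xRange.out (R.V_mem_xRange (i - 1)) (R.V_mem_xRange i)
      ⟨by linarith [min_le_right δ (R.V i 0 - R.V (i - 1) 0)], by linarith [lt_min hδ hlt]⟩)
    (fun s h0 h1 => by
      obtain ⟨d1, d2⟩ := hd s h0 (h1.trans (min_le_left _ _))
      have := h1.trans (min_le_right _ _)
      have e := topF_right_germ hR hi (x := R.V i 0 - s) (by linarith) h0
            (by rw [sub_add_cancel i 1]; linarith)
      rw [sub_add_cancel] at e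
      rw [phi_left u h0 fun j _ => d2 j, e]
      ring) (mem_xRange hz)
  rw [topF_V_succ hR hi] at this
  have h2 := le_topF hR hz
  have hneg : ¬ (0 ≤ -R.dir (i - 1) 0) := by omega
  simp only [flip_one, germ, u1, hneg, if_false, cons_val_one, cons_val_zero]
  have h3 : z 1 + R.phi u (z 0) - (R.V i 1 + R.phi u (R.V i 0)) ≤
    (R.dir (i - 1) 1 / R.dir (i - 1) 0 + R.rhoL u (R.V i 0)) * (z 0 - R.V i 0) := by linarith
  have h4 := mul_le_mul_of_nonneg_left h3 hp.le
  have h5 : (R.dir (i - 1) 0 : ℝ) * ((R.dir (i - 1) 1 / R.dir (i - 1) 0 + R.rhoL u (R.V i 0)) *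
    (z 0 - R.V i 0)) =
    (R.dir (i - 1) 1 + R.rhoL u (R.V i 0) * R.dir (i - 1) 0) * (z 0 - R.V i 0) := by
    field_simp
  push_cast
  linarith

theorem flip_neg_one (u : Fin m → ℤ) (z : Pt) :
    R.neg.flip (fun j => -u j) (-z) 1 =
      -R.flip u z 1 + ∑ j, (u j : ℝ) * (z 0 - R.c j 0) := by
  simp only [flip_one, Pi.neg_apply, phi_neg]
  ring

theorem flip_neg_one_sub (u : Fin m → ℤ) (z w : Pt) :
    R.neg.flip (fun j => -u j) (-z) 1 - R.neg.flip (fun j => -u j) (-w) 1 =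
      -(R.flip u z 1 - R.flip u w 1) + (∑ j, (u j : ℝ)) * (z 0 - w 0) := by
  rw [flip_neg_one, flip_neg_one, Finset.sum_mul]
  have : ∑ j, (u j : ℝ) * (z 0 - R.c j 0) - ∑ j, (u j : ℝ) * (w 0 - R.c j 0) =
    ∑ j, (u j : ℝ) * (z 0 - w 0) := by
    rw [← Finset.sum_sub_distrib]
    exact Finset.sum_congr rfl fun j _ => by ring
  linarith

/-- The germ of the outgoing edge at a vertex supports the flipped polygon. -/
theorem support_flip (hR : R.IsValid) {u : Fin m → ℤ} (hu : R.IsFlip u) (i : Fin d)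
    {z : Pt} (hz : z ∈ R.carrier) :
    (R.dir i 0 : ℝ) * (R.flip u z 1 - R.flip u (R.V i) 1) -
      R.germ u (R.V i 0) (R.dir i) 1 * (z 0 - R.V i 0) ≤ 0 := by
  rcases lt_trichotomy (R.dir i 0) 0 with h | h | h
  · have := support_flip_of_pos hR.neg hu.neg (i := i) (by simpa [neg] using h) (z := -z)
      (by simpa [mem_carrier_neg])
    have e := R.flip_neg_one_sub u z (R.V i)
    have g := congrFun (R.germ_neg u (R.V i 0) (w := R.dir i)) 1
    change (((-R.dir i 0 : ℤ) : ℝ)) * (R.neg.flip (fun j => -u j) (-z) 1 -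
      R.neg.flip (fun j => -u j) (-R.V i) 1) -
      ((R.neg.germ (fun j => -u j) (-(R.V i 0)) (fun k => -R.dir i k) 1 : ℤ) : ℝ) *
        (-(z 0) - -(R.V i 0)) ≤ 0 at this
    rw [e, g] at this
    push_cast at this
    linarith
  · have := support hR i hz
    simp [h, germ] at this ⊢
    linarith
  · exact support_flip_of_pos hR hu h hz

/-- The germ of the incoming edge at a vertex supports the flipped polygon. -/
theorem support_flip_pred (hR : R.IsValid) {u : Fin m → ℤ} (hu : R.IsFlip u) (i : Fin d)
    {z : Pt} (hz : z ∈ R.carrier) :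
    0 ≤ (R.u1 i 0 : ℝ) * (R.flip u z 1 - R.flip u (R.V i) 1) -
      R.germ u (R.V i 0) (R.u1 i) 1 * (z 0 - R.V i 0) := by
  rcases lt_trichotomy (R.dir (i - 1) 0) 0 with h | h | h
  · have := support_flip_pred_of_pos hR.neg hu.neg (i := i) (by simpa [neg] using h) (z := -z)
      (by simpa [mem_carrier_neg])
    have e := R.flip_neg_one_sub u z (R.V i)
    have g := congrFun (R.germ_neg u (R.V i 0) (w := R.u1 i)) 1
    change 0 ≤ (((-R.u1 i 0 : ℤ) : ℝ)) * (R.neg.flip (fun j => -u j) (-z) 1 -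
      R.neg.flip (fun j => -u j) (-R.V i) 1) -
      ((R.neg.germ (fun j => -u j) (-(R.V i 0)) (fun k => -R.u1 i k) 1 : ℤ) : ℝ) *
        (-(z 0) - -(R.V i 0)) at this
    rw [e, g] at this
    push_cast at this
    linarith
  · have := support_pred hR i hz
    simp [h, germ, u1] at this ⊢
    linarith
  · exact support_flip_pred_of_pos hR hu h hz

end STRep

theorem Int.eq_of_coprime_of_mul_eq {a b c d : ℤ} (hab : Int.gcd a b = 1) (hcd : Int.gcd c d = 1)
    (h : a * d = b * c) (ha : 0 < a) (hc : 0 < c) : a = c := by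
  have h1 : a ∣ c := (Int.isCoprime_iff_gcd_eq_one.2 hab).dvd_of_dvd_mul_left ⟨d, h.symm⟩
  have h2 : c ∣ a := (Int.isCoprime_iff_gcd_eq_one.2 hcd).dvd_of_dvd_mul_right
    ⟨b, by linarith⟩
  exact Int.dvd_antisymm ha.le hc.le h1 h2

namespace STRep

variable {d m : ℕ} [NeZero d] {R : STRep d m}

/-- The frame in which all the cuts going up are flipped. -/
def flipTop (R : STRep d m) (j : Fin m) : ℤ := if R.eps j = 1 then 1 else 0

theorem isFlip_flipTop (R : STRep d m) : R.IsFlip R.flipTop := by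
  intro j
  unfold flipTop
  split_ifs with h
  · exact .inr h.symm
  · exact .inl rfl

theorem jump_flipTop (hR : R.IsValid) {i : Fin d} (hi : R.V i 1 = R.topF (R.V i 0)) :
    R.jump R.flipTop (R.V i 0) = R.numCuts i := by
  classical
  have e : (R.numCuts i : ℤ) = ∑ j, if R.CutHits j (R.V i) then 1 else 0 := by
    rw [Finset.sum_boole, numCuts, Set.ncard_eq_toFinset_card']
    simp
  rw [e, jump]
  refine Finset.sum_congr rfl fun j _ => ?_
  unfold flipTop
  by_cases h : R.CutHits j (R.V i)
  · simp [h, h.2.1, eps_of_cutHits_top hR h hi]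
  · split_ifs with h1 h2
    · exact absurd (cutHits_top hR h2 h1.symm hi) h
    · rfl
    · rfl

/-- A vertex which is extreme in the horizontal direction. -/
def IsTip (R : STRep d m) (i : Fin d) : Prop :=
  (0 ≤ R.dir (i - 1) 0 ∧ R.dir i 0 ≤ 0) ∨ (R.dir (i - 1) 0 ≤ 0 ∧ 0 ≤ R.dir i 0)

theorem not_isTip {i : Fin d} (h : ¬ R.IsTip i) :
    (0 < R.dir (i - 1) 0 ∧ 0 < R.dir i 0) ∨ (R.dir (i - 1) 0 < 0 ∧ R.dir i 0 < 0) := by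
  unfold IsTip at h
  omega

theorem IsTip.extreme (hR : R.IsValid) {i : Fin d} (hi : R.IsTip i) :
    (∀ z ∈ R.carrier, z 0 ≤ R.V i 0) ∨ (∀ z ∈ R.carrier, R.V i 0 ≤ z 0) := by
  rcases hi with h | h
  · exact .inl fun z hz => le_V_of_turn hR i h.1 h.2 hz
  · exact .inr fun z hz => V_le_of_turn hR i h.1 h.2 hz

theorem IsTip.c_ne (hR : R.IsValid) {i : Fin d} (hi : R.IsTip i) (j : Fin m) :
    R.c j 0 ≠ R.V i 0 := by
  obtain ⟨p, hp⟩ := exists_lt_c hR j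
  obtain ⟨q, hq⟩ := exists_c_lt hR j
  rcases hi.extreme hR with h | h
  · exact (hq.trans_le (h _ (R.V_mem q))).ne
  · exact ((h _ (R.V_mem p)).trans_lt hp).ne'

theorem IsTip.numCuts_eq (hR : R.IsValid) {i : Fin d} (hi : R.IsTip i) : R.numCuts i = 0 := by
  unfold numCuts
  rw [Set.ncard_eq_zero (toFinite _)]
  ext j
  simp only [mem_empty_iff_false, iff_false]
  intro h
  exact hi.c_ne hR j h.2.1.symm

theorem IsTip.isHD (hR : R.IsValid) {i : Fin d} (hi : R.IsTip i) : R.IsHDCorner i := by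
  intro h
  have := h.1
  rw [hi.numCuts_eq hR] at this
  exact lt_irrefl _ this

theorem IsTip.det (hR : R.IsValid) {i : Fin d} (hi : R.IsTip i) : detZ (R.u1 i) (R.u2 i) = 1 := by
  have h1 := hR.clockwise (i - 1)
  rw [sub_add_cancel] at h1
  have h2 := hR.corner_delzant i (hi.numCuts_eq hR)
  rw [detZ_corner'] at h2 ⊢
  simp only [detZ] at h1
  omega

theorem IsHDCorner.det (hR : R.IsValid) {i : Fin d} (hi : R.IsHDCorner i) :
    detZ (R.u1 i) ((Tpow (R.numCuts i : ℤ)).mulVec (R.u2 i)) = 1 := by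
  rcases Nat.eq_zero_or_pos (R.numCuts i) with h | h
  · have h1 := hR.clockwise (i - 1)
    rw [sub_add_cancel] at h1
    have h2 := hR.corner_delzant i h
    rw [detZ_corner'] at h2
    rw [detZ_corner, h]
    simp only [detZ] at h1
    simp
    omega
  · exact (hR.corner_cut i h).resolve_left fun h0 => hi ⟨h, h0⟩

theorem detZ_germ_of_pos {i : Fin d} (h1 : 0 < R.dir (i - 1) 0) (h2 : 0 < R.dir i 0)
    (u : Fin m → ℤ) (x : ℝ) :
    detZ (R.germ u x (R.u1 i)) (R.germ u x (R.u2 i)) =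
      detZ (R.u1 i) ((Tpow (R.numCuts i : ℤ)).mulVec (R.u2 i)) +
        (R.numCuts i - R.jump u x) * (R.dir (i - 1) 0 * R.dir i 0) := by
  rw [detZ_corner]
  have hneg : ¬ (0 ≤ -R.dir (i - 1) 0) := by omega
  simp only [detZ, germ, u1, u2, hneg, h2.le, if_true, if_false, cons_val_zero, cons_val_one,
    rhoR_eq]
  ring

theorem IsTip.rho (hR : R.IsValid) {i : Fin d} (hi : R.IsTip i) (u : Fin m → ℤ) :
    R.rhoR u (R.V i 0) = R.rhoL u (R.V i 0) := by
  rw [rhoR_eq, jump, Finset.sum_eq_zero, add_zero]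
  intro j _
  rw [if_neg (hi.c_ne hR j)]

theorem IsTip.detZ_germ (hR : R.IsValid) {i : Fin d} (hi : R.IsTip i) (u : Fin m → ℤ) :
    detZ (R.germ u (R.V i 0) (R.u1 i)) (R.germ u (R.V i 0) (R.u2 i)) = 1 := by
  rw [← hi.det hR]
  simp only [detZ, germ, hi.rho hR, ite_self, cons_val_zero, cons_val_one]
  ring

theorem detZ_germ_neg (u : Fin m → ℤ) (x : ℝ) (v w : Fin 2 → ℤ) :
    detZ (R.neg.germ (fun j => -u j) (-x) (fun k => -v k))
      (R.neg.germ (fun j => -u j) (-x) (fun k => -w k)) =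
    detZ (R.germ u x v) (R.germ u x w) := by
  rw [germ_neg, germ_neg]
  have (w : Fin 2 → ℤ) : R.germ u x w 0 = w 0 := rfl
  simp only [detZ, cons_val_zero, cons_val_one, this]
  ring

theorem detZ_germ_neg' (u : Fin m → ℤ) (i : Fin d) :
    detZ (R.neg.germ (fun j => -u j) (R.neg.V i 0) (R.neg.u1 i))
      (R.neg.germ (fun j => -u j) (R.neg.V i 0) (R.neg.u2 i)) =
    detZ (R.germ u (R.V i 0) (R.u1 i)) (R.germ u (R.V i 0) (R.u2 i)) :=
  detZ_germ_neg u _ _ _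

/-- In every frame a hidden or Delzant corner is a genuine corner. -/
theorem IsHDCorner.detZ_germ_pos (hR : R.IsValid) {i : Fin d} (hi : R.IsHDCorner i)
    {u : Fin m → ℤ} (hu : R.IsFlip u) :
    0 < detZ (R.germ u (R.V i 0) (R.u1 i)) (R.germ u (R.V i 0) (R.u2 i)) := by
  have key : ∀ {R : STRep d m}, R.IsValid → R.IsHDCorner i → ∀ {u}, R.IsFlip u →
      0 < R.dir (i - 1) 0 → 0 < R.dir i 0 →
      0 < detZ (R.germ u (R.V i 0) (R.u1 i)) (R.germ u (R.V i 0) (R.u2 i)) := by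
    intro R hR hi u hu h1 h2
    rw [detZ_germ_of_pos h1 h2, hi.det hR]
    have := jump_le_numCuts hR hu (topF_V hR h2).symm
    have : 0 ≤ (R.numCuts i - R.jump u (R.V i 0)) * (R.dir (i - 1) 0 * R.dir i 0) :=
      mul_nonneg (by linarith) (by positivity)
    linarith
  by_cases ht : R.IsTip i
  · rw [ht.detZ_germ hR]; exact one_pos
  · rcases not_isTip ht with h | h
    · exact key hR hi hu h.1 h.2
    · rw [← detZ_germ_neg']
      exact key hR.neg (by rwa [IsHDCorner, isFakeCorner_neg]) hu.neg (by simpa [neg] using h.1)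
        (by simpa [neg] using h.2)

theorem IsHDCorner.detZ_germ_flipTop (hR : R.IsValid) {i : Fin d} (hi : R.IsHDCorner i)
    (h : 0 ≤ R.dir (i - 1) 0 + R.dir i 0) :
    detZ (R.germ R.flipTop (R.V i 0) (R.u1 i)) (R.germ R.flipTop (R.V i 0) (R.u2 i)) = 1 := by
  by_cases ht : R.IsTip i
  · exact ht.detZ_germ hR _
  · rcases not_isTip ht with h' | h'
    · rw [detZ_germ_of_pos h'.1 h'.2, hi.det hR, jump_flipTop hR (topF_V hR h'.2).symm]
      simp
    · omega

theorem IsFakeCorner.not_isTip (hR : R.IsValid) {i : Fin d} (hi : R.IsFakeCorner i) :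
    ¬ R.IsTip i := fun h => h.isHD hR hi

theorem IsFakeCorner.detZ_germ_flipTop (hR : R.IsValid) {i : Fin d} (hi : R.IsFakeCorner i)
    (h : 0 < R.dir i 0) :
    detZ (R.germ R.flipTop (R.V i 0) (R.u1 i)) (R.germ R.flipTop (R.V i 0) (R.u2 i)) = 0 := by
  rcases STRep.not_isTip (hi.not_isTip hR) with h' | h'
  · rw [detZ_germ_of_pos h'.1 h'.2, hi.2, jump_flipTop hR (topF_V hR h'.2).symm]
    simp
  · omega

theorem IsFakeCorner.dir_eq (hR : R.IsValid) {i : Fin d} (hi : R.IsFakeCorner i) :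
    R.dir (i - 1) 0 = R.dir i 0 := by
  have h := hi.2
  rw [detZ_corner] at h
  have p1 := hR.primitive (i - 1)
  have p2 := hR.primitive i
  have p2' : Int.gcd (R.dir i 0) (R.dir i 1 + R.numCuts i * R.dir i 0) = 1 := by
    simpa using p2
  rcases STRep.not_isTip (hi.not_isTip hR) with h' | h'
  · exact Int.eq_of_coprime_of_mul_eq p1 p2' (by linarith) h'.1 h'.2
  · have := Int.eq_of_coprime_of_mul_eq (a := -R.dir (i - 1) 0) (b := -R.dir (i - 1) 1)
      (c := -R.dir i 0) (d := -(R.dir i 1 + R.numCuts i * R.dir i 0))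
      (by simpa [Int.gcd_neg, Int.neg_gcd] using p1) (by rwa [Int.gcd_neg, Int.neg_gcd]) (by linarith)
      (by omega) (by omega)
    omega

theorem IsFakeCorner.dir_ne_zero (hR : R.IsValid) {i : Fin d} (hi : R.IsFakeCorner i) :
    R.dir i 0 ≠ 0 := by
  rcases STRep.not_isTip (hi.not_isTip hR) with h' | h' <;> omega

/-- No flipped cut lies strictly between two abscissas. -/
def NoCross (R : STRep d m) (u : Fin m → ℤ) (x y : ℝ) : Prop :=
  ∀ j, u j ≠ 0 → ¬ (x < R.c j 0 ∧ R.c j 0 < y) ∧ ¬ (y < R.c j 0 ∧ R.c j 0 < x)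

theorem NoCross.symm {u : Fin m → ℤ} {x y : ℝ} (h : R.NoCross u x y) : R.NoCross u y x :=
  fun j hj => (h j hj).symm

theorem NoCross.mono {u : Fin m → ℤ} {x y z : ℝ} (h : R.NoCross u x y)
    (hz : (x ≤ z ∧ z ≤ y) ∨ (y ≤ z ∧ z ≤ x)) : R.NoCross u x z := by
  intro j hj
  obtain ⟨h1, h2⟩ := h j hj
  rcases hz with hz | hz
  · exact ⟨fun h => h1 ⟨h.1, h.2.trans_le hz.2⟩, fun h => absurd hz.1 (not_le.2 (h.1.trans h.2))⟩
  · exact ⟨fun h => absurd hz.2 (not_le.2 (h.1.trans h.2)), fun h => h2 ⟨hz.1.trans_lt h.1, h.2⟩⟩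

theorem exists_delta_noCross (R : STRep d m) (x : ℝ) :
    ∃ δ > 0, ∀ y, |y - x| ≤ δ → ∀ u, R.NoCross u x y := by
  obtain ⟨δ, hδ, h⟩ := R.exists_delta x
  refine ⟨δ, hδ, fun y hy u j _ => ⟨fun hj => ?_, fun hj => ?_⟩⟩
  · exact (h δ hδ.le le_rfl).1 j ⟨hj.1, by linarith [(abs_le.1 hy).2]⟩
  · exact (h δ hδ.le le_rfl).2 j ⟨by linarith [(abs_le.1 hy).1], hj.2⟩

theorem flip_edge (u : Fin m → ℤ) {p q : Pt} {w : Fin 2 → ℤ} {s : ℝ} (hs : 0 ≤ s)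
    (hq : ∀ k, q k = p k + s * w k) (h : R.NoCross u (p 0) (q 0)) :
    R.flip u q 1 = R.flip u p 1 + s * R.germ u (p 0) w 1 := by
  simp only [flip_one, germ, cons_val_one]
  rw [hq 1]
  split_ifs with hw
  · have hw' : (0 : ℝ) ≤ w 0 := by exact_mod_cast hw
    have := R.phi_right u (x := p 0) (s := s * w 0) (by positivity) fun j hj => by
      rw [← hq 0]; exact (h j hj).1
    rw [hq 0, this]
    push_cast
    ring
  · have hw' : (w 0 : ℝ) ≤ 0 := by exact_mod_cast (not_le.1 hw).le
    have := R.phi_left u (x := p 0) (s := -(s * w 0)) (by nlinarith) fun j hj => by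
      rw [sub_neg_eq_add, ← hq 0]; exact (h j hj).2
    rw [sub_neg_eq_add] at this
    rw [hq 0, this]
    push_cast
    ring

theorem germ_edge_end (u : Fin m → ℤ) {p q : Pt} {w : Fin 2 → ℤ} {s : ℝ} (hs : 0 < s)
    (hq : q 0 = p 0 + s * w 0) (h : R.NoCross u (p 0) (q 0)) :
    R.germ u (q 0) (fun k => -w k) 1 = -R.germ u (p 0) w 1 := by
  simp only [germ, cons_val_one, cons_val_fin_one]
  rcases lt_trichotomy (w 0) 0 with hw | hw | hw
  · have hw' : (w 0 : ℝ) < 0 := by exact_mod_cast hw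
    have hlt : q 0 < p 0 := by nlinarith
    have : R.rhoR u (q 0) = R.rhoL u (p 0) := by
      unfold rhoR rhoL
      refine Finset.sum_congr rfl fun j _ => ?_
      rcases eq_or_ne (u j) 0 with hj | hj
      · simp [hj]
      · have := (h j hj).2
        congr 1
        exact propext ⟨fun h1 => h1.trans_lt hlt, fun h1 => not_lt.1 fun h2 => this ⟨h2, h1⟩⟩
    rw [if_pos (by omega), if_neg (by omega), this]
    ring
  · simp [hw]
  · have hw' : (0 : ℝ) < w 0 := by exact_mod_cast hw
    have hlt : p 0 < q 0 := by nlinarith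
    have : R.rhoL u (q 0) = R.rhoR u (p 0) := by
      unfold rhoR rhoL
      refine Finset.sum_congr rfl fun j _ => ?_
      rcases eq_or_ne (u j) 0 with hj | hj
      · simp [hj]
      · have := (h j hj).1
        congr 1
        exact propext ⟨fun h1 => not_lt.1 fun h2 => this ⟨h2, h1⟩, fun h1 => h1.trans_lt hlt⟩
    rw [if_neg (by omega), if_pos (by omega), this]
    ring

end STRep

section cyclic

variable {d : ℕ}

theorem distCyc_lt [NeZero d] (s i : Fin d) : distCyc s i < d :=
  Nat.mod_lt _ (Nat.pos_of_neZero d)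

theorem distCyc_eq (s i : Fin d) :
    distCyc s i = if s ≤ i then i.val - s.val else i.val + d - s.val := by
  unfold distCyc
  have := s.isLt
  have := i.isLt
  split_ifs with h
  · have h' : s.val ≤ i.val := h
    rw [show i.val + d - s.val = (i.val - s.val) + d by omega, Nat.add_mod_right,
      Nat.mod_eq_of_lt (by omega)]
  · have h' : i.val < s.val := not_le.1 h
    rw [Nat.mod_eq_of_lt (by omega)]

theorem chainLen_pos [NeZero d] (s e : Fin d) : 0 < chainLen s e := by
  unfold chainLen
  split_ifs with h
  · exact Nat.pos_of_neZero d
  · rw [distCyc_eq]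
    have : e.val ≠ s.val := fun h' => h (Fin.ext h')
    have := s.isLt
    split_ifs with h1
    · have h1 : s.val ≤ e.val := h1
      omega
    · omega

theorem chainLen_le [NeZero d] (s e : Fin d) : chainLen s e ≤ d := by
  unfold chainLen
  split_ifs
  · exact le_rfl
  · exact (distCyc_lt s e).le

theorem Fin.iterate_add_one_val [NeZero d] (s : Fin d) (k : ℕ) :
    ((· + 1)^[k] s).val = (s.val + k) % d := by
  induction k with
  | zero => simp [Nat.mod_eq_of_lt s.isLt]
  | succ k ih =>
    rw [Function.iterate_succ_apply', Fin.val_add, ih, Fin.val_one']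
    rw [← Nat.add_mod, add_assoc]

theorem distCyc_iterate [NeZero d] (s : Fin d) {k : ℕ} (hk : k < d) :
    distCyc s ((· + 1)^[k] s) = k := by
  unfold distCyc
  rw [Fin.iterate_add_one_val]
  have hs := s.isLt
  rcases lt_or_ge (s.val + k) d with h | h
  · rw [Nat.mod_eq_of_lt h, show s.val + k + d - s.val = k + d by omega, Nat.add_mod_right,
      Nat.mod_eq_of_lt hk]
  · rw [Nat.mod_eq_sub_mod h, Nat.mod_eq_of_lt (show s.val + k - d < d by omega),
      show s.val + k - d + d - s.val = k by omega, Nat.mod_eq_of_lt hk]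

theorem iterate_distCyc [NeZero d] (s i : Fin d) : (· + 1)^[distCyc s i] s = i := by
  ext
  rw [Fin.iterate_add_one_val, distCyc_eq]
  have := s.isLt
  have := i.isLt
  split_ifs with h
  · have h' : s.val ≤ i.val := h
    rw [show s.val + (i.val - s.val) = i.val by omega, Nat.mod_eq_of_lt i.isLt]
  · have h' : i.val < s.val := not_le.1 h
    rw [show s.val + (i.val + d - s.val) = i.val + d by omega, Nat.add_mod_right,
      Nat.mod_eq_of_lt i.isLt]

theorem iterate_chainLen [NeZero d] (s e : Fin d) : (· + 1)^[chainLen s e] s = e := by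
  unfold chainLen
  split_ifs with h
  · subst h
    ext
    rw [Fin.iterate_add_one_val]
    simp [Nat.mod_eq_of_lt e.isLt]
  · exact iterate_distCyc s e

theorem sum_distCyc [NeZero d] (s : Fin d) (P : ℕ → Prop) [DecidablePred P] (f : Fin d → ℝ) :
    (∑ i : Fin d, if P (distCyc s i) then f i else 0) =
      ∑ k ∈ (Finset.range d).filter P, f ((· + 1)^[k] s) := by
  rw [← Finset.sum_filter]
  refine Finset.sum_bij' (fun i _ => distCyc s i) (fun k _ => (· + 1)^[k] s) ?_ ?_ ?_ ?_ ?_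
  · intro i hi
    simp only [Finset.mem_filter, Finset.mem_univ, true_and] at hi
    simp [hi, distCyc_lt]
  · intro k hk
    simp only [Finset.mem_filter, Finset.mem_range] at hk
    simp only [Finset.mem_filter, Finset.mem_univ, true_and]
    rw [distCyc_iterate s hk.1]
    exact hk.2
  · intro i _
    exact iterate_distCyc s i
  · intro k hk
    exact distCyc_iterate s (Finset.mem_range.1 (Finset.mem_filter.1 hk).1)
  · intro i _
    exact (congrArg f (iterate_distCyc s i)).symm

end cyclic

namespace STRep

variable {d m : ℕ} [NeZero d] {R : STRep d m}

/-- The neighbouring vertex, in the clockwise (`b = true`) or anticlockwise direction. -/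
def next (b : Bool) (i : Fin d) : Fin d := bif b then i + 1 else i - 1

/-- The primitive direction of the edge from a vertex to its neighbour. -/
def dirAt (R : STRep d m) (b : Bool) (i : Fin d) : Fin 2 → ℤ := bif b then R.u2 i else R.u1 i

/-- The length of the edge from a vertex to its neighbour. -/
def lenAt (R : STRep d m) (b : Bool) (i : Fin d) : ℝ := bif b then R.len i else R.len (i - 1)

/-- The orientation sign. -/
def sg (b : Bool) : ℝ := bif b then 1 else -1

theorem sg_mul_self (b : Bool) : sg b * sg b = 1 := by cases b <;> simp [sg]

theorem lenAt_pos (hR : R.IsValid) (b : Bool) (i : Fin d) : 0 < R.lenAt b i := by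
  cases b
  · exact hR.len_pos (i - 1)
  · exact hR.len_pos i

theorem V_next (hR : R.IsValid) (b : Bool) (i : Fin d) (k : Fin 2) :
    R.V (next b i) k = R.V i k + R.lenAt b i * R.dirAt b i k := by
  cases b
  · have := V_eq_pred hR i k
    simp [next, lenAt, dirAt, u1]
    linarith
  · exact V_succ hR i k

theorem dirAt_not_next (b : Bool) (i : Fin d) :
    R.dirAt (!b) (next b i) = fun k => -R.dirAt b i k := by
  cases b <;> ext k <;> simp [next, dirAt, u1, u2]

theorem next_not_next (b : Bool) (i : Fin d) : next (!b) (next b i) = i := by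
  cases b <;> simp [next]

/-- A point of an edge emanating from a vertex. -/
theorem dirAt_mem (hR : R.IsValid) (b : Bool) (i : Fin d) {s : ℝ} (h0 : 0 ≤ s)
    (h1 : s ≤ R.lenAt b i) {q : Pt} (hq : ∀ k, q k = R.V i k + s * R.dirAt b i k) :
    q ∈ R.carrier := by
  cases b
  · refine edge_mem_carrier hR (i - 1) (s := R.len (i - 1) - s) (sub_nonneg.2 h1) (by linarith)
      fun k => ?_
    rw [hq k, V_eq_pred hR i k]
    simp [dirAt, u1]
    ring
  · exact edge_mem_carrier hR i h0 h1 hq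

theorem support_dirAt (hR : R.IsValid) (b : Bool) (i : Fin d) {z : Pt} (hz : z ∈ R.carrier) :
    sg b * ((R.dirAt b i 0 : ℝ) * (z 1 - R.V i 1) - R.dirAt b i 1 * (z 0 - R.V i 0)) ≤ 0 := by
  cases b
  · have := support_pred hR i hz
    simp [sg, dirAt, u1]
    linarith
  · have := support hR i hz
    simp only [sg, cond_true, one_mul]
    exact this

theorem support_flip_dirAt (hR : R.IsValid) {u : Fin m → ℤ} (hu : R.IsFlip u) (b : Bool)
    (i : Fin d) {z : Pt} (hz : z ∈ R.carrier) :
    sg b * ((R.dirAt b i 0 : ℝ) * (R.flip u z 1 - R.flip u (R.V i) 1) -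
      R.germ u (R.V i 0) (R.dirAt b i) 1 * (z 0 - R.V i 0)) ≤ 0 := by
  cases b
  · have := support_flip_pred hR hu i hz
    simp only [sg, dirAt, cond_false]
    linarith
  · have := support_flip hR hu i hz
    simp only [sg, cond_true, one_mul]
    exact this

/-- The directions at a fake corner have the same horizontal component. -/
theorem dirAt_next_zero (hR : R.IsValid) (b : Bool) (i : Fin d) (h : R.IsFakeCorner (next b i)) :
    R.dirAt b (next b i) 0 = R.dirAt b i 0 := by
  have := h.dir_eq hR
  cases b
  · simp only [next, dirAt, u1, cond_false] at this ⊢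
    omega
  · simp only [next, dirAt, u2, cond_true] at this ⊢
    rw [← this, add_sub_cancel_right]

theorem dirAt_ne_zero_of_fake (hR : R.IsValid) (b : Bool) (i : Fin d) (h : R.IsFakeCorner i) :
    R.dirAt b i 0 ≠ 0 := by
  have h1 := h.dir_eq hR
  have h2 := h.dir_ne_zero hR
  cases b
  · simp only [dirAt, u1, cond_false]; omega
  · exact h2

theorem sg_mul_detZ (b : Bool) (i : Fin d) (u : Fin m → ℤ) (x : ℝ) :
    sg b * detZ (R.germ u x (R.dirAt (!b) i)) (R.germ u x (R.dirAt b i)) =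
      detZ (R.germ u x (R.u1 i)) (R.germ u x (R.u2 i)) := by
  cases b
  · simp [sg, dirAt, detZ]; ring
  · simp [sg, dirAt]

/-- The length of the path of `k` edges starting at a vertex. -/
noncomputable def armLen (R : STRep d m) (b : Bool) (s : Fin d) (k : ℕ) : ℝ :=
  ∑ j ∈ Finset.range k, R.lenAt b ((next b)^[j] s)

theorem armLen_zero (b : Bool) (s : Fin d) : R.armLen b s 0 = 0 := by simp [armLen]

theorem armLen_succ (b : Bool) (s : Fin d) (k : ℕ) :
    R.armLen b s (k + 1) = R.armLen b s k + R.lenAt b ((next b)^[k] s) :=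
  Finset.sum_range_succ _ _

theorem armLen_nonneg (hR : R.IsValid) (b : Bool) (s : Fin d) (k : ℕ) : 0 ≤ R.armLen b s k :=
  Finset.sum_nonneg fun _ _ => (lenAt_pos hR b _).le

theorem armLen_mono (hR : R.IsValid) (b : Bool) (s : Fin d) : Monotone (R.armLen b s) :=
  monotone_nat_of_le_succ fun k => by rw [armLen_succ]; linarith [lenAt_pos hR b ((next b)^[k] s)]

section corners

variable {D : ℕ} [NeZero D] {g : Fin D → Fin d}

/-- The number of edges in the semitoric edge emanating from a corner. -/
def armNum (g : Fin D → Fin d) (b : Bool) (a : Fin D) : ℕ :=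
  bif b then chainLen (g a) (g (a + 1)) else chainLen (g (a - 1)) (g a)

/-- A point at distance `t` from the corner on a given semitoric edge. -/
def ArmPt (R : STRep d m) (g : Fin D → Fin d) (b : Bool) (a : Fin D) (q : Pt) (t : ℝ) : Prop :=
  ∃ k < armNum g b a, ∃ s, 0 ≤ s ∧ s ≤ R.lenAt b ((next b)^[k] (g a)) ∧
    (∀ c, q c = R.V ((next b)^[k] (g a)) c + s * R.dirAt b ((next b)^[k] (g a)) c) ∧
    t = R.armLen b (g a) k + s

theorem armNum_pos (b : Bool) (a : Fin D) : 0 < armNum g b a := by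
  cases b <;> exact chainLen_pos _ _

theorem next_true : (next true : Fin d → Fin d) = (· + 1) := rfl

theorem next_false_iterate (s : Fin d) {k n : ℕ} (hk : k ≤ n) :
    (next false)^[k] ((next true)^[n] s) = (next true)^[n - k] s := by
  induction k with
  | zero => rfl
  | succ k ih =>
    rw [Function.iterate_succ_apply', ih (by omega), show n - k = (n - (k + 1)) + 1 by omega,
      Function.iterate_succ_apply']
    exact next_not_next true _

theorem next_armNum (b : Bool) (a : Fin D) :
    (next b)^[armNum g b a] (g a) = g (next b a) := by
  cases b
  · have h : g a = (next true)^[armNum g false a] (g (a - 1)) := (iterate_chainLen _ _).symm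
    conv_lhs => rw [h]
    rw [next_false_iterate _ le_rfl]
    simp [next]
  · exact iterate_chainLen _ _

theorem next_false_eq (a : Fin D) {k : ℕ} (hk : k ≤ armNum g false a) :
    (next false)^[k] (g a) = (next true)^[armNum g false a - k] (g (a - 1)) := by
  have h : g a = (next true)^[armNum g false a] (g (a - 1)) := (iterate_chainLen _ _).symm
  conv_lhs => rw [h]
  rw [next_false_iterate _ hk]

theorem not_corner_of_lt_chainLen (hg : StrictMono g) (a b : Fin D) {k : ℕ} (h0 : 0 < k)
    (h1 : k < chainLen (g a) (g (a + 1))) : (· + 1)^[k] (g a) ≠ g b := by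
  intro h
  have hv := congrArg Fin.val h
  have hkd : k < d := h1.trans_le (chainLen_le _ _)
  rw [Fin.iterate_add_one_val] at hv
  have ha := (g a).isLt
  have hb := (g b).isLt
  have hlt : ∀ {x y : Fin D}, x < y → (g x).val < (g y).val := fun h => hg h
  have hle : ∀ {x y : Fin D}, x ≤ y → (g x).val ≤ (g y).val := fun h => hg.monotone h
  have hD := Nat.pos_of_neZero D
  have hinj : ∀ {x y : Fin D}, (g x).val = (g y).val → x = y :=
    fun h => hg.injective (Fin.ext h)
  have hch : chainLen (g a) (g (a + 1)) =
      if g (a + 1) = g a then d else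
        if g a ≤ g (a + 1) then (g (a + 1)).val - (g a).val else
          (g (a + 1)).val + d - (g a).val := by
    rw [chainLen, distCyc_eq]
  rw [hch] at h1
  by_cases hw : a.val + 1 < D
  · have hv1 : (a + 1).val = a.val + 1 := by
      rw [Fin.val_add, Fin.val_one', Nat.mod_eq_of_lt (show 1 < D by omega), Nat.mod_eq_of_lt hw]
    have hl : a < a + 1 := by rw [Fin.lt_def, hv1]; omega
    have hl' := hlt hl
    rw [if_neg (hg hl).ne', if_pos (hg hl).le] at h1
    have hlt1 := (g (a + 1)).isLt
    rw [Nat.mod_eq_of_lt (by omega)] at hv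
    have c1 : a < b := by
      by_contra! hc
      have := hle hc
      omega
    have c2 : b < a + 1 := by
      by_contra! hc
      have := hle hc
      omega
    rw [Fin.lt_def] at c1 c2
    omega
  · have hv1 : (a + 1).val = 0 := by
      rw [Fin.val_add, Fin.val_one']
      have : a.val + 1 = D := by have := a.isLt; omega
      rcases Nat.lt_or_ge 1 D with h2 | h2
      · rw [Nat.mod_eq_of_lt h2, this, Nat.mod_self]
      · obtain rfl : D = 1 := by omega
        exact Nat.mod_one _
    have hlast : ∀ x : Fin D, x ≤ a := fun x => by
      rw [Fin.le_def]; have := x.isLt; omega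
    have hfirst : ∀ x : Fin D, a + 1 ≤ x := fun x => by
      rw [Fin.le_def]; omega
    have hba := hle (hlast b)
    have h1b := hle (hfirst b)
    have h1a := hle (hfirst a)
    rcases lt_or_ge ((g a).val + k) d with h2 | h2
    · rw [Nat.mod_eq_of_lt h2] at hv
      omega
    · rw [Nat.mod_eq_sub_mod h2, Nat.mod_eq_of_lt (by omega)] at hv
      split_ifs at h1 with h3 h4
      · have := congrArg Fin.val h3
        omega
      · have h4 : (g a).val ≤ (g (a + 1)).val := h4
        exact h3 (Fin.ext (by omega))
      · omega

theorem fake_arm (hg : IsCornerEnum R g) (b : Bool) (a : Fin D) {k : ℕ} (h0 : 0 < k)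
    (h1 : k < armNum g b a) : R.IsFakeCorner ((next b)^[k] (g a)) := by
  by_contra h
  obtain ⟨c, hc⟩ := (hg.2 _).1 h
  cases b
  · rw [next_false_eq a h1.le] at hc
    have h2 : armNum g false a = chainLen (g (a - 1)) (g (a - 1 + 1)) := by
      rw [sub_add_cancel]; rfl
    exact not_corner_of_lt_chainLen hg.1 (a - 1) c (k := armNum g false a - k) (by omega)
      (by rw [← h2]; omega) hc.symm
  · exact not_corner_of_lt_chainLen hg.1 a c h0 h1 hc.symm

theorem isHD (hg : IsCornerEnum R g) (a : Fin D) : R.IsHDCorner (g a) := (hg.2 _).2 ⟨a, rfl⟩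

theorem dirAt_arm_zero (hR : R.IsValid) (hg : IsCornerEnum R g) (b : Bool) (a : Fin D) {k : ℕ}
    (h : k < armNum g b a) : R.dirAt b ((next b)^[k] (g a)) 0 = R.dirAt b (g a) 0 := by
  induction k with
  | zero => rfl
  | succ k ih =>
    rw [Function.iterate_succ_apply', dirAt_next_zero hR, ih (by omega)]
    have := fake_arm hg b a (by omega) h
    rwa [Function.iterate_succ_apply'] at this

theorem V_arm_zero (hR : R.IsValid) (hg : IsCornerEnum R g) (b : Bool) (a : Fin D) {k : ℕ}
    (h : k ≤ armNum g b a) :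
    R.V ((next b)^[k] (g a)) 0 = R.V (g a) 0 + R.armLen b (g a) k * R.dirAt b (g a) 0 := by
  induction k with
  | zero => simp [armLen]
  | succ k ih =>
    rw [Function.iterate_succ_apply', V_next hR, ih (by omega), armLen_succ,
      dirAt_arm_zero hR hg b a (by omega)]
    ring

theorem ArmPt.zero (hR : R.IsValid) (hg : IsCornerEnum R g) {b : Bool} {a : Fin D} {q : Pt}
    {t : ℝ} (h : ArmPt R g b a q t) : q 0 = R.V (g a) 0 + t * R.dirAt b (g a) 0 := by
  obtain ⟨k, hk, s, h0, h1, hq, rfl⟩ := h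
  rw [hq 0, V_arm_zero hR hg b a hk.le, dirAt_arm_zero hR hg b a hk]
  ring

theorem ArmPt.mem (hR : R.IsValid) {b : Bool} {a : Fin D} {q : Pt} {t : ℝ}
    (h : ArmPt R g b a q t) : q ∈ R.carrier := by
  obtain ⟨k, hk, s, h0, h1, hq, rfl⟩ := h
  exact dirAt_mem hR b _ h0 h1 hq

theorem ArmPt.nonneg (hR : R.IsValid) {b : Bool} {a : Fin D} {q : Pt} {t : ℝ}
    (h : ArmPt R g b a q t) : 0 ≤ t := by
  obtain ⟨k, hk, s, h0, h1, hq, rfl⟩ := h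
  exact add_nonneg (armLen_nonneg hR _ _ _) h0

theorem ArmPt.exists {b : Bool} {a : Fin D} {t : ℝ} (h0 : 0 ≤ t)
    (h1 : t ≤ R.armLen b (g a) (armNum g b a)) : ∃ q, ArmPt R g b a q t := by
  have key : ∀ K, 0 < K → K ≤ armNum g b a → t ≤ R.armLen b (g a) K → ∃ q, ArmPt R g b a q t := by
    intro K
    induction K with
    | zero => intro h; omega
    | succ K ih =>
      intro _ h2 h3
      rcases Nat.eq_zero_or_pos K with rfl | hK
      · rw [armLen_succ, armLen_zero, zero_add] at h3
        exact ⟨_, 0, by omega, t, h0, h3, fun c => rfl, by simp [armLen]⟩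
      · rcases le_total t (R.armLen b (g a) K) with h | h
        · exact ih hK (by omega) h
        · rw [armLen_succ] at h3
          exact ⟨_, K, by omega, t - R.armLen b (g a) K, by linarith, by linarith,
            fun c => rfl, by ring⟩
  exact key _ (armNum_pos b a) le_rfl h1

theorem armPt_zero (hR : R.IsValid) (b : Bool) (a : Fin D) : ArmPt R g b a (R.V (g a)) 0 :=
  ⟨0, armNum_pos b a, 0, le_rfl, (lenAt_pos hR b _).le, fun c => by simp, by simp [armLen]⟩

theorem armLen_true (a : Fin D) {k : ℕ} (hk : k ≤ armNum g true a) :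
    (∑ i : Fin d, if distCyc (g a) i < k then R.len i else 0) = R.armLen true (g a) k := by
  rw [sum_distCyc (g a) (· < k)]
  have hd : k ≤ d := hk.trans (chainLen_le _ _)
  have : (Finset.range d).filter (· < k) = Finset.range k := by
    ext x; simp; omega
  rw [this]
  rfl

theorem armLen_false (a : Fin D) {k : ℕ} (hk : k ≤ armNum g false a) :
    (∑ i : Fin d, if armNum g false a - k ≤ distCyc (g (a - 1)) i ∧
        distCyc (g (a - 1)) i < armNum g false a then R.len i else 0) =
      R.armLen false (g a) k := by
  rw [sum_distCyc (g (a - 1)) fun x => armNum g false a - k ≤ x ∧ x < armNum g false a]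
  have hd : armNum g false a ≤ d := chainLen_le _ _
  have : (Finset.range d).filter (fun x => armNum g false a - k ≤ x ∧ x < armNum g false a) =
      Finset.Ico (armNum g false a - k) (armNum g false a) := by
    ext x; simp; omega
  rw [this]
  clear this
  induction k with
  | zero => simp [armLen]
  | succ k ih =>
    rw [armLen_succ, ← ih (by omega), Finset.sum_eq_sum_Ico_succ_bot (by omega),
      show armNum g false a - (k + 1) + 1 = armNum g false a - k by omega,
      next_false_eq a (by omega)]
    rw [add_comm]
    congr 1
    rw [show armNum g false a - k = armNum g false a - (k + 1) + 1 by omega,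
      Function.iterate_succ_apply']
    simp only [lenAt, cond_false, next, cond_true, add_sub_cancel_right]
    rfl

theorem stEdgeLen_eq_true (a : Fin D) :
    stEdgeLen R g a = R.armLen true (g a) (armNum g true a) :=
  armLen_true a le_rfl

theorem armNum_false_succ (a : Fin D) : armNum g false (a + 1) = armNum g true a := by
  simp [armNum]

theorem stEdgeLen_eq_false (a : Fin D) :
    stEdgeLen R g a = R.armLen false (g (a + 1)) (armNum g false (a + 1)) := by
  rw [← armLen_false (a + 1) le_rfl]
  simp [stEdgeLen, armNum]

theorem armPt_true_iff {a : Fin D} {q : Pt} {t : ℝ} : ArmPt R g true a q t ↔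
    ∃ (i : Fin d) (s : ℝ), distCyc (g a) i < chainLen (g a) (g (a + 1)) ∧
      0 ≤ s ∧ s ≤ R.len i ∧ (∀ k, q k = R.V i k + s * (R.dir i k : ℝ)) ∧
      t = (∑ i' : Fin d, if distCyc (g a) i' < distCyc (g a) i then R.len i' else 0) + s := by
  constructor
  · rintro ⟨k, hk, s, h0, h1, hq, rfl⟩
    have hk' : k < chainLen (g a) (g (a + 1)) := hk
    have e : distCyc (g a) ((next true)^[k] (g a)) = k :=
      distCyc_iterate _ (hk'.trans_le (chainLen_le _ _))
    refine ⟨(next true)^[k] (g a), s, by rwa [e], h0, h1, hq, ?_⟩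
    rw [e, armLen_true a hk.le]
  · rintro ⟨i, s, hk, h0, h1, hq, rfl⟩
    refine ⟨distCyc (g a) i, hk, s, h0, ?_, ?_, ?_⟩
    · rw [next_true, iterate_distCyc]; exact h1
    · rw [next_true, iterate_distCyc]; exact hq
    · rw [armLen_true a (show distCyc (g a) i ≤ armNum g true a from hk.le)]

theorem armPt_false_iff (hR : R.IsValid) {a : Fin D} {q : Pt} {t : ℝ} : ArmPt R g false a q t ↔
    ∃ (i : Fin d) (s : ℝ), distCyc (g (a - 1)) i < chainLen (g (a - 1)) (g a) ∧
      0 ≤ s ∧ s ≤ R.len i ∧ (∀ k, q k = R.V i k + s * (R.dir i k : ℝ)) ∧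
      t = (∑ i' : Fin d, if distCyc (g (a - 1)) i < distCyc (g (a - 1)) i' ∧
              distCyc (g (a - 1)) i' < chainLen (g (a - 1)) (g a) then R.len i' else 0)
          + (R.len i - s) := by
  have hn : armNum g false a = chainLen (g (a - 1)) (g a) := rfl
  have key : ∀ k, k + 1 ≤ armNum g false a → ∀ i : Fin d, distCyc (g (a - 1)) i + (k + 1) =
      armNum g false a → (next false)^[k] (g a) = i + 1 ∧ R.armLen false (g a) k =
      ∑ i' : Fin d, if distCyc (g (a - 1)) i < distCyc (g (a - 1)) i' ∧
              distCyc (g (a - 1)) i' < chainLen (g (a - 1)) (g a) then R.len i' else 0 := by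
    intro k hk i hi
    constructor
    · rw [next_false_eq a (by omega), show armNum g false a - k = distCyc (g (a - 1)) i + 1 by omega,
        Function.iterate_succ_apply', next_true, iterate_distCyc]
    · rw [← armLen_false a (by omega), show armNum g false a - k = distCyc (g (a - 1)) i + 1 by omega]
      rfl
  constructor
  · rintro ⟨k, hk, s, h0, h1, hq, rfl⟩
    have e : distCyc (g (a - 1)) ((next true)^[armNum g false a - (k + 1)] (g (a - 1))) =
        armNum g false a - (k + 1) :=
      distCyc_iterate _ (by have := chainLen_le (g (a - 1)) (g a); omega)
    obtain ⟨k1, k2⟩ := key k hk ((next true)^[armNum g false a - (k + 1)] (g (a - 1))) (by omega)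
    set i := (next true)^[armNum g false a - (k + 1)] (g (a - 1))
    rw [k1] at h1 hq
    simp only [lenAt, dirAt, u1, cond_false, add_sub_cancel_right] at h1 hq
    refine ⟨i, R.len i - s, by omega, by linarith, by linarith, fun c => ?_, ?_⟩
    · rw [hq, V_succ hR]; push_cast; ring
    · rw [k2]; ring
  · rintro ⟨i, s, hk, h0, h1, hq, rfl⟩
    obtain ⟨k1, k2⟩ := key (armNum g false a - (distCyc (g (a - 1)) i + 1)) (by omega) i (by omega)
    refine ⟨armNum g false a - (distCyc (g (a - 1)) i + 1), by omega, R.len i - s, by linarith, ?_,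
      fun c => ?_, ?_⟩
    · rw [k1]; simp [lenAt]; linarith
    · rw [k1, hq, V_succ hR]; simp [dirAt, u1]; ring
    · rw [k2]

theorem onEmanating_iff (hR : R.IsValid) {a : Fin D} {q : Pt} {t : ℝ} :
    OnEmanating R g a q t ↔ ∃ b, ArmPt R g b a q t := by
  rw [OnEmanating, ← armPt_true_iff, ← armPt_false_iff hR]
  simp [or_comm]

/-- The semitoric edge seen from its other end. -/
theorem ArmPt.reverse (hR : R.IsValid) {a : Fin D} {q : Pt} {t : ℝ} (h : ArmPt R g true a q t) :
    ArmPt R g false (a + 1) q (stEdgeLen R g a - t) := by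
  obtain ⟨k, hk, s, h0, h1, hq, rfl⟩ := h
  have hn := armNum_false_succ (g := g) a
  have e : (next false)^[armNum g true a - (k + 1)] (g (a + 1)) = (next true)^[k] (g a) + 1 := by
    rw [next_false_eq (g := g) (a + 1) (by rw [armNum_false_succ]; omega), hn,
      show armNum g true a - (armNum g true a - (k + 1)) = k + 1 by omega,
      Function.iterate_succ_apply', add_sub_cancel_right]
    rfl
  refine ⟨armNum g true a - (k + 1), by rw [hn]; omega, R.len ((next true)^[k] (g a)) - s, ?_, ?_, ?_, ?_⟩
  · simpa [lenAt] using h1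
  · rw [e]; simp [lenAt]; linarith
  · intro c
    rw [e, hq, V_succ hR]; simp [dirAt, u1, u2]; ring
  · have h2 := armLen_true (R := R) a (show k + 1 ≤ armNum g true a by omega)
    have h3 := armLen_false (R := R) (a + 1) (g := g) (k := armNum g true a - (k + 1)) (by rw [armNum_false_succ]; omega)
    rw [armLen_succ] at h2
    rw [← h3]
    rw [hn, add_sub_cancel_right, show armNum g true a - (armNum g true a - (k + 1)) = k + 1 by omega]
    have h4 : stEdgeLen R g a =
      (∑ i : Fin d, if distCyc (g a) i < k + 1 then R.len i else 0) +
      ∑ i : Fin d, if k + 1 ≤ distCyc (g a) i ∧ distCyc (g a) i < armNum g true a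
        then R.len i else 0 := by
      rw [stEdgeLen, ← Finset.sum_add_distrib]
      refine Finset.sum_congr rfl fun i _ => ?_
      have : armNum g true a = chainLen (g a) (g (a + 1)) := rfl
      rw [← this]
      by_cases c1 : distCyc (g a) i < k + 1
      · rw [if_pos c1, if_pos (by omega), if_neg (by omega), add_zero]
      · by_cases c2 : distCyc (g a) i < armNum g true a
        · rw [if_neg c1, if_pos c2, if_pos (by omega), zero_add]
        · rw [if_neg c1, if_neg c2, if_neg (by omega), zero_add]
    rw [h4, h2]
    simp only [lenAt, cond_true]
    ring

end corners

theorem germ_zero (u : Fin m → ℤ) (x : ℝ) (w : Fin 2 → ℤ) : R.germ u x w 0 = w 0 := rfl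

theorem germ_of_zero (u : Fin m → ℤ) (x : ℝ) {w : Fin 2 → ℤ} (h : w 0 = 0) :
    R.germ u x w 1 = w 1 := by simp [germ, h]

theorem dirAt_ne_zero (hR : R.IsValid) (b : Bool) (i : Fin d) (h : R.dirAt b i 0 = 0) :
    R.dirAt b i 1 ≠ 0 := by
  intro h'
  cases b
  · have := hR.primitive (i - 1)
    simp [dirAt, u1] at h h'
    simp [h, h'] at this
  · have := hR.primitive i
    simp [dirAt, u2] at h h'
    simp [h, h'] at this

/-- Two-sided supports at a vertex force both edge directions to be parallel to a line of the
flipped polygon passing through it. -/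
theorem parallel_of_two_sided (hR : R.IsValid) {u : Fin m → ℤ} (hu : R.IsFlip u) (b : Bool)
    (i : Fin d) {v : Fin 2 → ℤ} {s t : ℝ} (hs : 0 < s) (ht : 0 < t) {y z : Pt}
    (hy : y ∈ R.carrier) (hz : z ∈ R.carrier) (hy0 : y 0 = R.V i 0 + s * v 0)
    (hy1 : R.flip u y 1 = R.flip u (R.V i) 1 + s * v 1) (hz0 : z 0 = R.V i 0 - t * v 0)
    (hz1 : R.flip u z 1 = R.flip u (R.V i) 1 - t * v 1) :
    R.dirAt b i 0 * v 1 = R.germ u (R.V i 0) (R.dirAt b i) 1 * v 0 := by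
  have h1 := support_flip_dirAt hR hu b i hy
  have h2 := support_flip_dirAt hR hu b i hz
  rw [hy0, hy1] at h1
  rw [hz0, hz1] at h2
  set w : ℝ := (R.dirAt b i 0 : ℝ)
  set y : ℝ := (R.germ u (R.V i 0) (R.dirAt b i) 1 : ℝ)
  have k1 : sg b * (w * v 1 - y * v 0) ≤ 0 := by
    by_contra! h
    nlinarith [mul_pos hs h]
  have k2 : 0 ≤ sg b * (w * v 1 - y * v 0) := by
    by_contra! h
    nlinarith [mul_pos ht (neg_pos.2 h)]
  have k3 : w * v 1 - y * v 0 = 0 := by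
    have := sg_mul_self b
    have h0 : sg b * (w * v 1 - y * v 0) = 0 := le_antisymm k1 k2
    calc _ = (sg b * sg b) * (w * v 1 - y * v 0) := by rw [this, one_mul]
      _ = 0 := by rw [mul_assoc, h0, mul_zero]
  have k4 : w * v 1 = y * v 0 := by linarith
  exact Int.cast_injective (α := ℝ) (by push_cast; exact k4)

section corners

variable {D : ℕ} [NeZero D] {g : Fin D → Fin d}

theorem armNum_eq_one (hR : R.IsValid) (hg : IsCornerEnum R g) {b : Bool} {a : Fin D}
    (h : R.dirAt b (g a) 0 = 0) : armNum g b a = 1 := by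
  by_contra hne
  have h1 : 1 < armNum g b a := by have := armNum_pos (g := g) b a; omega
  have := dirAt_ne_zero_of_fake hR b _ (fake_arm hg b a one_pos h1)
  rw [dirAt_arm_zero hR hg b a h1] at this
  exact this h

/-- The flipped polygon contains a half-open segment. -/
def HasSegment (R : STRep d m) (u : Fin m → ℤ) (p : Pt) (v : Fin 2 → ℤ) (lam : ℝ) : Prop :=
  ∀ s, 0 ≤ s → s < lam →
    ∃ z ∈ R.carrier, z 0 = p 0 + s * v 0 ∧ R.flip u z 1 = R.flip u p 1 + s * v 1

theorem flip_edge_of_hasSegment (hR : R.IsValid) (hg : IsCornerEnum R g) {u : Fin m → ℤ}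
    (hu : R.IsFlip u) {b : Bool} {a : Fin D} {lam : ℝ} {v : Fin 2 → ℤ}
    (hv0 : v 0 = R.dirAt b (g a) 0) (hs : HasSegment R u (R.V (g a)) v lam)
    {k : ℕ} (hk : k < armNum g b a)
    (hV : R.flip u (R.V ((next b)^[k] (g a))) 1 =
      R.flip u (R.V (g a)) 1 + R.armLen b (g a) k * v 1)
    (hgerm : R.germ u (R.V ((next b)^[k] (g a)) 0) (R.dirAt b ((next b)^[k] (g a))) 1 = v 1)
    {s : ℝ} (h0 : 0 ≤ s) (h1 : s ≤ R.lenAt b ((next b)^[k] (g a)))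
    (hlam : R.armLen b (g a) k + s < lam) {q : Pt}
    (hq : ∀ c, q c = R.V ((next b)^[k] (g a)) c + s * R.dirAt b ((next b)^[k] (g a)) c) :
    R.flip u q 1 = R.flip u (R.V (g a)) 1 + (R.armLen b (g a) k + s) * v 1 := by
  have hw0 := dirAt_arm_zero hR hg b a hk
  have hV0 := V_arm_zero hR hg b a hk.le
  set i := (next b)^[k] (g a)
  have hqm := dirAt_mem hR b i h0 h1 hq
  rw [← hv0] at hw0 hV0
  by_cases hz : v 0 = 0
  · rw [germ_of_zero _ _ (by rw [hw0, hz])] at hgerm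
    have e0 := hq 0
    have e1 := hq 1
    rw [hw0, hz] at e0
    simp only [Int.cast_zero, mul_zero, add_zero] at e0
    simp only [flip_one] at hV ⊢
    rw [e0, e1, hgerm]
    linarith
  · obtain ⟨z, hzm, hz0, hz1⟩ := hs (R.armLen b (g a) k + s)
      (add_nonneg (armLen_nonneg hR _ _ _) h0) hlam
    have hzq : z 0 = q 0 := by rw [hz0, hq 0, hV0, hw0]; ring
    have s1 := support_dirAt hR b i hzm
    have s2 := support_flip_dirAt hR hu b i hqm
    rw [hgerm, hw0, hV, hq 0, hw0] at s2
    rw [hzq, hq 0, hw0] at s1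
    have hf : R.flip u q 1 - R.flip u z 1 = q 1 - z 1 := by simp [hzq]
    have e1 := hq 1
    have t1 : sg b * v 0 * (z 1 - q 1) ≤ 0 := by
      rw [e1]; nlinarith
    have t2 : sg b * v 0 * (q 1 - z 1) ≤ 0 := by
      rw [← hf, hz1]; nlinarith
    have t3 : sg b * v 0 * (q 1 - z 1) = 0 := by linarith
    have hne : sg b * (v 0 : ℝ) ≠ 0 :=
      mul_ne_zero (fun h => by have := sg_mul_self b; simp [h] at this) (by exact_mod_cast hz)
    have t4 := (mul_eq_zero.1 t3).resolve_left hne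
    linarith

theorem arm_straight_aux (hR : R.IsValid) (hg : IsCornerEnum R g) {u : Fin m → ℤ}
    (hu : R.IsFlip u) {b : Bool} {a : Fin D} {lam : ℝ} {v : Fin 2 → ℤ}
    (hv : v = R.germ u (R.V (g a) 0) (R.dirAt b (g a)))
    (hs : HasSegment R u (R.V (g a)) v lam)
    {k : ℕ} (hk : k ≤ armNum g b a) (hlam : R.armLen b (g a) k < lam) :
    k < armNum g b a ∧ R.flip u (R.V ((next b)^[k] (g a))) 1 =
        R.flip u (R.V (g a)) 1 + R.armLen b (g a) k * v 1 ∧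
      R.germ u (R.V ((next b)^[k] (g a)) 0) (R.dirAt b ((next b)^[k] (g a))) 1 = v 1 := by
  induction k with
  | zero => exact ⟨armNum_pos b a, by simp [armLen], by simp [hv]⟩
  | succ k ih =>
    have hv0 : v 0 = R.dirAt b (g a) 0 := by rw [hv, germ_zero]
    have hk' : k < armNum g b a := hk
    obtain ⟨-, ih1, ih2⟩ := ih hk'.le (by
      rw [armLen_succ] at hlam; linarith [lenAt_pos hR b ((next b)^[k] (g a))])
    have hw0 := dirAt_arm_zero hR hg b a hk'
    have hV0 := V_arm_zero hR hg b a hk'.le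
    have hV0' := V_arm_zero hR hg b a hk
    rw [← hv0] at hw0 hV0 hV0'
    have edge := @flip_edge_of_hasSegment d m _ R D _ g hR hg u hu b a lam v hv0 hs k hk' ih1 ih2
    have hsucc : (next b)^[k + 1] (g a) = next b ((next b)^[k] (g a)) :=
      Function.iterate_succ_apply' _ _ _
    rw [hsucc] at hV0' ⊢
    have hlen := armLen_succ (R := R) b (g a) k
    set i := (next b)^[k] (g a)
    have hl := lenAt_pos hR b i
    have hW := edge hl.le le_rfl (by rw [← hlen]; exact hlam) (V_next hR b i)
    rw [← hlen] at hW
    obtain ⟨y, hy, hy0, hy1⟩ := hs (R.armLen b (g a) (k + 1) + (lam - R.armLen b (g a) (k + 1)) / 2)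
      (by linarith [armLen_nonneg hR b (g a) (k + 1)]) (by linarith)
    let z : Pt := fun c => R.V i c + (R.lenAt b i / 2) * R.dirAt b i c
    have hz : z ∈ R.carrier := dirAt_mem hR b i (by linarith) (by linarith) fun c => rfl
    have hz1 := edge (q := z) (s := R.lenAt b i / 2) (by linarith) (by linarith) (by linarith)
      fun c => rfl
    have hz0 : z 0 = R.V i 0 + (R.lenAt b i / 2) * v 0 := by rw [← hw0]
    have par := fun b' => parallel_of_two_sided hR hu b' (next b i) (v := v)
      (s := (lam - R.armLen b (g a) (k + 1)) / 2) (t := R.lenAt b i / 2) (by linarith)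
      (by linarith) hy hz (by rw [hy0, hV0']; ring) (by rw [hy1, hW]; ring)
      (by rw [hz0, hV0', hlen, hV0]; ring) (by rw [hz1, hW, hlen]; ring)
    have hvne : v 0 = 0 → v 1 ≠ 0 := by
      intro h
      rw [hv, germ_of_zero _ _ (by rw [← hv0, h])]
      exact dirAt_ne_zero hR b _ (by rw [← hv0, h])
    have hdet : detZ (R.germ u (R.V (next b i) 0) (R.dirAt (!b) (next b i)))
        (R.germ u (R.V (next b i) 0) (R.dirAt b (next b i))) = 0 := by
      have p1 := par b
      have p2 := par (!b)
      simp only [detZ, germ_zero]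
      set α := R.dirAt b (next b i) 0
      set β := R.germ u (R.V (next b i) 0) (R.dirAt b (next b i)) 1
      set α' := R.dirAt (!b) (next b i) 0
      set β' := R.germ u (R.V (next b i) 0) (R.dirAt (!b) (next b i)) 1
      by_cases h : v 0 = 0
      · have h1 := hvne h
        rw [h, mul_zero] at p1 p2
        rw [(mul_eq_zero.1 p1).resolve_right h1, (mul_eq_zero.1 p2).resolve_right h1]
        ring
      · apply mul_right_cancel₀ h
        linear_combination α * p2 - α' * p1
    have hfake : R.IsFakeCorner (next b i) := by
      by_contra hc
      have hpos := IsHDCorner.detZ_germ_pos hR hc hu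
      have := sg_mul_detZ (R := R) b (next b i) u (R.V (next b i) 0)
      rw [hdet] at this
      have h2 : (0 : ℝ) < _ := Int.cast_pos.2 hpos
      rw [← this] at h2
      simp at h2
    refine ⟨?_, hW, ?_⟩
    · refine lt_of_le_of_ne hk fun h => isHD hg (next b a) ?_
      rw [← next_armNum (g := g), ← h, hsucc]
      exact hfake
    · have e := dirAt_next_zero hR b i hfake
      have hne := dirAt_ne_zero_of_fake hR b _ hfake
      have p1 := par b
      rw [e, hw0] at p1 hne
      rw [mul_comm] at p1
      exact (mul_right_cancel₀ hne p1).symm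

theorem le_armLen_of_hasSegment (hR : R.IsValid) (hg : IsCornerEnum R g) {u : Fin m → ℤ}
    (hu : R.IsFlip u) {b : Bool} {a : Fin D} {lam : ℝ}
    (hs : HasSegment R u (R.V (g a)) (R.germ u (R.V (g a) 0) (R.dirAt b (g a))) lam) :
    lam ≤ R.armLen b (g a) (armNum g b a) := by
  by_contra! h
  exact lt_irrefl _ (arm_straight_aux hR hg hu rfl hs le_rfl h).1

theorem ArmPt.flip_of_hasSegment (hR : R.IsValid) (hg : IsCornerEnum R g) {u : Fin m → ℤ}
    (hu : R.IsFlip u) {b : Bool} {a : Fin D} {lam : ℝ}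
    (hs : HasSegment R u (R.V (g a)) (R.germ u (R.V (g a) 0) (R.dirAt b (g a))) lam)
    {q : Pt} {t : ℝ} (hq : ArmPt R g b a q t) (ht : t < lam) :
    R.flip u q 1 = R.flip u (R.V (g a)) 1 +
      t * R.germ u (R.V (g a) 0) (R.dirAt b (g a)) 1 := by
  obtain ⟨k, hk, s, h0, h1, hq, rfl⟩ := hq
  obtain ⟨-, h2, h3⟩ := arm_straight_aux hR hg hu rfl hs hk.le (by linarith)
  exact flip_edge_of_hasSegment hR hg hu (germ_zero _ _ _) hs hk h2 h3 h0 h1 ht hq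

/-- The open edges of the top boundary are not crossed by upward cuts. -/
theorem noCross_top (hR : R.IsValid) {i : Fin d} (hi : 0 < R.dir i 0) :
    R.NoCross R.flipTop (R.V i 0) (R.V (i + 1) 0) := by
  have hi' := dir_zero_pos_cast hi
  have hlt : R.V i 0 < R.V (i + 1) 0 := by
    rw [V_succ hR i 0]; have := mul_pos (hR.len_pos i) hi'; linarith
  intro j hj
  refine ⟨fun ⟨h1, h2⟩ => ?_, fun ⟨h1, h2⟩ => by linarith⟩
  have he : R.eps j = 1 := by
    by_contra h
    exact hj (by simp [flipTop, h])
  obtain ⟨s, hs0, hs1, hs⟩ := exists_param hR hi h1.le h2.le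
  have ht := topF_edge hR hi hs0 hs1
  rw [← hs] at ht
  obtain ⟨k, hk⟩ := hR.cuts_at_vertices j ![R.c j 0, R.topF (R.c j 0)]
    (cutHits_top hR he rfl rfl)
  refine V_ne_edge hR i k (s := s) ?_ ?_ ?_
  · refine lt_of_le_of_ne hs0 fun h => ?_
    rw [← h] at hs; simp at hs; linarith
  · refine lt_of_le_of_ne hs1 fun h => ?_
    rw [h, ← V_succ hR i 0] at hs; linarith
  · rw [← hk]
    intro c
    fin_cases c
    · exact hs
    · exact ht

theorem noCross_top_dirAt (hR : R.IsValid) {b : Bool} {i : Fin d} (hi : 0 < sg b * R.dirAt b i 0) :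
    R.NoCross R.flipTop (R.V i 0) (R.V (next b i) 0) := by
  cases b
  · have h : 0 < R.dir (i - 1) 0 := by
      simp [sg, dirAt, u1] at hi; exact hi
    have := noCross_top hR h
    rw [sub_add_cancel] at this
    exact this.symm
  · exact noCross_top hR (by simpa [sg, dirAt, u2] using hi)

theorem arm_flat_aux (hR : R.IsValid) (hg : IsCornerEnum R g) {b : Bool} {a : Fin D}
    (hi : 0 < sg b * R.dirAt b (g a) 0) {k : ℕ} (hk : k < armNum g b a) :
    R.flip R.flipTop (R.V ((next b)^[k] (g a))) 1 = R.flip R.flipTop (R.V (g a)) 1 +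
        R.armLen b (g a) k * R.germ R.flipTop (R.V (g a) 0) (R.dirAt b (g a)) 1 ∧
      R.germ R.flipTop (R.V ((next b)^[k] (g a)) 0) (R.dirAt b ((next b)^[k] (g a))) 1 =
        R.germ R.flipTop (R.V (g a) 0) (R.dirAt b (g a)) 1 := by
  induction k with
  | zero => exact ⟨by simp [armLen], rfl⟩
  | succ k ih =>
    obtain ⟨ih1, ih2⟩ := ih (by omega)
    have hw0 := dirAt_arm_zero hR hg b a (k := k) (by omega)
    have hfake := fake_arm hg b a (Nat.succ_pos k) hk
    rw [Nat.succ_eq_add_one, Function.iterate_succ_apply'] at hfake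
    rw [armLen_succ, Function.iterate_succ_apply']
    set i := (next b)^[k] (g a)
    rw [← hw0] at hi
    have hnc := noCross_top_dirAt hR hi
    have hl := lenAt_pos hR b i
    constructor
    · rw [flip_edge R.flipTop hl.le (V_next hR b i) hnc, ih1, ih2]; ring
    · have h1 := germ_edge_end R.flipTop hl (V_next hR b i 0) hnc
      rw [← dirAt_not_next] at h1
      have e := dirAt_next_zero hR b i hfake
      have hdir : 0 < R.dir (next b i) 0 := by
        have h2 := hfake.dir_eq hR
        rw [← e] at hi
        cases b
        · simp [sg, dirAt, u1] at hi; rw [← h2]; exact hi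
        · simpa [sg, dirAt, u2] using hi
      have h3 := hfake.detZ_germ_flipTop hR hdir
      have h4 := sg_mul_detZ (R := R) b (next b i) R.flipTop (R.V (next b i) 0)
      rw [h3, Int.cast_zero] at h4
      have hsg : sg b ≠ 0 := fun h => by have := sg_mul_self b; simp [h] at this
      have h5 := (mul_eq_zero.1 h4).resolve_left hsg
      rw [Int.cast_eq_zero] at h5
      have hne := dirAt_ne_zero_of_fake hR b _ hfake
      have e' := congrFun (dirAt_not_next (R := R) b i) 0
      simp only [detZ, germ_zero, h1, e', ih2] at h5
      rw [e] at h5 hne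
      refine mul_left_cancel₀ hne ?_
      linear_combination -h5

/-- Semitoric edges on the top boundary are straight once all upward cuts are removed. -/
theorem ArmPt.flip_flipTop (hR : R.IsValid) (hg : IsCornerEnum R g) {b : Bool} {a : Fin D}
    (hi : 0 < sg b * R.dirAt b (g a) 0) {q : Pt} {t : ℝ} (hq : ArmPt R g b a q t) :
    R.flip R.flipTop q 1 = R.flip R.flipTop (R.V (g a)) 1 +
      t * R.germ R.flipTop (R.V (g a) 0) (R.dirAt b (g a)) 1 := by
  obtain ⟨k, hk, s, h0, h1, hq, rfl⟩ := hq
  obtain ⟨h2, h3⟩ := arm_flat_aux hR hg hi hk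
  have hw0 := dirAt_arm_zero hR hg b a hk
  set i := (next b)^[k] (g a)
  rw [← hw0] at hi
  have hnc := noCross_top_dirAt hR hi
  have hn := V_next hR b i 0
  have hq0 := hq 0
  have hl := lenAt_pos hR b i
  have : R.NoCross R.flipTop (R.V i 0) (q 0) := by
    refine hnc.mono ?_
    rw [hn, hq0]
    rcases le_total 0 (R.dirAt b i 0 : ℝ) with h | h
    · left; constructor <;> nlinarith
    · right; constructor <;> nlinarith
  rw [flip_edge R.flipTop h0 hq this, h2, h3]
  ring

theorem ArmPt.top (hR : R.IsValid) (hg : IsCornerEnum R g) {b : Bool} {a : Fin D}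
    (hi : 0 < sg b * R.dirAt b (g a) 0) {q : Pt} {t : ℝ} (hq : ArmPt R g b a q t) :
    q 1 = R.topF (q 0) := by
  obtain ⟨k, hk, s, h0, h1, hq, rfl⟩ := hq
  have hw0 := dirAt_arm_zero hR hg b a hk
  set i := (next b)^[k] (g a)
  rw [← hw0] at hi
  cases b
  · have h : 0 < R.dir (i - 1) 0 := by simp [sg, dirAt, u1] at hi; exact hi
    have e : ∀ c, q c = R.V (i - 1) c + (R.len (i - 1) - s) * R.dir (i - 1) c := fun c => by
      rw [hq, V_eq_pred hR i c]; simp [dirAt, u1]; ring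
    rw [e, e 0, topF_edge hR h (by simpa [lenAt] using h1) (by linarith)]
  · have h : 0 < R.dir i 0 := by simpa [sg, dirAt, u2] using hi
    rw [hq, hq 0]
    exact (topF_edge hR h h0 h1).symm

end corners

/-- The half-open triangle with vertex `p` and sides `v`, `w` in the flipped polygon. -/
def triangle (R : STRep d m) (u : Fin m → ℤ) (p : Pt) (v w : Fin 2 → ℤ) (lam : ℝ) : Set Pt :=
  {z | ∃ s r : ℝ, 0 ≤ s ∧ 0 ≤ r ∧ s + r < lam ∧ z 0 = p 0 + (s * v 0 + r * w 0) ∧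
    R.flip u z 1 = R.flip u p 1 + (s * v 1 + r * w 1)}

theorem stMap_eq_flip (n : ℤ) (t : ℝ) (u : Fin m → ℤ) (z : Pt) :
    stMap R.c n t u z = ![z 0, R.flip u z 1 + n * z 0 + t] := by
  ext i
  fin_cases i
  · rfl
  · simp [stMap, phi]; ring

theorem sl2Apply_zero (M : Matrix.SpecialLinearGroup (Fin 2) ℤ) (x : Pt) :
    sl2Apply M x 0 = M.1 0 0 * x 0 + M.1 0 1 * x 1 := by
  simp [sl2Apply, Matrix.mulVec, dotProduct, Fin.sum_univ_two]

theorem sl2Apply_one (M : Matrix.SpecialLinearGroup (Fin 2) ℤ) (x : Pt) :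
    sl2Apply M x 1 = M.1 1 0 * x 0 + M.1 1 1 * x 1 := by
  simp [sl2Apply, Matrix.mulVec, dotProduct, Fin.sum_univ_two]

theorem stMap_injective (n : ℤ) (t : ℝ) (u : Fin m → ℤ) :
    Function.Injective (stMap R.c n t u) := by
  intro x y h
  rw [stMap_eq_flip, stMap_eq_flip] at h
  have h0 : x 0 = y 0 := congrFun h 0
  have h1 : R.flip u x 1 + n * x 0 + t = R.flip u y 1 + n * y 0 + t := congrFun h 1
  simp only [flip_one, h0] at h1
  ext i
  fin_cases i
  · exact h0
  · show x 1 = y 1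
    linarith

theorem exists_triangle_of_packed {p : Pt} {lam : ℝ} {B : Set Pt}
    (h : IsSTPackedTriangle R p lam B) :
    0 < lam ∧ B ⊆ R.carrier ∧ (∀ j, R.c j ∉ B) ∧ ∃ u, R.IsFlip u ∧ ∃ v w : Fin 2 → ℤ,
      detZ v w = 1 ∧ B = R.triangle u p v w lam ∧ ∃ δ > 0, ∀ z ∈ R.carrier,
        |z 0 - p 0| < δ → |R.flip u z 1 - R.flip u p 1| < δ → z ∈ B := by
  obtain ⟨hl, hB, hc, n, t, u, hu, ⟨M, hM⟩, U, hU, hpU, hUB⟩ := h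
  refine ⟨hl, hB, hc, u, hu, ![M.1 0 0, M.1 1 0 - n * M.1 0 0], ![M.1 0 1, M.1 1 1 - n * M.1 0 1],
    ?_, ?_, ?_⟩
  · have := M.2
    rw [Matrix.det_fin_two] at this
    simp [detZ]
    linear_combination this
  · ext z
    rw [← (stMap_injective (R := R) n t u).mem_set_image, hM]
    constructor
    · rintro ⟨x, ⟨h0, h1, h2⟩, hx⟩
      have e0 := congrFun hx 0
      have e1 := congrFun hx 1
      simp only [Pi.add_apply, sl2Apply_zero, sl2Apply_one, stMap_eq_flip, cons_val_zero,
        cons_val_one] at e0 e1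
      refine ⟨x 0, x 1, h0, h1, h2, ?_, ?_⟩
      · simp; linarith
      · simp only [cons_val_zero, cons_val_one]
        push_cast
        linear_combination -e1 + n * e0
    · rintro ⟨s, r, h0, h1, h2, e0, e1⟩
      simp only [cons_val_zero, cons_val_one] at e0 e1
      push_cast at e1
      refine ⟨![s, r], ⟨h0, h1, h2⟩, ?_⟩
      ext i
      fin_cases i
      · simp [sl2Apply_zero, stMap_eq_flip]
        linarith
      · simp only [stMap_eq_flip, Pi.add_apply, Fin.mk_one, sl2Apply_one, cons_val_zero,
          cons_val_one]
        linear_combination -e1 - n * e0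
  · obtain ⟨ε, hε, hball⟩ := Metric.isOpen_iff.1 hU _ hpU
    have hn : 0 ≤ |(n : ℝ)| := abs_nonneg _
    refine ⟨ε / (1 + |(n : ℝ)|), by positivity, fun z hz h0 h1 => ?_⟩
    rw [lt_div_iff₀ (by positivity)] at h0 h1
    have hzU : stMap R.c n t u z ∈ U := by
      apply hball
      rw [Metric.mem_ball, dist_pi_lt_iff hε]
      intro i
      rw [Real.dist_eq]
      fin_cases i
      · simp only [stMap_eq_flip, Fin.zero_eta, cons_val_zero]
        nlinarith [abs_nonneg (z 0 - p 0)]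
      · have : R.flip u z 1 + n * z 0 + t - (R.flip u p 1 + n * p 0 + t) =
          (R.flip u z 1 - R.flip u p 1) + n * (z 0 - p 0) := by ring
        rw [stMap_eq_flip, stMap_eq_flip]
        change |R.flip u z 1 + n * z 0 + t - (R.flip u p 1 + n * p 0 + t)| < ε
        rw [this]
        calc _ ≤ |R.flip u z 1 - R.flip u p 1| + |(n : ℝ)| * |z 0 - p 0| := by
              rw [← abs_mul]; exact abs_add_le _ _
          _ < ε := by
              rcases hn.eq_or_lt with h | h
              · rw [← h] at h0 h1 ⊢; linarith
              · nlinarith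
    have : stMap R.c n t u z ∈ stMap R.c n t u '' B ∩ U := by
      rw [hUB]
      exact ⟨mem_image_of_mem _ hz, hzU⟩
    exact (stMap_injective (R := R) n t u).mem_set_image.1 this.1

theorem germ_primitive (hR : R.IsValid) (b : Bool) (i : Fin d) (u : Fin m → ℤ) (x : ℝ) {k : ℤ}
    (h0 : k ∣ R.germ u x (R.dirAt b i) 0) (h1 : k ∣ R.germ u x (R.dirAt b i) 1) : k ∣ 1 := by
  have key : ∀ w : Fin 2 → ℤ, Int.gcd (w 0) (w 1) = 1 → k ∣ R.germ u x w 0 →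
      k ∣ R.germ u x w 1 → k ∣ 1 := by
    intro w hw h0 h1
    rw [germ_zero] at h0
    have h2 : k ∣ w 1 := by
      have := dvd_sub h1 (h0.mul_left (if 0 ≤ w 0 then R.rhoR u x else R.rhoL u x))
      simpa [germ] using this
    have := Int.dvd_coe_gcd h0 h2
    rwa [hw] at this
  refine key _ ?_ h0 h1
  cases b
  · have := hR.primitive (i - 1)
    simpa [dirAt, u1, Int.gcd_neg, Int.neg_gcd] using this
  · exact hR.primitive i

theorem flip_self_sub (u : Fin m → ℤ) (z : Pt) : R.flip u z 1 = z 1 + R.phi u (z 0) := rfl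

/-- Short edge germs lie in the flipped polygon. -/
theorem exists_edge_point (hR : R.IsValid) (b : Bool) (i : Fin d) (u : Fin m → ℤ) :
    ∃ δ > 0, ∀ s, 0 ≤ s → s ≤ δ → ∃ q ∈ R.carrier, q 0 = R.V i 0 + s * R.dirAt b i 0 ∧
      R.flip u q 1 = R.flip u (R.V i) 1 + s * R.germ u (R.V i 0) (R.dirAt b i) 1 := by
  obtain ⟨δ, hδ, hnc⟩ := exists_delta_noCross R (R.V i 0)
  have hpos : (0 : ℝ) < 1 + |(R.dirAt b i 0 : ℝ)| := by positivity
  refine ⟨min (R.lenAt b i) (δ / (1 + |(R.dirAt b i 0 : ℝ)|)),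
    lt_min (lenAt_pos hR b i) (div_pos hδ hpos), fun s h0 h1 => ?_⟩
  refine ⟨fun c => R.V i c + s * R.dirAt b i c,
    dirAt_mem hR b i h0 (h1.trans (min_le_left _ _)) fun c => rfl, rfl, ?_⟩
  refine flip_edge u h0 (fun c => rfl) (hnc _ ?_ u)
  have h2 := h1.trans (min_le_right _ _)
  rw [le_div_iff₀ hpos] at h2
  rw [add_sub_cancel_left, abs_mul, abs_of_nonneg h0]
  linarith

/-- The sides of a packed triangle are the edge directions at the corner. -/
theorem triangle_sides (hR : R.IsValid) {u : Fin m → ℤ} (hu : R.IsFlip u) {i : Fin d} {lam : ℝ}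
    (hl : 0 < lam) {v w : Fin 2 → ℤ} (hdet : detZ v w = 1)
    (hsub : R.triangle u (R.V i) v w lam ⊆ R.carrier)
    (hloc : ∃ δ > 0, ∀ z ∈ R.carrier, |z 0 - R.V i 0| < δ →
      |R.flip u z 1 - R.flip u (R.V i) 1| < δ → z ∈ R.triangle u (R.V i) v w lam) :
    v = R.germ u (R.V i 0) (R.u1 i) ∧ w = R.germ u (R.V i 0) (R.u2 i) := by
  obtain ⟨δ, hδ, hloc⟩ := hloc
  have edge : ∀ b, 0 ≤ detZ (R.germ u (R.V i 0) (R.dirAt b i)) w ∧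
      0 ≤ detZ v (R.germ u (R.V i 0) (R.dirAt b i)) := by
    intro b
    obtain ⟨ε, hε, hq⟩ := exists_edge_point hR b i u
    set e := R.germ u (R.V i 0) (R.dirAt b i) with he
    have e0 : e 0 = R.dirAt b i 0 := rfl
    rw [← e0] at hq
    obtain ⟨s, hs, hs1, hs2, hs3⟩ : ∃ s : ℝ, 0 < s ∧ s ≤ ε ∧ s * |(e 0 : ℝ)| < δ ∧
        s * |(e 1 : ℝ)| < δ := by
      have hpos : (0 : ℝ) < 1 + |(e 0 : ℝ)| + |(e 1 : ℝ)| := by positivity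
      have hs : 0 < min ε (δ / (1 + |(e 0 : ℝ)| + |(e 1 : ℝ)|)) := lt_min hε (div_pos hδ hpos)
      have h := min_le_right ε (δ / (1 + |(e 0 : ℝ)| + |(e 1 : ℝ)|))
      rw [le_div_iff₀ hpos] at h
      refine ⟨_, hs, min_le_left _ _, ?_, ?_⟩ <;>
      nlinarith [abs_nonneg (e 0 : ℝ), abs_nonneg (e 1 : ℝ)]
    obtain ⟨q, hqm, hq0, hq1⟩ := hq s hs.le hs1
    obtain ⟨α, β, hα, hβ, -, k0, k1⟩ := hloc q hqm
      (by rwa [hq0, add_sub_cancel_left, abs_mul, abs_of_pos hs])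
      (by rwa [hq1, add_sub_cancel_left, abs_mul, abs_of_pos hs])
    rw [hq0] at k0
    rw [hq1] at k1
    have k0 : s * e 0 = α * v 0 + β * w 0 := by linarith
    have k1 : s * e 1 = α * v 1 + β * w 1 := by linarith
    have hdet' : (v 0 : ℝ) * w 1 - v 1 * w 0 = 1 := by
      have : ((detZ v w : ℤ) : ℝ) = 1 := by rw [hdet]; simp
      simpa [detZ] using this
    have a1 : s * ((e 0 : ℝ) * w 1 - e 1 * w 0) = α := by
      linear_combination (w 1 : ℝ) * k0 - w 0 * k1 + α * hdet'
    have a2 : s * ((v 0 : ℝ) * e 1 - v 1 * e 0) = β := by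
      linear_combination (v 0 : ℝ) * k1 - v 1 * k0 + β * hdet'
    constructor
    · have : 0 ≤ (e 0 : ℝ) * w 1 - e 1 * w 0 := by
        by_contra! h; nlinarith
      rw [detZ]; exact_mod_cast this
    · have : 0 ≤ (v 0 : ℝ) * e 1 - v 1 * e 0 := by
        by_contra! h; nlinarith
      rw [detZ]; exact_mod_cast this
  have sup : ∀ y : Fin 2 → ℤ, (∃ z ∈ R.carrier, ∃ s : ℝ, 0 < s ∧ z 0 = R.V i 0 + s * y 0 ∧
      R.flip u z 1 = R.flip u (R.V i) 1 + s * y 1) →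
      0 ≤ detZ (R.germ u (R.V i 0) (R.u1 i)) y ∧ detZ (R.germ u (R.V i 0) (R.u2 i)) y ≤ 0 := by
    rintro y ⟨z, hz, s, hs, h0, h1⟩
    have s1 := support_flip_pred hR hu i hz
    have s2 := support_flip hR hu i hz
    rw [h0, h1] at s1 s2
    constructor
    · have : 0 ≤ (R.germ u (R.V i 0) (R.u1 i) 0 : ℝ) * y 1 -
          R.germ u (R.V i 0) (R.u1 i) 1 * y 0 := by
        rw [germ_zero]
        by_contra! h; nlinarith
      rw [detZ]; exact_mod_cast this
    · have : (R.germ u (R.V i 0) (R.u2 i) 0 : ℝ) * y 1 -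
          R.germ u (R.V i 0) (R.u2 i) 1 * y 0 ≤ 0 := by
        rw [germ_zero, u2]
        by_contra! h; nlinarith
      rw [detZ]; exact_mod_cast this
  have pt : ∀ s r : ℝ, 0 ≤ s → 0 ≤ r → s + r < lam → ∃ z ∈ R.carrier,
      z 0 = R.V i 0 + (s * v 0 + r * w 0) ∧
      R.flip u z 1 = R.flip u (R.V i) 1 + (s * v 1 + r * w 1) := by
    intro s r hs hr hsr
    let z : Pt := ![R.V i 0 + (s * v 0 + r * w 0), R.flip u (R.V i) 1 + (s * v 1 + r * w 1) -
      R.phi u (R.V i 0 + (s * v 0 + r * w 0))]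
    have hz0 : z 0 = R.V i 0 + (s * v 0 + r * w 0) := rfl
    have hz1 : R.flip u z 1 = R.flip u (R.V i) 1 + (s * v 1 + r * w 1) := by
      rw [flip_self_sub, hz0]
      exact sub_add_cancel _ _
    exact ⟨z, hsub ⟨s, r, hs, hr, hsr, hz0, hz1⟩, hz0, hz1⟩
  obtain ⟨z, hz, hz0, hz1⟩ := pt (lam / 2) 0 (by linarith) le_rfl (by linarith)
  obtain ⟨z', hz', hz0', hz1'⟩ := pt 0 (lam / 2) le_rfl (by linarith) (by linarith)
  obtain ⟨v1, v2⟩ := sup v ⟨z, hz, lam / 2, by linarith, by rw [hz0]; ring, by rw [hz1]; ring⟩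
  obtain ⟨w1, w2⟩ := sup w ⟨z', hz', lam / 2, by linarith, by rw [hz0']; ring, by rw [hz1']; ring⟩
  obtain ⟨f1, f2⟩ := edge false
  obtain ⟨t1, t2⟩ := edge true
  have pf := fun k => germ_primitive (k := k) hR false i u (R.V i 0)
  have ptr := fun k => germ_primitive (k := k) hR true i u (R.V i 0)
  simp only [dirAt, cond_false, cond_true] at f1 f2 t1 t2 pf ptr
  set e := R.germ u (R.V i 0) (R.u1 i)
  set f := R.germ u (R.V i 0) (R.u2 i)
  have c1 : detZ v e = 0 := by
    have : detZ v e = -detZ e v := by simp [detZ]; ring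
    omega
  have c2 : detZ f w = 0 := by omega
  have x0 : e 0 = detZ e w * v 0 := by
    simp only [detZ] at *; linear_combination (-e 0) * hdet + w 0 * c1
  have x1 : e 1 = detZ e w * v 1 := by
    simp only [detZ] at *; linear_combination (-e 1) * hdet + w 1 * c1
  have y0 : f 0 = detZ v f * w 0 := by
    simp only [detZ] at *; linear_combination (-f 0) * hdet + v 0 * c2
  have y1 : f 1 = detZ v f * w 1 := by
    simp only [detZ] at *; linear_combination (-f 1) * hdet + v 1 * c2
  have z1 := Int.eq_one_of_dvd_one f1 (pf _ ⟨_, x0⟩ ⟨_, x1⟩)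
  have z2 := Int.eq_one_of_dvd_one t2 (ptr _ ⟨_, y0⟩ ⟨_, y1⟩)
  rw [z1, one_mul] at x0 x1
  rw [z2, one_mul] at y0 y1
  constructor
  · ext c; fin_cases c
    · exact x0.symm
    · exact x1.symm
  · ext c; fin_cases c
    · exact y0.symm
    · exact y1.symm

/-- A packed triangle is the standard triangle in some flipped polygon. -/
theorem exists_flip_of_packed (hR : R.IsValid) {i : Fin d} {lam : ℝ} {B : Set Pt}
    (h : IsSTPackedTriangle R (R.V i) lam B) :
    0 < lam ∧ B ⊆ R.carrier ∧ (∀ j, R.c j ∉ B) ∧ ∃ u, R.IsFlip u ∧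
      detZ (R.germ u (R.V i 0) (R.u1 i)) (R.germ u (R.V i 0) (R.u2 i)) = 1 ∧
      B = R.triangle u (R.V i) (R.germ u (R.V i 0) (R.u1 i)) (R.germ u (R.V i 0) (R.u2 i)) lam := by
  obtain ⟨hl, hB, hc, u, hu, v, w, hdet, rfl, hloc⟩ := exists_triangle_of_packed h
  obtain ⟨rfl, rfl⟩ := triangle_sides hR hu hl hdet hB hloc
  exact ⟨hl, hB, hc, u, hu, hdet, rfl⟩

section corners

variable {D : ℕ} [NeZero D] {g : Fin D → Fin d}

theorem hasSegment_of_triangle {u : Fin m → ℤ} {i : Fin d} {lam : ℝ} (b : Bool)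
    (hB : R.triangle u (R.V i) (R.germ u (R.V i 0) (R.u1 i)) (R.germ u (R.V i 0) (R.u2 i)) lam
      ⊆ R.carrier) :
    HasSegment R u (R.V i) (R.germ u (R.V i 0) (R.dirAt b i)) lam := by
  intro s h0 h1
  set v := R.germ u (R.V i 0) (R.dirAt b i) with hv
  let z : Pt := ![R.V i 0 + s * v 0, R.flip u (R.V i) 1 + s * v 1 - R.phi u (R.V i 0 + s * v 0)]
  have hz0 : z 0 = R.V i 0 + s * v 0 := rfl
  have hz1 : R.flip u z 1 = R.flip u (R.V i) 1 + s * v 1 := by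
    rw [flip_self_sub, hz0]
    exact sub_add_cancel _ _
  refine ⟨z, hB ?_, hz0, hz1⟩
  cases b
  · exact ⟨s, 0, h0, le_rfl, by linarith, by rw [hz0]; simp [hv, dirAt],
      by rw [hz1]; simp [hv, dirAt]⟩
  · exact ⟨0, s, le_rfl, h0, by linarith, by rw [hz0]; simp [hv, dirAt],
      by rw [hz1]; simp [hv, dirAt]⟩

theorem le_armLen_of_packed (hR : R.IsValid) (hg : IsCornerEnum R g) (b : Bool) {a : Fin D}
    {lam : ℝ} {B : Set Pt} (h : IsSTPackedTriangle R (R.V (g a)) lam B) :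
    lam ≤ R.armLen b (g a) (armNum g b a) := by
  obtain ⟨-, hB, -, u, hu, -, rfl⟩ := exists_flip_of_packed hR h
  exact le_armLen_of_hasSegment hR hg hu (hasSegment_of_triangle b hB)

theorem ArmPt.mem_packed (hR : R.IsValid) (hg : IsCornerEnum R g) {b : Bool} {a : Fin D}
    {lam : ℝ} {B : Set Pt} (h : IsSTPackedTriangle R (R.V (g a)) lam B) {q : Pt} {t : ℝ}
    (hq : ArmPt R g b a q t) (ht : t < lam) : q ∈ B := by
  obtain ⟨-, hB, -, u, hu, -, rfl⟩ := exists_flip_of_packed hR h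
  have h1 := hq.flip_of_hasSegment hR hg hu (hasSegment_of_triangle b hB) ht
  have h0 := hq.zero hR hg
  have hn := hq.nonneg hR
  cases b
  · exact ⟨t, 0, hn, le_rfl, by linarith, by rw [h0]; simp [dirAt, germ_zero],
      by rw [h1]; simp [dirAt]⟩
  · exact ⟨0, t, le_rfl, hn, by linarith, by rw [h0]; simp [dirAt, germ_zero],
      by rw [h1]; simp [dirAt]⟩

/-- Coordinates of a point of the polygon in the frame of a corner. -/
theorem exists_coords (hR : R.IsValid) {u : Fin m → ℤ} (hu : R.IsFlip u) {i : Fin d}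
    (hdet : detZ (R.germ u (R.V i 0) (R.u1 i)) (R.germ u (R.V i 0) (R.u2 i)) = 1)
    {z : Pt} (hz : z ∈ R.carrier) : ∃ s r : ℝ, 0 ≤ s ∧ 0 ≤ r ∧
      z 0 = R.V i 0 + (s * R.germ u (R.V i 0) (R.u1 i) 0 + r * R.germ u (R.V i 0) (R.u2 i) 0) ∧
      R.flip u z 1 = R.flip u (R.V i) 1 +
        (s * R.germ u (R.V i 0) (R.u1 i) 1 + r * R.germ u (R.V i 0) (R.u2 i) 1) := by
  have s1 := support_flip_pred hR hu i hz
  have s2 := support_flip hR hu i hz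
  change 0 ≤ (R.germ u (R.V i 0) (R.u1 i) 0 : ℝ) * _ - _ at s1
  change (R.germ u (R.V i 0) (R.u2 i) 0 : ℝ) * _ - (R.germ u (R.V i 0) (R.u2 i) 1 : ℝ) * _ ≤ 0 at s2
  set e := R.germ u (R.V i 0) (R.u1 i)
  set f := R.germ u (R.V i 0) (R.u2 i)
  have hdet' : (e 0 : ℝ) * f 1 - e 1 * f 0 = 1 := by
    have : ((detZ e f : ℤ) : ℝ) = 1 := by rw [hdet]; simp
    simpa [detZ] using this
  refine ⟨(z 0 - R.V i 0) * f 1 - (R.flip u z 1 - R.flip u (R.V i) 1) * f 0,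
    e 0 * (R.flip u z 1 - R.flip u (R.V i) 1) - e 1 * (z 0 - R.V i 0), by linarith, s1, ?_, ?_⟩
  · linear_combination -(z 0 - R.V i 0) * hdet'
  · linear_combination -(R.flip u z 1 - R.flip u (R.V i) 1) * hdet'

theorem alphaBound_of_packed (hR : R.IsValid) (hg : IsCornerEnum R g) {a : Fin D}
    {lam : ℝ} {B : Set Pt} (h : IsSTPackedTriangle R (R.V (g a)) lam B) :
    AlphaBound R g a lam := by
  intro j q t hq hqc _
  obtain ⟨b, hq⟩ := (onEmanating_iff hR).1 hq
  obtain ⟨-, hB, hc, u, hu, hdet, rfl⟩ := exists_flip_of_packed hR h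
  by_contra! hlt
  have hκ : 0 ≤ |q 1 - R.c j 1| * |((R.dir (g a) 0 + R.dir (g a - 1) 0 : ℤ) : ℝ)| := by positivity
  have h1 := hq.flip_of_hasSegment hR hg hu (hasSegment_of_triangle b hB) (by linarith)
  have h0 := hq.zero hR hg
  obtain ⟨s, r, hs, hr, k0, k1⟩ :=
    exists_coords hR hu hdet (interior_subset (hR.marked_interior j))
  refine hc j ⟨s, r, hs, hr, lt_of_le_of_lt ?_ hlt, k0, k1⟩
  have hf : R.flip u (R.c j) 1 - R.flip u q 1 = R.c j 1 - q 1 := by simp [hqc]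
  rw [← hqc, h0] at k0
  have e0 : R.germ u (R.V (g a) 0) (R.u1 (g a)) 0 = -R.dir (g a - 1) 0 := rfl
  have f0 : R.germ u (R.V (g a) 0) (R.u2 (g a)) 0 = R.dir (g a) 0 := rfl
  have hdet' : ((R.germ u (R.V (g a) 0) (R.u1 (g a)) 0 : ℤ) : ℝ) *
      R.germ u (R.V (g a) 0) (R.u2 (g a)) 1 - R.germ u (R.V (g a) 0) (R.u1 (g a)) 1 *
      (R.germ u (R.V (g a) 0) (R.u2 (g a)) 0 : ℤ) = 1 := by
    have : ((detZ (R.germ u (R.V (g a) 0) (R.u1 (g a))) (R.germ u (R.V (g a) 0) (R.u2 (g a))) : ℤ)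
      : ℝ) = 1 := by rw [hdet]; simp
    simpa [detZ] using this
  have key : s + r = t + (q 1 - R.c j 1) * ((R.dir (g a) 0 + R.dir (g a - 1) 0 : ℤ) : ℝ) := by
    rw [e0, f0] at hdet' k0
    cases b
    · have e0' : R.dirAt false (g a) 0 = -R.dir (g a - 1) 0 := rfl
      rw [e0'] at k0
      simp only [dirAt, cond_false] at h1
      set E := R.germ u (R.V (g a) 0) (R.u1 (g a)) 1
      set F := R.germ u (R.V (g a) 0) (R.u2 (g a)) 1
      push_cast at *
      set x := (R.dir (g a) 0 : ℝ)
      set y := (R.dir (g a - 1) 0 : ℝ)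
      have k1' : (R.c j 1 - q 1) + t * E = s * E + r * F := by linarith
      have k0' : -(t * y) = -(s * y) + r * x := by linarith
      linear_combination (t - s - r) * hdet' - (F - E) * k0' + (x + y) * k1'
    · have e0' : R.dirAt true (g a) 0 = R.dir (g a) 0 := rfl
      rw [e0'] at k0
      simp only [dirAt, cond_true] at h1
      set E := R.germ u (R.V (g a) 0) (R.u1 (g a)) 1
      set F := R.germ u (R.V (g a) 0) (R.u2 (g a)) 1
      push_cast at *
      set x := (R.dir (g a) 0 : ℝ)
      set y := (R.dir (g a - 1) 0 : ℝ)
      have k1' : (R.c j 1 - q 1) + t * F = s * E + r * F := by linarith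
      have k0' : t * x = -(s * y) + r * x := by linarith
      linear_combination (t - s - r) * hdet' - (F - E) * k0' + (x + y) * k1'
  rw [key, ← abs_mul]
  linarith [le_abs_self ((q 1 - R.c j 1) * ((R.dir (g a) 0 + R.dir (g a - 1) 0 : ℤ) : ℝ))]

theorem alphaBound_zero (hR : R.IsValid) (a : Fin D) : AlphaBound R g a 0 := by
  intro j q t hq _ _
  obtain ⟨b, hq⟩ := (onEmanating_iff hR).1 hq
  have := hq.nonneg hR
  positivity

end corners

theorem isTip_of_forall_le (hR : R.IsValid) {i : Fin d} (h : ∀ k, R.V i 0 ≤ R.V k 0) :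
    R.dir (i - 1) 0 ≤ 0 ∧ 0 ≤ R.dir i 0 := by
  have h1 := h (i - 1)
  have h2 := h (i + 1)
  rw [V_eq_pred hR i 0] at h1
  rw [V_succ hR i 0] at h2
  have l1 := hR.len_pos (i - 1)
  have l2 := hR.len_pos i
  constructor
  · have : (R.dir (i - 1) 0 : ℝ) ≤ 0 := by by_contra! h; nlinarith
    exact_mod_cast this
  · have : (0 : ℝ) ≤ R.dir i 0 := by by_contra! h; nlinarith
    exact_mod_cast this

theorem isTip_of_forall_ge (hR : R.IsValid) {i : Fin d} (h : ∀ k, R.V k 0 ≤ R.V i 0) :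
    0 ≤ R.dir (i - 1) 0 ∧ R.dir i 0 ≤ 0 := by
  have h1 := h (i - 1)
  have h2 := h (i + 1)
  rw [V_eq_pred hR i 0] at h1
  rw [V_succ hR i 0] at h2
  have l1 := hR.len_pos (i - 1)
  have l2 := hR.len_pos i
  constructor
  · have : (0 : ℝ) ≤ R.dir (i - 1) 0 := by by_contra! h; nlinarith
    exact_mod_cast this
  · have : (R.dir i 0 : ℝ) ≤ 0 := by by_contra! h; nlinarith
    exact_mod_cast this

section corners

variable {D : ℕ} [NeZero D] {g : Fin D → Fin d}

theorem exists_corner_of_isTip (hR : R.IsValid) (hg : IsCornerEnum R g) {i : Fin d}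
    (hi : R.IsTip i) : ∃ a, g a = i := (hg.2 i).1 (hi.isHD hR)

theorem exists_corner_lt (hR : R.IsValid) (hg : IsCornerEnum R g) :
    ∃ a b, R.V (g a) 0 < R.V (g b) 0 := by
  obtain ⟨p, hp⟩ := Finite.exists_min fun i => R.V i 0
  obtain ⟨q, hq⟩ := Finite.exists_max fun i => R.V i 0
  obtain ⟨a, rfl⟩ := exists_corner_of_isTip hR hg (Or.inr (isTip_of_forall_le hR hp))
  obtain ⟨b, rfl⟩ := exists_corner_of_isTip hR hg (Or.inl (isTip_of_forall_ge hR hq))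
  obtain ⟨i, hi⟩ := exists_dir_pos hR
  refine ⟨a, b, (hp i).trans_lt (lt_of_lt_of_le ?_ (hq (i + 1)))⟩
  rw [V_succ hR i 0]
  have := mul_pos (hR.len_pos i) (dir_zero_pos_cast hi)
  linarith

theorem succ_ne_self (hR : R.IsValid) (hg : IsCornerEnum R g) (a : Fin D) : a + 1 ≠ a := by
  intro h
  obtain ⟨p, q, hpq⟩ := exists_corner_lt hR hg
  have h1 : ∀ b : Fin D, b = a := cyc_induction a rfl fun b hb => by rw [hb, h]
  rw [h1 p, h1 q] at hpq
  exact lt_irrefl _ hpq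

theorem stEdgeLen_nonneg (hR : R.IsValid) (a : Fin D) : 0 ≤ stEdgeLen R g a := by
  rw [stEdgeLen_eq_true]
  exact armLen_nonneg hR _ _ _

theorem add_le_of_packed (hR : R.IsValid) (hg : IsCornerEnum R g) {a : Fin D} {la lb : ℝ}
    {A B : Set Pt} (hA : IsSTPackedTriangle R (R.V (g a)) la A)
    (hB : IsSTPackedTriangle R (R.V (g (a + 1))) lb B) (hAB : Disjoint A B) :
    la + lb ≤ stEdgeLen R g a := by
  have h1 := le_armLen_of_packed hR hg true hA
  have h2 := le_armLen_of_packed hR hg false hB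
  have pA := hA.1
  have pB := hB.1
  rw [← stEdgeLen_eq_true] at h1
  rw [← stEdgeLen_eq_false] at h2
  by_contra! hlt
  obtain ⟨q, hq⟩ : ∃ q, ArmPt R g true a q ((stEdgeLen R g a - lb + la) / 2) :=
    ArmPt.exists (by linarith) (by rw [← stEdgeLen_eq_true]; linarith)
  exact Set.disjoint_left.1 hAB (hq.mem_packed hR hg hA (by linarith))
    ((hq.reverse hR).mem_packed hR hg hB (by linarith))

theorem mem_stPolytope_of_packing (hR : R.IsValid) (hg : IsCornerEnum R g) {sz : Fin D → ℝ}
    {P : Set Pt} (h : IsSTPacking R g sz P) : sz ∈ STPolytope R g := by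
  obtain ⟨tri, -, htri, hdis⟩ := h
  intro a
  refine ⟨?_, ?_, ?_⟩
  · rcases htri a with h | h
    · exact h.1.ge
    · exact h.1.le
  · rcases htri a with h | h <;> rcases htri (a + 1) with h' | h'
    · rw [h.1, h'.1, add_zero]
      exact stEdgeLen_nonneg hR a
    · rw [h.1, zero_add, stEdgeLen_eq_false]
      exact le_armLen_of_packed hR hg false h'
    · rw [h'.1, add_zero, stEdgeLen_eq_true]
      exact le_armLen_of_packed hR hg true h
    · exact add_le_of_packed hR hg h h' (hdis (succ_ne_self hR hg a).symm)
  · rcases htri a with h | h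
    · rw [h.1]; exact alphaBound_zero hR a
    · exact alphaBound_of_packed hR hg h

theorem dir_pred_succ (hR : R.IsValid) (hg : IsCornerEnum R g) (a : Fin D) :
    R.dir (g (a + 1) - 1) 0 = R.dir (g a) 0 := by
  have hn := armNum_pos (g := g) true a
  have h := dirAt_arm_zero hR hg true a (k := armNum g true a - 1) (by omega)
  have e := next_armNum (g := g) true a
  rw [show armNum g true a = (armNum g true a - 1) + 1 by omega, Function.iterate_succ_apply'] at e
  change _ = g (a + 1) at e
  rw [← e]
  change R.dir ((next true)^[armNum g true a - 1] (g a) + 1 - 1) 0 = _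
  rw [add_sub_cancel_right]
  exact h

end corners

theorem dir_sum_cases (hR : R.IsValid) {i : Fin d} (h : 0 ≤ R.dir (i - 1) 0 + R.dir i 0) :
    0 < R.dir (i - 1) 0 ∨ 0 < R.dir i 0 := by
  by_contra! hc
  have e1 : R.dir (i - 1) 0 = 0 := by omega
  have e2 : R.dir i 0 = 0 := by omega
  have := turn_pred hR i
  rw [e1, e2] at this
  simp at this

theorem V_top (hR : R.IsValid) {i : Fin d} (h : 0 ≤ R.dir (i - 1) 0 + R.dir i 0) :
    R.topF (R.V i 0) = R.V i 1 := by
  rcases dir_sum_cases hR h with h | h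
  · exact topF_V_succ hR h
  · exact topF_V hR h

theorem exists_flip_combo (hR : R.IsValid) {u : Fin m → ℤ} (hu : R.IsFlip u) {z w : Pt}
    (hz : z ∈ R.carrier) (hw : w ∈ R.carrier) {s r : ℝ} (hs : 0 ≤ s) (hr : 0 ≤ r)
    (hsr : s + r = 1) : ∃ y ∈ R.carrier, y 0 = s * z 0 + r * w 0 ∧
      R.flip u y 1 = s * R.flip u z 1 + r * R.flip u w 1 := by
  obtain ⟨z0, zb, zt⟩ := (mem_carrier_iff hR).1 hz
  obtain ⟨w0, wb, wt⟩ := (mem_carrier_iff hR).1 hw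
  have ht := (concaveOn_top hR hu).2 z0 w0 hs hr hsr
  have hb := (convexOn_bot hR hu).2 z0 w0 hs hr hsr
  have hx := (concaveOn_top hR hu).1 z0 w0 hs hr hsr
  simp only [smul_eq_mul] at ht hb hx
  set x := s * z 0 + r * w 0 with hxdef
  have e : ∀ v : ℝ, (![x, v] : Pt) 1 = v := fun _ => rfl
  refine ⟨![x, s * R.flip u z 1 + r * R.flip u w 1 - R.phi u x], (mem_carrier_iff hR).2
    ⟨hx, ?_, ?_⟩, rfl, sub_add_cancel _ _⟩
  · change R.botF x ≤ s * (z 1 + R.phi u (z 0)) + r * (w 1 + R.phi u (w 0)) - R.phi u x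
    have := mul_le_mul_of_nonneg_left zb hs
    have := mul_le_mul_of_nonneg_left wb hr
    linarith
  · change s * (z 1 + R.phi u (z 0)) + r * (w 1 + R.phi u (w 0)) - R.phi u x ≤ R.topF x
    have := mul_le_mul_of_nonneg_left zt hs
    have := mul_le_mul_of_nonneg_left wt hr
    linarith

/-- The flipped polygon contains a triangle once it contains the endpoints of its sides. -/
theorem triangle_subset (hR : R.IsValid) {u : Fin m → ℤ} (hu : R.IsFlip u) {p : Pt}
    (hp : p ∈ R.carrier) {v w : Fin 2 → ℤ} {lam : ℝ} (hl : 0 < lam)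
    (hv : ∃ q ∈ R.carrier, q 0 = p 0 + lam * v 0 ∧ R.flip u q 1 = R.flip u p 1 + lam * v 1)
    (hw : ∃ q ∈ R.carrier, q 0 = p 0 + lam * w 0 ∧ R.flip u q 1 = R.flip u p 1 + lam * w 1) :
    R.triangle u p v w lam ⊆ R.carrier := by
  rintro z ⟨s, r, hs, hr, hsr, h0, h1⟩
  obtain ⟨q, hq, q0, q1⟩ := hv
  obtain ⟨q', hq', q0', q1'⟩ := hw
  have hinj : ∀ y : Pt, y 0 = z 0 → R.flip u y 1 = R.flip u z 1 → y = z := by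
    intro y h0 h1
    rw [flip_one, flip_one, h0] at h1
    ext k
    fin_cases k
    · exact h0
    · exact add_right_cancel h1
  rcases (add_nonneg hs hr).eq_or_lt with h | h
  · have s0 : s = 0 := by linarith
    have r0 : r = 0 := by linarith
    subst s0 r0
    rwa [← hinj p (by rw [h0]; ring) (by rw [h1]; ring)]
  · obtain ⟨y, hy, y0, y1⟩ := exists_flip_combo hR hu hq hq' (s := s / (s + r)) (r := r / (s + r))
      (by positivity) (by positivity) (by field_simp)
    obtain ⟨y', hy', y0', y1'⟩ := exists_flip_combo hR hu hp hy (s := 1 - (s + r) / lam)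
      (r := (s + r) / lam) (by rw [sub_nonneg, div_le_one hl]; exact hsr.le) (by positivity)
      (by ring)
    rwa [← hinj y' _ _]
    · rw [y0', y0, q0, q0', h0]; field_simp; ring
    · rw [y1', y1, q1, q1', h1]; field_simp; ring

section corners

variable {D : ℕ} [NeZero D] {g : Fin D → Fin d}

theorem sg_dirAt_add (b : Bool) (i : Fin d) :
    sg b * ((R.dirAt b i 0 : ℝ) - R.dirAt (!b) i 0) = ((R.dir (i - 1) 0 + R.dir i 0 : ℤ) : ℝ) := by
  cases b <;> simp [sg, dirAt, u1, u2] <;> ring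

/-- Marked points lie outside the standard triangle: the part on the side of one arm. -/
theorem le_coords_aux (hR : R.IsValid) (hg : IsCornerEnum R g) {a : Fin D}
    (hsum : 0 ≤ R.dir (g a - 1) 0 + R.dir (g a) 0) {lam : ℝ} (hα : AlphaBound R g a lam)
    (b : Bool) (hl : lam ≤ R.armLen b (g a) (armNum g b a)) {j : Fin m} {α β : ℝ}
    (hα0 : 0 ≤ α) (hβ0 : 0 ≤ β)
    (h0 : R.c j 0 = R.V (g a) 0 + (α * R.dirAt b (g a) 0 + β * R.dirAt (!b) (g a) 0))
    (h1 : R.flip R.flipTop (R.c j) 1 = R.flip R.flipTop (R.V (g a)) 1 +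
      (α * R.germ R.flipTop (R.V (g a) 0) (R.dirAt b (g a)) 1 +
        β * R.germ R.flipTop (R.V (g a) 0) (R.dirAt (!b) (g a)) 1))
    (hd : 0 < sg b * (R.c j 0 - R.V (g a) 0) ∨ R.c j 0 = R.V (g a) 0) : lam ≤ α + β := by
  have hdet : sg b * ((R.dirAt (!b) (g a) 0 : ℝ) *
      R.germ R.flipTop (R.V (g a) 0) (R.dirAt b (g a)) 1 -
      R.germ R.flipTop (R.V (g a) 0) (R.dirAt (!b) (g a)) 1 * R.dirAt b (g a) 0) = 1 := by
    have e1 := sg_mul_detZ (R := R) b (g a) R.flipTop (R.V (g a) 0)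
    rw [(isHD hg a).detZ_germ_flipTop hR hsum] at e1
    simpa [detZ, germ_zero] using e1
  have hκ := sg_dirAt_add (R := R) b (g a)
  have hκ0 : (0 : ℝ) ≤ ((R.dir (g a - 1) 0 + R.dir (g a) 0 : ℤ) : ℝ) := by exact_mod_cast hsum
  have hs := sg_mul_self b
  have hsum' : ((R.dir (g a) 0 + R.dir (g a - 1) 0 : ℤ) : ℝ) =
      ((R.dir (g a - 1) 0 + R.dir (g a) 0 : ℤ) : ℝ) := by rw [add_comm]
  -- the bound at a boundary point above the marked point
  have main : ∀ q t, ArmPt R g b a q t → q 0 = R.c j 0 → q 1 = R.topF (q 0) →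
      R.flip R.flipTop q 1 = R.flip R.flipTop (R.V (g a)) 1 +
        t * R.germ R.flipTop (R.V (g a) 0) (R.dirAt b (g a)) 1 →
      (∀ q' t', OnEmanating R g a q' t' → q' 0 = R.c j 0 → t ≤ t') → lam ≤ α + β := by
    intro q t hq hq0 hq1 hqf hmin
    have hb := hα j q t ((onEmanating_iff hR).2 ⟨b, hq⟩) hq0 hmin
    have hc : R.c j 1 < q 1 := by rw [hq1, hq0]; exact c_lt_topF hR j
    rw [hsum', abs_of_nonneg hκ0, abs_of_pos (by linarith)] at hb
    have hq00 := hq.zero hR hg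
    rw [hq0, h0] at hq00
    have hf : R.flip R.flipTop (R.c j) 1 - R.flip R.flipTop q 1 = R.c j 1 - q 1 := by simp [hq0]
    rw [h1, hqf] at hf
    rw [← hκ] at hb
    refine hb.trans (le_of_eq ?_)
    set v0 := (R.dirAt b (g a) 0 : ℝ)
    set w0 := (R.dirAt (!b) (g a) 0 : ℝ)
    set v1 := (R.germ R.flipTop (R.V (g a) 0) (R.dirAt b (g a)) 1 : ℝ)
    set w1 := (R.germ R.flipTop (R.V (g a) 0) (R.dirAt (!b) (g a)) 1 : ℝ)
    have k0 : (α - t) * v0 + β * w0 = 0 := by linarith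
    have k1 : (α - t) * v1 + β * w1 = R.c j 1 - q 1 := by linarith
    have : q 1 - R.c j 1 = -((α - t) * v1 + β * w1) := by linarith
    rw [this]
    linear_combination (α - t + β) * hdet + sg b * (-v1 + w1) * k0
  have key : 0 < sg b * (R.c j 0 - R.V (g a) 0) → 0 < sg b * R.dirAt b (g a) 0 ∧
      sg b * (R.c j 0 - R.V (g a) 0) ≤ (α + β) * (sg b * R.dirAt b (g a) 0) := by
    intro hd
    have e : sg b * (R.c j 0 - R.V (g a) 0) =
        (α + β) * (sg b * R.dirAt b (g a) 0) -
          β * ((R.dir (g a - 1) 0 + R.dir (g a) 0 : ℤ) : ℝ) := by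
      rw [← hκ, h0]; ring
    have := mul_nonneg hβ0 hκ0
    refine ⟨?_, by linarith⟩
    by_contra! hn
    nlinarith [mul_nonneg (add_nonneg hα0 hβ0) (neg_nonneg.2 hn)]
  rcases hd with hd | hd
  · obtain ⟨hpos, hle⟩ := key hd
    set t := sg b * (R.c j 0 - R.V (g a) 0) / (sg b * R.dirAt b (g a) 0) with ht
    have ht0 : 0 < t := div_pos hd hpos
    have htle : t ≤ α + β := by rwa [ht, div_le_iff₀ hpos]
    have htm : t * (sg b * R.dirAt b (g a) 0) = sg b * (R.c j 0 - R.V (g a) 0) := by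
      exact div_mul_cancel₀ _ hpos.ne'
    rcases le_total t (R.armLen b (g a) (armNum g b a)) with h | h
    · obtain ⟨q, hq⟩ := ArmPt.exists ht0.le h
      refine main q t hq ?_ (hq.top hR hg hpos) (hq.flip_flipTop hR hg hpos) ?_
      · rw [hq.zero hR hg]
        linear_combination sg b * htm - (t * R.dirAt b (g a) 0 - R.c j 0 + R.V (g a) 0) * hs
      · intro q' t' hq' hq0'
        obtain ⟨b', hq'⟩ := (onEmanating_iff hR).1 hq'
        have hz := hq'.zero hR hg
        have hn := hq'.nonneg hR
        rw [hq0'] at hz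
        rw [ht, div_le_iff₀ hpos]
        rcases Bool.eq_or_eq_not b' b with rfl | rfl
        · rw [hz]; linarith
        · rw [hz]
          have : sg b * (R.dirAt (!b) (g a) 0 : ℝ) ≤ sg b * R.dirAt b (g a) 0 := by linarith
          nlinarith
    · linarith
  · have hz := armPt_zero (g := g) hR b a
    refine main _ 0 hz hd.symm (V_top hR hsum).symm (by simp) ?_
    intro q' t' hq' _
    obtain ⟨b', hq'⟩ := (onEmanating_iff hR).1 hq'
    exact hq'.nonneg hR

theorem le_coords (hR : R.IsValid) (hg : IsCornerEnum R g) {a : Fin D}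
    (hsum : 0 ≤ R.dir (g a - 1) 0 + R.dir (g a) 0) {lam : ℝ} (hα : AlphaBound R g a lam)
    (hl : ∀ b, lam ≤ R.armLen b (g a) (armNum g b a)) {j : Fin m} (b : Bool) {α β : ℝ}
    (hα0 : 0 ≤ α) (hβ0 : 0 ≤ β)
    (h0 : R.c j 0 = R.V (g a) 0 + (α * R.dirAt b (g a) 0 + β * R.dirAt (!b) (g a) 0))
    (h1 : R.flip R.flipTop (R.c j) 1 = R.flip R.flipTop (R.V (g a)) 1 +
      (α * R.germ R.flipTop (R.V (g a) 0) (R.dirAt b (g a)) 1 +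
        β * R.germ R.flipTop (R.V (g a) 0) (R.dirAt (!b) (g a)) 1)) : lam ≤ α + β := by
  have hsg : sg (!b) = -sg b := by cases b <;> simp [sg]
  have hs := sg_mul_self b
  by_cases hd : 0 < sg b * (R.c j 0 - R.V (g a) 0) ∨ R.c j 0 = R.V (g a) 0
  · exact le_coords_aux hR hg hsum hα b (hl b) hα0 hβ0 h0 h1 hd
  · push Not at hd
    rw [add_comm]
    refine le_coords_aux hR hg hsum hα (!b) (hl (!b)) (j := j) hβ0 hα0 ?_ ?_ (Or.inl ?_)
    · rw [h0, Bool.not_not]; ring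
    · rw [h1, Bool.not_not]; ring
    · rw [hsg]
      have h2 : sg b * (R.c j 0 - R.V (g a) 0) ≠ 0 := by
        intro h
        refine hd.2 (sub_eq_zero.1 ?_)
        calc R.c j 0 - R.V (g a) 0 = sg b * (sg b * (R.c j 0 - R.V (g a) 0)) := by
              rw [← mul_assoc, hs, one_mul]
          _ = 0 := by rw [h, mul_zero]
      have := lt_of_le_of_ne hd.1 h2
      linarith

/-- Coordinates of a marked point in the frame of a corner of the upper boundary. -/
theorem exists_coords_c (hR : R.IsValid) (hg : IsCornerEnum R g) {a : Fin D}
    (hsum : 0 ≤ R.dir (g a - 1) 0 + R.dir (g a) 0) (b : Bool) (j : Fin m) :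
    ∃ α β : ℝ, 0 ≤ α ∧ 0 ≤ β ∧
      R.c j 0 = R.V (g a) 0 + (α * R.dirAt b (g a) 0 + β * R.dirAt (!b) (g a) 0) ∧
      R.flip R.flipTop (R.c j) 1 = R.flip R.flipTop (R.V (g a)) 1 +
      (α * R.germ R.flipTop (R.V (g a) 0) (R.dirAt b (g a)) 1 +
        β * R.germ R.flipTop (R.V (g a) 0) (R.dirAt (!b) (g a)) 1) := by
  obtain ⟨s, r, hs, hr, h0, h1⟩ := exists_coords hR R.isFlip_flipTop
    ((isHD hg a).detZ_germ_flipTop hR hsum) (interior_subset (hR.marked_interior j))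
  rw [germ_zero, germ_zero] at h0
  cases b
  · exact ⟨s, r, hs, hr, h0, h1⟩
  · refine ⟨r, s, hr, hs, ?_, ?_⟩
    · rw [h0, add_comm (s * _)]; rfl
    · rw [h1, add_comm (s * _)]; rfl

/-- The endpoints of the sides of the standard triangle lie in the polygon. -/
theorem exists_side_end (hR : R.IsValid) (hg : IsCornerEnum R g) {a : Fin D}
    (hsum : 0 ≤ R.dir (g a - 1) 0 + R.dir (g a) 0) {lam : ℝ} (h0 : 0 ≤ lam)
    (hα : AlphaBound R g a lam)
    (hl : ∀ b, lam ≤ R.armLen b (g a) (armNum g b a)) (b : Bool) :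
    ∃ q ∈ R.carrier, ArmPt R g b a q lam ∧ q 0 = R.V (g a) 0 + lam * R.dirAt b (g a) 0 ∧
      R.flip R.flipTop q 1 = R.flip R.flipTop (R.V (g a)) 1 +
        lam * R.germ R.flipTop (R.V (g a) 0) (R.dirAt b (g a)) 1 := by
  rcases lt_or_ge 0 (sg b * (R.dirAt b (g a) 0 : ℝ)) with hpos | hneg
  · obtain ⟨q, hq⟩ := ArmPt.exists h0 (hl b)
    exact ⟨q, hq.mem hR, hq, hq.zero hR hg, hq.flip_flipTop hR hg hpos⟩
  · have hκ := sg_dirAt_add (R := R) b (g a)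
    have hκ0 : (0 : ℝ) ≤ ((R.dir (g a - 1) 0 + R.dir (g a) 0 : ℤ) : ℝ) := by exact_mod_cast hsum
    have far : ∀ j, sg b * (R.c j 0 - R.V (g a) 0) ≤ lam * (sg b * R.dirAt b (g a) 0) := by
      intro j
      obtain ⟨α, β, hα0, hβ0, k0, k1⟩ := exists_coords_c hR hg hsum b j
      have h := le_coords hR hg hsum hα hl b hα0 hβ0 k0 k1
      have e : sg b * (R.c j 0 - R.V (g a) 0) =
        (α + β) * (sg b * R.dirAt b (g a) 0) -
          β * ((R.dir (g a - 1) 0 + R.dir (g a) 0 : ℤ) : ℝ) := by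
        rw [← hκ, k0]; ring
      have := mul_nonneg hβ0 hκ0
      nlinarith
    have hlen : lam ≤ R.lenAt b (g a) := by
      by_contra! hlt
      have hne : armNum g b a ≠ 1 := by
        intro h1
        have := hl b
        rw [h1, armLen_succ, armLen_zero, zero_add] at this
        exact absurd hlt (not_lt.2 this)
      have hn := armNum_pos (g := g) b a
      have hf := fake_arm hg b a (k := 1) one_pos (by omega)
      have hz : (R.dirAt b (g a) 0 : ℝ) ≠ 0 := by
        intro h
        exact hne (armNum_eq_one hR hg (by exact_mod_cast h))
      obtain ⟨j, hj⟩ : {j | R.CutHits j (R.V ((next b)^[1] (g a)))}.Nonempty :=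
        Set.nonempty_of_ncard_ne_zero hf.1.ne'
      have hj0 := hj.2.1
      have hV := V_next hR b (g a) 0
      have hfj := far j
      rw [← hj0, Function.iterate_one, hV, add_sub_cancel_left] at hfj
      have hlt' : sg b * (R.dirAt b (g a) 0 : ℝ) < 0 := by
        refine lt_of_le_of_ne hneg fun h => ?_
        rcases mul_eq_zero.1 h with h | h
        · cases b <;> simp [sg] at h
        · exact hz h
      nlinarith
    refine ⟨fun k => R.V (g a) k + lam * R.dirAt b (g a) k,
      dirAt_mem hR b (g a) h0 hlen fun _ => rfl,
      ⟨0, armNum_pos _ _, lam, h0, hlen, fun _ => rfl, by simp [armLen_zero]⟩, rfl,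
      flip_edge _ h0 (fun _ => rfl) ?_⟩
    intro j _
    have hfj := far j
    have hs := sg_mul_self b
    have hsg := mul_nonpos_of_nonneg_of_nonpos h0 hneg
    cases b
    · simp only [sg, cond_false] at *
      constructor <;> rintro ⟨p1, p2⟩ <;> linarith
    · simp only [sg, cond_true] at *
      constructor <;> rintro ⟨p1, p2⟩ <;> linarith

/-- The standard triangle at a corner of the upper boundary. -/
def topTri (R : STRep d m) (i : Fin d) (lam : ℝ) : Set Pt :=
  R.triangle R.flipTop (R.V i) (R.germ R.flipTop (R.V i 0) (R.u1 i))
    (R.germ R.flipTop (R.V i 0) (R.u2 i)) lam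

theorem isSTPackedTriangle_topTri (hR : R.IsValid) (hg : IsCornerEnum R g) {a : Fin D}
    (hsum : 0 ≤ R.dir (g a - 1) 0 + R.dir (g a) 0) {lam : ℝ} (h0 : 0 < lam)
    (hα : AlphaBound R g a lam)
    (hl : ∀ b, lam ≤ R.armLen b (g a) (armNum g b a)) :
    IsSTPackedTriangle R (R.V (g a)) lam (R.topTri (g a) lam) := by
  have hdet := (isHD hg a).detZ_germ_flipTop hR hsum
  obtain ⟨q, hq, -, hq0, hq1⟩ := exists_side_end hR hg hsum h0.le hα hl false
  obtain ⟨q', hq', -, hq0', hq1'⟩ := exists_side_end hR hg hsum h0.le hα hl true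
  have hsub : R.topTri (g a) lam ⊆ R.carrier :=
    triangle_subset hR R.isFlip_flipTop (R.V_mem _) h0 ⟨q, hq, hq0, hq1⟩ ⟨q', hq', hq0', hq1'⟩
  refine ⟨h0, hsub, ?_, 0, 0, R.flipTop, R.isFlip_flipTop, ?_, ?_⟩
  · rintro j ⟨s, r, hs, hr, hsr, k0, k1⟩
    rw [germ_zero, germ_zero] at k0
    exact absurd hsr (not_lt.2 (le_coords hR hg hsum hα hl false hs hr k0 k1))
  · unfold topTri
    set e := R.germ R.flipTop (R.V (g a) 0) (R.u1 (g a))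
    set f := R.germ R.flipTop (R.V (g a) 0) (R.u2 (g a))
    refine ⟨⟨!![e 0, f 0; e 1, f 1], ?_⟩, ?_⟩
    · rw [Matrix.det_fin_two_of, ← hdet]
      simp [detZ]; ring
    · have m0 : ∀ hM x, sl2Apply ⟨!![e 0, f 0; e 1, f 1], hM⟩ x 0 = e 0 * x 0 + f 0 * x 1 :=
        fun hM x => sl2Apply_zero _ x
      have m1 : ∀ hM x, sl2Apply ⟨!![e 0, f 0; e 1, f 1], hM⟩ x 1 = e 1 * x 0 + f 1 * x 1 :=
        fun hM x => sl2Apply_one _ x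
      ext y
      constructor
      · rintro ⟨z, ⟨s, r, hs, hr, hsr, k0, k1⟩, rfl⟩
        refine ⟨![s, r], ⟨hs, hr, hsr⟩, ?_⟩
        ext k
        fin_cases k
        · refine (congrArg₂ (· + ·) (m0 _ _) rfl).trans ?_
          rw [stMap_eq_flip, stMap_eq_flip]
          change e 0 * s + f 0 * r + R.V (g a) 0 = z 0
          rw [k0]; ring
        · refine (congrArg₂ (· + ·) (m1 _ _) rfl).trans ?_
          rw [stMap_eq_flip, stMap_eq_flip]
          change e 1 * s + f 1 * r + (R.flip R.flipTop (R.V (g a)) 1 + ((0 : ℤ) : ℝ) *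
            R.V (g a) 0 + 0) = R.flip R.flipTop z 1 + ((0 : ℤ) : ℝ) * z 0 + 0
          rw [k1]; push_cast; ring
      · rintro ⟨x, ⟨hs, hr, hsr⟩, rfl⟩
        let z : Pt := ![R.V (g a) 0 + (x 0 * e 0 + x 1 * f 0), R.flip R.flipTop (R.V (g a)) 1 +
          (x 0 * e 1 + x 1 * f 1) - R.phi R.flipTop (R.V (g a) 0 + (x 0 * e 0 + x 1 * f 0))]
        have hz1 : R.flip R.flipTop z 1 = R.flip R.flipTop (R.V (g a)) 1 +
          (x 0 * e 1 + x 1 * f 1) := sub_add_cancel _ _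
        refine ⟨z, ⟨x 0, x 1, hs, hr, hsr, rfl, hz1⟩, ?_⟩
        ext k
        fin_cases k
        · refine Eq.trans ?_ (congrArg₂ (· + ·) (m0 _ _) rfl).symm
          rw [stMap_eq_flip, stMap_eq_flip]
          change R.V (g a) 0 + (x 0 * e 0 + x 1 * f 0) = e 0 * x 0 + f 0 * x 1 + R.V (g a) 0
          ring
        · refine Eq.trans ?_ (congrArg₂ (· + ·) (m1 _ _) rfl).symm
          rw [stMap_eq_flip, stMap_eq_flip]
          change R.flip R.flipTop z 1 + ((0 : ℤ) : ℝ) * z 0 + 0 = e 1 * x 0 + f 1 * x 1 +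
            (R.flip R.flipTop (R.V (g a)) 1 + ((0 : ℤ) : ℝ) * R.V (g a) 0 + 0)
          rw [hz1]; push_cast; ring
  · have hc := fun z hz => exists_coords hR R.isFlip_flipTop hdet (z := z) hz
    set e := R.germ R.flipTop (R.V (g a) 0) (R.u1 (g a))
    set f := R.germ R.flipTop (R.V (g a) 0) (R.u2 (g a))
    have hdet' : (e 0 : ℝ) * f 1 - e 1 * f 0 = 1 := by
      have : ((detZ e f : ℤ) : ℝ) = 1 := by rw [hdet]; simp
      simpa [detZ] using this
    set P := stMap R.c 0 0 R.flipTop (R.V (g a)) with hP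
    refine ⟨{y | (y 0 - P 0) * f 1 - (y 1 - P 1) * f 0 + (e 0 * (y 1 - P 1) - e 1 * (y 0 - P 0))
      < lam}, ?_, ?_, ?_⟩
    · exact isOpen_lt (by fun_prop) continuous_const
    · simpa using h0
    · apply Set.Subset.antisymm
      · rintro y ⟨⟨z, hz, rfl⟩, hy⟩
        exact ⟨⟨z, hsub hz, rfl⟩, hy⟩
      · rintro y ⟨⟨z, hz, rfl⟩, hy⟩
        refine ⟨⟨z, ?_, rfl⟩, hy⟩
        obtain ⟨s, r, hs, hr, k0, k1⟩ := hc z hz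
        refine ⟨s, r, hs, hr, ?_, k0, k1⟩
        have e0 : stMap R.c 0 0 R.flipTop z 0 - P 0 = s * e 0 + r * f 0 := by
          rw [hP, stMap_eq_flip, stMap_eq_flip]
          change z 0 - R.V (g a) 0 = _
          linarith
        have e1 : stMap R.c 0 0 R.flipTop z 1 - P 1 = s * e 1 + r * f 1 := by
          rw [hP, stMap_eq_flip, stMap_eq_flip]
          change R.flip R.flipTop z 1 + ((0 : ℤ) : ℝ) * z 0 + 0 -
            (R.flip R.flipTop (R.V (g a)) 1 + ((0 : ℤ) : ℝ) * R.V (g a) 0 + 0) = _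
          rw [k1]; push_cast; ring
        change _ < lam at hy
        rw [e0, e1] at hy
        refine lt_of_eq_of_lt ?_ hy
        linear_combination -(s + r) * hdet'

end corners

theorem stMap_neg (c : Fin m → Pt) (n : ℤ) (t : ℝ) (u : Fin m → ℤ) (z : Pt) :
    stMap c (n + ∑ j, u j) (-t + ∑ j, u j * (-c j) 0) (fun j => -u j) (-z) =
      -stMap (fun j => -c j) n t u z := by
  have key : ∑ j, (((-u j : ℤ) : ℤ) : ℝ) * max (-z 0 - c j 0) 0 =
      -∑ j, (u j : ℝ) * max (z 0 - (-c j) 0) 0 + (∑ j, (u j : ℝ)) * z 0 -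
        ∑ j, u j * (-c j) 0 := by
    rw [Finset.sum_mul, ← Finset.sum_neg_distrib, ← Finset.sum_add_distrib,
      ← Finset.sum_sub_distrib]
    refine Finset.sum_congr rfl fun j _ => ?_
    have h : (-c j) 0 = -c j 0 := rfl
    rw [h]
    push_cast
    rcases le_total (z 0 + c j 0) 0 with h | h
    · rw [max_eq_left (by linarith), max_eq_right (by linarith)]; ring
    · rw [max_eq_right (by linarith), max_eq_left (by linarith)]; ring
  ext k
  fin_cases k
  · rfl
  · change -z 1 + ((n + ∑ j, u j : ℤ) : ℝ) * -z 0 + (-t + ∑ j, u j * (-c j) 0) +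
      ∑ j, (((-u j : ℤ) : ℤ) : ℝ) * max (-z 0 - c j 0) 0 =
      -(z 1 + n * z 0 + t + ∑ j, (u j : ℝ) * max (z 0 - (-c j) 0) 0)
    rw [key]; push_cast; ring

theorem _root_.IsSTPackedTriangle.neg {p : Pt} {lam : ℝ} {B : Set Pt}
    (h : IsSTPackedTriangle R.neg p lam B) : IsSTPackedTriangle R (-p) lam (-B) := by
  obtain ⟨h0, hsub, hc, n, t, u, hu, ⟨M, hM⟩, U, hU, hpU, hBU⟩ := h
  have hs := stMap_neg R.c n t u
  set n' := n + ∑ j, u j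
  set t' := -t + ∑ j, u j * (-R.c j) 0
  have him : ∀ S : Set Pt, stMap R.c n' t' (fun j => -u j) '' (-S) =
      -(stMap R.neg.c n t u '' S) := by
    intro S
    ext y
    constructor
    · rintro ⟨z, hz, rfl⟩
      refine ⟨-z, hz, ?_⟩
      rw [← _root_.neg_neg (stMap R.neg.c n t u (-z))]
      have := hs (-z)
      rw [_root_.neg_neg] at this
      rw [this]; rfl
    · rintro ⟨z, hz, hy⟩
      refine ⟨-z, by simpa using hz, ?_⟩
      rw [hs, ← _root_.neg_neg y, ← hy]; rfl
  refine ⟨h0, ?_, ?_, n', t', fun j => -u j, ?_, ⟨-M, ?_⟩, -U, hU.neg, ?_, ?_⟩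
  · intro z hz
    have := mem_carrier_neg.1 (hsub hz)
    simpa using this
  · exact fun j hj => hc j hj
  · intro j
    rcases hu j with h | h
    · left; simp [h]
    · right; simp only [h]; simp [STRep.neg]
  · rw [him, hM, hs]
    ext y
    have hneg : ∀ x, sl2Apply (-M) x = -sl2Apply M x := by
      intro x
      ext k
      fin_cases k
      · rw [Fin.zero_eta, Pi.neg_apply, sl2Apply_zero, sl2Apply_zero]; simp; ring
      · rw [Fin.mk_one, Pi.neg_apply, sl2Apply_one, sl2Apply_one]; simp; ring
    constructor
    · rintro ⟨x, hx, hy⟩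
      refine ⟨x, hx, ?_⟩
      rw [← _root_.neg_neg y, ← hy, neg_add]
      exact congrArg₂ (· + ·) (hneg x) rfl
    · rintro ⟨x, hx, rfl⟩
      refine ⟨x, hx, ?_⟩
      change _ = -(sl2Apply (-M) x + _)
      rw [hneg, neg_add, _root_.neg_neg, _root_.neg_neg]; rfl
  · rw [hs, Set.mem_neg, _root_.neg_neg]; exact hpU
  · have hcar : R.carrier = -R.neg.carrier := by
      rw [carrier_neg, _root_.neg_neg]
    rw [hcar, him, him, ← Set.inter_neg, ← Set.inter_neg, hBU]

theorem lenAt_neg (b : Bool) (i : Fin d) : R.neg.lenAt b i = R.lenAt b i := by cases b <;> rfl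

theorem armLen_neg (b : Bool) (i : Fin d) (k : ℕ) : R.neg.armLen b i k = R.armLen b i k :=
  Finset.sum_congr rfl fun _ _ => lenAt_neg _ _

section corners

variable {D : ℕ} [NeZero D] {g : Fin D → Fin d}

theorem _root_.IsCornerEnum.neg (hg : IsCornerEnum R g) : IsCornerEnum R.neg g :=
  ⟨hg.1, fun i => by rw [← hg.2, IsHDCorner, IsHDCorner, isFakeCorner_neg]⟩

theorem onEmanating_neg {a : Fin D} {q : Pt} {t : ℝ} :
    OnEmanating R.neg g a q t ↔ OnEmanating R g a (-q) t := by
  have key : ∀ (i : Fin d) (s : ℝ), (∀ k, q k = R.neg.V i k + s * (R.neg.dir i k : ℝ)) ↔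
      ∀ k, (-q) k = R.V i k + s * (R.dir i k : ℝ) := by
    refine fun i s => forall_congr' fun k => ?_
    change q k = -R.V i k + s * ((-R.dir i k : ℤ) : ℝ) ↔ -q k = _
    push_cast
    constructor <;> intro h <;> linarith
  unfold OnEmanating
  simp only [key]
  rfl

theorem _root_.AlphaBound.neg {a : Fin D} {lam : ℝ} (h : AlphaBound R g a lam) :
    AlphaBound R.neg g a lam := by
  intro j q t hq hqj hmin
  have := h j (-q) t (onEmanating_neg.1 hq) ?_ ?_
  · refine this.trans (le_of_eq ?_)
    congr 1
    have e1 : |(-q) 1 - R.c j 1| = |q 1 - R.neg.c j 1| := by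
      change |-q 1 - R.c j 1| = |q 1 - -R.c j 1|
      rw [← abs_neg]; congr 1; ring
    have e2 : |((R.dir (g a) 0 + R.dir (g a - 1) 0 : ℤ) : ℝ)| =
        |((R.neg.dir (g a) 0 + R.neg.dir (g a - 1) 0 : ℤ) : ℝ)| := by
      change _ = |((-R.dir (g a) 0 + -R.dir (g a - 1) 0 : ℤ) : ℝ)|
      rw [← abs_neg]; congr 1; push_cast; ring
    rw [e1, e2]
  · change -q 0 = _
    rw [hqj]; exact _root_.neg_neg _
  · intro q' t' hq' hqj'
    refine hmin (-q') t' (onEmanating_neg.2 (by rwa [_root_.neg_neg])) ?_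
    change -q' 0 = -R.c j 0
    rw [hqj']

theorem le_armLen (hR : R.IsValid) {sz : Fin D → ℝ} (h : sz ∈ STPolytope R g) (b : Bool)
    (a : Fin D) : sz a ≤ R.armLen b (g a) (armNum g b a) := by
  cases b
  · have h1 := (h (a - 1)).2.1
    rw [sub_add_cancel, stEdgeLen_eq_false, sub_add_cancel] at h1
    linarith [(h (a - 1)).1]
  · have h1 := (h a).2.1
    rw [stEdgeLen_eq_true] at h1
    linarith [(h (a + 1)).1]

open Classical in
/-- The standard triangle at a corner. -/
def stdTri (R : STRep d m) (i : Fin d) (lam : ℝ) : Set Pt :=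
  if 0 ≤ R.dir (i - 1) 0 + R.dir i 0 then R.topTri i lam else -R.neg.topTri i lam

theorem isSTPackedTriangle_stdTri (hR : R.IsValid) (hg : IsCornerEnum R g) {sz : Fin D → ℝ}
    (h : sz ∈ STPolytope R g) {a : Fin D} (h0 : 0 < sz a) :
    IsSTPackedTriangle R (R.V (g a)) (sz a) (R.stdTri (g a) (sz a)) := by
  unfold stdTri
  split_ifs with hs
  · exact isSTPackedTriangle_topTri hR hg hs h0 (h a).2.2 fun b => le_armLen hR h b a
  · have := isSTPackedTriangle_topTri hR.neg hg.neg (a := a) (lam := sz a) ?_ h0 (h a).2.2.neg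
      fun b => ?_
    · have := this.neg
      rwa [show -R.neg.V (g a) = R.V (g a) from _root_.neg_neg _] at this
    · change 0 ≤ -R.dir (g a - 1) 0 + -R.dir (g a) 0
      omega
    · rw [armLen_neg]; exact le_armLen hR h b a

theorem stPolytope_neg {sz : Fin D → ℝ} (h : sz ∈ STPolytope R g) : sz ∈ STPolytope R.neg g :=
  fun a => ⟨(h a).1, (h a).2.1, (h a).2.2.neg⟩

end corners

theorem V_succ_eq_of_eq (hR : R.IsValid) {i k : Fin d} (h : R.V i = R.V k) :
    R.V (i + 1) = R.V (k + 1) := by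
  have ei := fun c => V_succ hR i c
  have ek := fun c => V_succ hR k c
  have li := hR.len_pos i
  have lk := hR.len_pos k
  have s1 := support hR i (R.V_mem (k + 1))
  have s2 := support hR k (R.V_mem (i + 1))
  have s3 := support_pred hR i (R.V_mem (k + 1))
  have t := turn_pred hR i
  rw [ek, ek, h] at s1 s3
  rw [ei, ei, h] at s2
  simp only [add_sub_cancel_left] at s1 s2 s3
  have hpar : (R.dir i 0 : ℝ) * R.dir k 1 = R.dir i 1 * R.dir k 0 := by
    apply le_antisymm
    · have : R.len k * ((R.dir i 0 : ℝ) * R.dir k 1 - R.dir i 1 * R.dir k 0) ≤ 0 := by linarith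
      linarith [nonpos_of_mul_nonpos_right this lk]
    · have : R.len i * ((R.dir k 0 : ℝ) * R.dir i 1 - R.dir k 1 * R.dir i 0) ≤ 0 := by linarith
      linarith [nonpos_of_mul_nonpos_right this li]
  obtain ⟨τ, hτ⟩ : ∃ τ : ℝ, ∀ c, (R.dir k c : ℝ) = τ * R.dir i c := by
    by_cases h0 : (R.dir i 0 : ℝ) = 0
    · have h1 : (R.dir i 1 : ℝ) ≠ 0 := by
        intro h1
        rw [h0, h1] at t
        simp at t
      refine ⟨R.dir k 1 / R.dir i 1, fun c => ?_⟩
      fin_cases c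
      · rw [h0, zero_mul] at hpar
        have := (mul_eq_zero.1 hpar.symm).resolve_left h1
        change (R.dir k 0 : ℝ) = _ * (R.dir i 0 : ℝ)
        rw [this, h0, mul_zero]
      · exact (div_mul_cancel₀ _ h1).symm
    · refine ⟨R.dir k 0 / R.dir i 0, fun c => ?_⟩
      fin_cases c
      · exact (div_mul_cancel₀ _ h0).symm
      · change (R.dir k 1 : ℝ) = _ * (R.dir i 1 : ℝ)
        field_simp
        linarith
  have hτ0 : 0 < τ := by
    by_contra! hn
    rw [hτ 0, hτ 1] at s3
    have hτn : τ ≠ 0 := by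
      rintro rfl
      have t' := turn hR k
      rw [hτ 0, hτ 1] at t'
      simp at t'
    have : 0 < R.len k * -τ := mul_pos lk (neg_pos.2 (lt_of_le_of_ne hn hτn))
    nlinarith
  have key : R.len k * τ = R.len i := by
    apply le_antisymm
    · by_contra! hlt
      refine V_ne_edge hR k (i + 1) (s := R.len i / τ) (by positivity)
        ((div_lt_iff₀ hτ0).2 hlt) fun c => ?_
      rw [ei, h, hτ c]
      field_simp
    · by_contra! hlt
      refine V_ne_edge hR i (k + 1) (s := R.len k * τ) (by positivity) hlt fun c => ?_
      rw [ek, h, hτ c]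
      ring
  ext c
  rw [ei, ek, h, hτ c, ← key]
  ring

theorem isFakeCorner_of_eq (hR : R.IsValid) {i k : Fin d} (h : R.V i = R.V k)
    (hp : R.V (i - 1) = R.V (k - 1)) (hs : R.V (i + 1) = R.V (k + 1)) (hi : R.IsFakeCorner i) :
    R.IsFakeCorner k := by
  have hn : R.numCuts i = R.numCuts k := by unfold numCuts; rw [h]
  have hd : ∀ (i : Fin d) (n : ℤ), R.len (i - 1) * R.len i *
      ((R.dir (i - 1) 1 * R.dir i 0 - R.dir (i - 1) 0 * R.dir i 1 -
        n * (R.dir (i - 1) 0 * R.dir i 0) : ℤ) : ℝ) =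
      (R.V i 1 - R.V (i - 1) 1) * (R.V (i + 1) 0 - R.V i 0) -
        (R.V i 0 - R.V (i - 1) 0) * (R.V (i + 1) 1 - R.V i 1) -
        n * ((R.V i 0 - R.V (i - 1) 0) * (R.V (i + 1) 0 - R.V i 0)) := by
    intro i n
    rw [hR.edge_eq i, hR.edge_eq i]
    have h0 := hR.edge_eq (i - 1) 0
    have h1 := hR.edge_eq (i - 1) 1
    rw [sub_add_cancel] at h0 h1
    rw [h0, h1]
    push_cast
    ring
  refine ⟨hn ▸ hi.1, ?_⟩
  have hi2 := hi.2
  rw [detZ_corner] at hi2 ⊢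
  have h1 := hd i (R.numCuts i)
  have h2 := hd k (R.numCuts k)
  rw [h, hp, hs, hn, ← h2, ← hn, hi2, Int.cast_zero, mul_zero, eq_comm] at h1
  have := (mul_eq_zero.1 h1).resolve_left
    (mul_pos (hR.len_pos (k - 1)) (hR.len_pos k)).ne'
  rw [← hn]
  exact_mod_cast this

section corners

variable {D : ℕ} [NeZero D] {g : Fin D → Fin d}

/-- If the first corner is strictly leftmost-lowest among the corners, the polygon is
traversed only once. -/
theorem injective_V (hR : R.IsValid) (hg : IsCornerEnum R g)
    (hlex : ∀ a : Fin D, a ≠ 0 →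
      R.V (g 0) 0 < R.V (g a) 0 ∨
        (R.V (g 0) 0 = R.V (g a) 0 ∧ R.V (g 0) 1 < R.V (g a) 1)) : Function.Injective R.V := by
  intro i k h
  by_contra hik
  have key : ∀ j, R.V (j + (k - i)) = R.V j := by
    refine cyc_induction i ?_ fun j hj => ?_
    · rw [add_sub_cancel, h]
    · rw [add_right_comm]
      exact V_succ_eq_of_eq hR hj
  have hHD : R.IsHDCorner (g 0 + (k - i)) := by
    intro hf
    refine isHD hg 0 (isFakeCorner_of_eq hR (key _) ?_ ?_ hf)
    · rw [add_sub_right_comm]; exact key _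
    · rw [add_right_comm]; exact key _
  obtain ⟨a, ha⟩ := (hg.2 _).1 hHD
  have ha0 : a ≠ 0 := by
    rintro rfl
    have : k - i = 0 := by simpa using ha.symm
    exact hik (sub_eq_zero.1 this).symm
  have := hlex a ha0
  rw [ha, key] at this
  simp at this

/-- The first coordinate of the direction of an edge, oriented rightwards along the upper
boundary. -/
noncomputable def slope (R : STRep d m) (b : Bool) (i : Fin d) : ℝ := sg b * R.dirAt b i 0

theorem slope_true (i : Fin d) : R.slope true i = R.dir i 0 := one_mul _

theorem slope_false (i : Fin d) : R.slope false i = R.dir (i - 1) 0 := by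
  simp [slope, sg, dirAt, u1]

theorem slope_neg (b : Bool) (i : Fin d) : R.neg.slope b i = -R.slope b i := by
  cases b
  · rw [slope_false, slope_false]; simp [STRep.neg]
  · rw [slope_true, slope_true]; simp [STRep.neg]

theorem slope_add (b : Bool) (i : Fin d) :
    R.slope b i + R.slope (!b) i = ((R.dir (i - 1) 0 + R.dir i 0 : ℤ) : ℝ) := by
  cases b
  · rw [slope_false, Bool.not_false, slope_true]; push_cast; ring
  · rw [slope_true, Bool.not_true, slope_false]; push_cast; ring

theorem slope_next (hR : R.IsValid) (hg : IsCornerEnum R g) (b : Bool) (a : Fin D) :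
    R.slope (!b) (g (next b a)) = R.slope b (g a) := by
  cases b
  · rw [Bool.not_false, slope_true, slope_false, ← dir_pred_succ hR hg]
    simp [next]
  · rw [Bool.not_true, slope_false, slope_true]
    exact_mod_cast dir_pred_succ hR hg a

theorem sg_not (b : Bool) : sg (!b) = -sg b := by cases b <;> simp [sg]

theorem le_of_slope (hR : R.IsValid) {b : Bool} {i : Fin d} (h : R.slope b i ≤ 0)
    (h' : 0 ≤ R.slope (!b) i) {z : Pt} (hz : z ∈ R.carrier) :
    sg b * z 0 ≤ sg b * R.V i 0 := by
  cases b
  · rw [slope_false] at h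
    rw [Bool.not_false, slope_true] at h'
    have := V_le_of_turn hR i (by exact_mod_cast h) (by exact_mod_cast h') hz
    simp only [sg, cond_false]
    linarith
  · rw [slope_true] at h
    rw [Bool.not_true, slope_false] at h'
    have := le_V_of_turn hR i (by exact_mod_cast h') (by exact_mod_cast h) hz
    simp only [sg, cond_true]
    linarith

theorem top_of_slope (hR : R.IsValid) {b : Bool} {i : Fin d} (h : 0 < R.slope b i) :
    R.topF (R.V i 0) = R.V i 1 := by
  cases b
  · rw [slope_false] at h
    exact topF_V_succ hR (by exact_mod_cast h)
  · rw [slope_true] at h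
    exact topF_V hR (by exact_mod_cast h)

theorem corner_eq_of_top (hg : IsCornerEnum R g) (hV : Function.Injective R.V) {a b : Fin D}
    (ha : R.topF (R.V (g a) 0) = R.V (g a) 1) (hb : R.topF (R.V (g b) 0) = R.V (g b) 1)
    (h : R.V (g a) 0 = R.V (g b) 0) : a = b := by
  apply hg.1.injective
  apply hV
  ext k
  fin_cases k
  · exact h
  · change R.V (g a) 1 = R.V (g b) 1
    rw [← ha, ← hb, h]

theorem V_next_corner (hR : R.IsValid) (hg : IsCornerEnum R g) (b : Bool) (a : Fin D) :
    sg b * R.V (g (next b a)) 0 =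
      sg b * R.V (g a) 0 + R.armLen b (g a) (armNum g b a) * R.slope b (g a) := by
  rw [← next_armNum (g := g), V_arm_zero hR hg b a le_rfl, slope]
  ring

/-- Corners of the upper boundary are not in the interior of a semitoric edge. -/
theorem corner_not_inside (hR : R.IsValid) (hg : IsCornerEnum R g) (hV : Function.Injective R.V)
    {b : Bool} {a k : Fin D} (hb : 0 < R.slope b (g a))
    (hk : R.topF (R.V (g k) 0) = R.V (g k) 1) (h : sg b * R.V (g a) 0 < sg b * R.V (g k) 0) :
    sg b * R.V (g (next b a)) 0 ≤ sg b * R.V (g k) 0 := by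
  by_contra! hlt
  rw [V_next_corner hR hg] at hlt
  set t := (sg b * R.V (g k) 0 - sg b * R.V (g a) 0) / R.slope b (g a) with ht
  have htm : t * R.slope b (g a) = sg b * R.V (g k) 0 - sg b * R.V (g a) 0 :=
    div_mul_cancel₀ _ hb.ne'
  have ht0 : 0 < t := div_pos (by linarith) hb
  have ht1 : t < R.armLen b (g a) (armNum g b a) := by
    rw [ht, div_lt_iff₀ hb]; linarith
  obtain ⟨q, hq⟩ := ArmPt.exists ht0.le ht1.le
  have hq1 := hq.top hR hg hb
  have hq0 : q 0 = R.V (g k) 0 := by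
    rw [hq.zero hR hg]
    have := sg_mul_self b
    rw [slope] at htm
    linear_combination sg b * htm - (t * R.dirAt b (g a) 0 - R.V (g k) 0 + R.V (g a) 0) * this
  have hqk : q = R.V (g k) := by
    ext c
    fin_cases c
    · exact hq0
    · change q 1 = R.V (g k) 1
      rw [hq1, hq0, hk]
  have hvert : ∀ n ≤ armNum g b a, R.V ((next b)^[n] (g a)) ≠ R.V (g k) := by
    intro n hn h
    have h := hV h
    rcases Nat.eq_zero_or_pos n with rfl | h0
    · rw [Function.iterate_zero, id] at h
      rw [← h] at htm
      rw [sub_self] at htm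
      exact (mul_pos ht0 hb).ne' htm
    · rcases hn.lt_or_eq with h1 | rfl
      · exact isHD hg k (h ▸ fake_arm hg b a h0 h1)
      · have := V_arm_zero hR hg b a (le_refl (armNum g b a))
        rw [h] at this
        have : sg b * R.V (g k) 0 = sg b * R.V (g a) 0 +
          R.armLen b (g a) (armNum g b a) * R.slope b (g a) := by
          rw [this, slope]; ring
        linarith
  obtain ⟨n, hn, s, hs0, hs1, hqs, -⟩ := hq
  rw [hqk] at hqs
  rcases hs0.eq_or_lt with rfl | hs0
  · exact hvert n hn.le (by ext c; rw [hqs c]; ring)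
  rcases hs1.eq_or_lt with rfl | hs1
  · refine hvert (n + 1) hn ?_
    ext c
    rw [hqs c, Function.iterate_succ_apply', V_next hR]
  · cases b
    · refine V_ne_edge hR ((next false)^[n] (g a) - 1) (g k)
        (s := R.len ((next false)^[n] (g a) - 1) - s) (sub_pos.2 hs1) (by linarith) fun c => ?_
      rw [hqs c, V_eq_pred hR]
      simp only [dirAt, cond_false, u1]
      push_cast
      ring
    · exact V_ne_edge hR _ _ hs0 hs1 hqs

theorem side_le (hR : R.IsValid) (hg : IsCornerEnum R g) (hV : Function.Injective R.V)
    {sz : Fin D → ℝ} (h : sz ∈ STPolytope R g) {β : Bool} {a b : Fin D}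
    (ha : 0 < R.slope β (g a)) (hb : 0 < R.slope (!β) (g b))
    (hab : sg β * R.V (g a) 0 < sg β * R.V (g b) 0) :
    sg β * R.V (g a) 0 + sz a * R.slope β (g a) ≤
      sg β * R.V (g b) 0 - sz b * R.slope (!β) (g b) := by
  have pair : ∀ c, sz c + sz (next β c) ≤ R.armLen β (g c) (armNum g β c) := by
    intro c
    cases β
    · have := (h (c - 1)).2.1
      rw [stEdgeLen_eq_false, sub_add_cancel, add_comm] at this
      exact this
    · have := (h c).2.1
      rwa [stEdgeLen_eq_true] at this
  have hnn : next β (next (!β) b) = b := by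
    have := next_not_next (!β) b
    rwa [Bool.not_not] at this
  have sa := slope_next hR hg β a
  have sb := slope_next hR hg (!β) b
  rw [Bool.not_not] at sb
  have ea := V_next_corner hR hg β a
  have eb := V_next_corner hR hg (!β) b
  rw [sg_not] at eb
  have h1 := corner_not_inside hR hg hV ha (top_of_slope hR hb) hab
  have h2 := corner_not_inside hR hg hV hb (top_of_slope hR ha) (by rw [sg_not]; linarith)
  rw [sg_not] at h2
  by_cases hadj : next β a = b
  · rw [hadj] at sa ea
    rw [sa, ea]
    have := pair a
    rw [hadj] at this
    nlinarith
  · have h3 : sg β * R.V (g (next β a)) 0 ≤ sg β * R.V (g (next (!β) b)) 0 := by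
      have tb : 0 < R.slope β (g (next (!β) b)) := by rw [sb]; exact hb
      rcases lt_or_ge (sg β * R.V (g a) 0) (sg β * R.V (g (next (!β) b)) 0) with hlt | hge
      · exact corner_not_inside hR hg hV ha (top_of_slope hR tb) hlt
      · exfalso
        apply hadj
        have : R.V (g a) 0 = R.V (g (next (!β) b)) 0 := by
          have hs := sg_mul_self β
          have he : sg β * R.V (g a) 0 = sg β * R.V (g (next (!β) b)) 0 := by linarith
          have := congrArg (sg β * ·) he
          simpa only [← mul_assoc, hs, one_mul] using this
        rw [corner_eq_of_top hg hV (top_of_slope hR ha) (top_of_slope hR tb) this, hnn]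
    have l1 := mul_le_mul_of_nonneg_right (le_armLen hR h β a) ha.le
    have l2 := mul_le_mul_of_nonneg_right (le_armLen hR h (!β) b) hb.le
    linarith

end corners

/-- The hypotenuse of the standard triangle at a corner of the upper boundary. -/
noncomputable def chord (R : STRep d m) (i : Fin d) (lam x : ℝ) : ℝ :=
  R.flip R.flipTop (R.V i) 1 + lam * R.germ R.flipTop (R.V i 0) (R.dirAt false i) 1 +
    (x - R.V i 0 + lam * R.slope false i) *
      (((R.germ R.flipTop (R.V i 0) (R.dirAt true i) 1 : ℝ) -
        R.germ R.flipTop (R.V i 0) (R.dirAt false i) 1) /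
          (R.slope true i + R.slope false i)) - R.phi R.flipTop x

theorem dirAt_eq_slope (b : Bool) (i : Fin d) : (R.dirAt b i 0 : ℝ) = sg b * R.slope b i := by
  rw [slope, ← mul_assoc, sg_mul_self, one_mul]

theorem flipTop_nonneg (R : STRep d m) (j : Fin m) : 0 ≤ R.flipTop j := by
  unfold flipTop; split_ifs <;> simp

theorem concaveOn_chord (R : STRep d m) (i : Fin d) (lam : ℝ) :
    ConcaveOn ℝ univ (R.chord i lam) := by
  have h1 : ConvexOn ℝ univ (R.phi R.flipTop) := by
    refine ⟨convex_univ, fun x _ y _ s r hs hr hsr => ?_⟩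
    simp only [phi, smul_eq_mul]
    rw [Finset.mul_sum, Finset.mul_sum, ← Finset.sum_add_distrib]
    refine Finset.sum_le_sum fun j _ => ?_
    have hu : (0 : ℝ) ≤ R.flipTop j := by exact_mod_cast R.flipTop_nonneg j
    have : max (s * x + r * y - R.c j 0) 0 ≤
        s * max (x - R.c j 0) 0 + r * max (y - R.c j 0) 0 := by
      refine max_le ?_ (by positivity)
      have h1 := mul_le_mul_of_nonneg_left (le_max_left (x - R.c j 0) 0) hs
      have h2 := mul_le_mul_of_nonneg_left (le_max_left (y - R.c j 0) 0) hr
      have : R.c j 0 = s * R.c j 0 + r * R.c j 0 := by rw [← add_mul, hsr, one_mul]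
      linarith
    nlinarith [mul_le_mul_of_nonneg_left this hu]
  refine ⟨convex_univ, fun x hx y hy s r hs hr hsr => ?_⟩
  have := h1.2 hx hy hs hr hsr
  simp only [smul_eq_mul] at this ⊢
  unfold chord
  have hs' : s = 1 - r := by linarith
  subst hs'
  refine le_trans (le_of_eq ?_) (sub_le_sub_left this _)
  ring

theorem topTri_coords {i : Fin d} {lam : ℝ} {z : Pt} (hz : z ∈ R.topTri i lam) (b : Bool) :
    ∃ s r : ℝ, 0 ≤ s ∧ 0 ≤ r ∧ s + r < lam ∧
      sg b * z 0 = sg b * R.V i 0 + (r * R.slope b i - s * R.slope (!b) i) := by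
  obtain ⟨s, r, hs, hr, hsr, h0, -⟩ := hz
  rw [germ_zero, germ_zero] at h0
  have e1 : (R.u1 i 0 : ℝ) = -R.slope false i := by
    have := dirAt_eq_slope (R := R) false i
    simpa [sg, dirAt] using this
  have e2 : (R.u2 i 0 : ℝ) = R.slope true i := by
    have := dirAt_eq_slope (R := R) true i
    simpa [sg, dirAt] using this
  rw [e1, e2] at h0
  cases b
  · refine ⟨r, s, hr, hs, by linarith, ?_⟩
    rw [h0]; simp only [sg, cond_false, Bool.not_false]; ring
  · refine ⟨s, r, hs, hr, hsr, ?_⟩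
    rw [h0]; simp only [sg, cond_true, Bool.not_true]; ring

theorem chord_end {i : Fin d} (hκ : 0 < R.dir (i - 1) 0 + R.dir i 0) {lam : ℝ} {b : Bool} {q : Pt}
    (h0 : q 0 = R.V i 0 + lam * R.dirAt b i 0)
    (h1 : R.flip R.flipTop q 1 = R.flip R.flipTop (R.V i) 1 +
      lam * R.germ R.flipTop (R.V i 0) (R.dirAt b i) 1) : R.chord i lam (q 0) = q 1 := by
  have hκ' : (0 : ℝ) < R.slope true i + R.slope false i := by
    have := slope_add (R := R) true i
    rw [Bool.not_true] at this
    rw [this]; exact_mod_cast hκ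
  rw [flip_self_sub] at h1
  have e : q 1 = R.flip R.flipTop q 1 - R.phi R.flipTop (q 0) := by rw [flip_self_sub]; ring
  rw [e, flip_self_sub, h1]
  unfold chord
  congr 1
  rw [dirAt_eq_slope] at h0
  rw [h0]
  cases b
  · simp only [sg, cond_false]; ring
  · simp only [sg, cond_true]
    field_simp
    ring

theorem chord_mem (hR : R.IsValid) {i : Fin d} (hκ : 0 < R.dir (i - 1) 0 + R.dir i 0) {lam : ℝ}
    (hl : 0 < lam)
    (h : ∀ b, ∃ q ∈ R.carrier, q 0 = R.V i 0 + lam * R.dirAt b i 0 ∧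
      R.flip R.flipTop q 1 = R.flip R.flipTop (R.V i) 1 +
        lam * R.germ R.flipTop (R.V i 0) (R.dirAt b i) 1) {x : ℝ}
    (hx : ∀ b, sg b * x ≤ sg b * R.V i 0 + lam * R.slope b i) :
    ∃ y ∈ R.carrier, y 0 = x ∧ y 1 = R.chord i lam x := by
  have hκ' : (0 : ℝ) < R.slope true i + R.slope false i := by
    have := slope_add (R := R) true i
    rw [Bool.not_true] at this
    rw [this]; exact_mod_cast hκ
  obtain ⟨p, hp, p0, p1⟩ := h false
  obtain ⟨q, hq, q0, q1⟩ := h true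
  have x1 := hx true
  have x2 := hx false
  rw [dirAt_eq_slope] at p0 q0
  simp only [sg, cond_true, cond_false] at x1 x2 p0 q0
  set E := R.slope true i
  set F := R.slope false i
  set r := (x - R.V i 0 + lam * F) / (lam * (E + F)) with hr
  have hden : 0 < lam * (E + F) := mul_pos hl hκ'
  have hr0 : 0 ≤ r := div_nonneg (by linarith) hden.le
  have hr1 : r ≤ 1 := by rw [hr, div_le_one hden]; linarith
  have hrm : r * (lam * (E + F)) = x - R.V i 0 + lam * F := div_mul_cancel₀ _ hden.ne'
  obtain ⟨y, hy, y0, y1⟩ := exists_flip_combo hR R.isFlip_flipTop hp hq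
    (sub_nonneg.2 hr1) hr0 (sub_add_cancel 1 r)
  have hyx : y 0 = x := by rw [y0, p0, q0]; linear_combination hrm
  refine ⟨y, hy, hyx, ?_⟩
  have e : y 1 = R.flip R.flipTop y 1 - R.phi R.flipTop (y 0) := by rw [flip_self_sub]; ring
  rw [e, y1, p1, q1, hyx]
  unfold chord
  congr 1
  change _ = _ + (x - R.V i 0 + lam * F) * (_ / (E + F))
  rw [← hrm]
  field_simp
  ring

section corners

variable {D : ℕ} [NeZero D] {g : Fin D → Fin d}

theorem chord_lt (hR : R.IsValid) (hg : IsCornerEnum R g) {a : Fin D}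
    (hκ : 0 < R.dir (g a - 1) 0 + R.dir (g a) 0) {lam : ℝ} {z : Pt}
    (hz : z ∈ R.topTri (g a) lam) : R.chord (g a) lam (z 0) < z 1 := by
  have hκ' : (0 : ℝ) < R.slope true (g a) + R.slope false (g a) := by
    have := slope_add (R := R) true (g a)
    rw [Bool.not_true] at this
    rw [this]; exact_mod_cast hκ
  have hdet := (isHD hg a).detZ_germ_flipTop hR hκ.le
  have hdet' : ((R.germ R.flipTop (R.V (g a) 0) (R.dirAt false (g a)) 0 : ℤ) : ℝ) *
      R.germ R.flipTop (R.V (g a) 0) (R.dirAt true (g a)) 1 -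
      R.germ R.flipTop (R.V (g a) 0) (R.dirAt false (g a)) 1 *
      R.germ R.flipTop (R.V (g a) 0) (R.dirAt true (g a)) 0 = 1 := by
    exact_mod_cast hdet
  obtain ⟨s, r, hs, hr, hsr, h0, h1⟩ := hz
  rw [germ_zero, germ_zero] at h0 hdet'
  change z 0 = _ + (s * (R.dirAt false (g a) 0 : ℝ) + r * (R.dirAt true (g a) 0 : ℝ)) at h0
  rw [dirAt_eq_slope, dirAt_eq_slope] at h0 hdet'
  have e : z 1 = R.flip R.flipTop z 1 - R.phi R.flipTop (z 0) := by rw [flip_self_sub]; ring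
  rw [e, h1]
  unfold chord
  refine sub_lt_sub_right ?_ _
  change _ < _ + (s * (R.germ R.flipTop (R.V (g a) 0) (R.dirAt false (g a)) 1 : ℝ) +
    r * (R.germ R.flipTop (R.V (g a) 0) (R.dirAt true (g a)) 1 : ℝ))
  simp only [sg, cond_true, cond_false] at h0 hdet'
  rw [h0]
  set v1 : ℝ := (R.germ R.flipTop (R.V (g a) 0) (R.dirAt false (g a)) 1 : ℝ)
  set w1 : ℝ := (R.germ R.flipTop (R.V (g a) 0) (R.dirAt true (g a)) 1 : ℝ)
  set E := R.slope true (g a)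
  set F := R.slope false (g a)
  rw [← sub_pos]
  have : R.flip R.flipTop (R.V (g a)) 1 + (s * v1 + r * w1) -
      (R.flip R.flipTop (R.V (g a)) 1 + lam * v1 +
        (R.V (g a) 0 + (s * (-1 * F) + r * (1 * E)) - R.V (g a) 0 + lam * F) *
          ((w1 - v1) / (E + F))) = (lam - s - r) / (E + F) := by
    field_simp
    linear_combination (lam - s - r) * hdet'
  rw [this]
  exact div_pos (by linarith) hκ'

theorem pair_le (hR : R.IsValid) {sz : Fin D → ℝ} (h : sz ∈ STPolytope R g) (β : Bool)
    (c : Fin D) : sz c + sz (next β c) ≤ R.armLen β (g c) (armNum g β c) := by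
  cases β
  · have := (h (c - 1)).2.1
    rw [stEdgeLen_eq_false, sub_add_cancel, add_comm] at this
    exact this
  · have := (h c).2.1
    rwa [stEdgeLen_eq_true] at this

theorem injective_V_neg (hV : Function.Injective R.V) : Function.Injective R.neg.V :=
  fun _ _ h => hV (neg_injective h)

theorem slope_add_nonneg {i : Fin d} (h : 0 ≤ R.dir (i - 1) 0 + R.dir i 0) (b : Bool) :
    0 ≤ R.slope b i + R.slope (!b) i := by
  rw [slope_add]; exact_mod_cast h

theorem sg_mul_inj {b : Bool} {x y : ℝ} (h : sg b * x = sg b * y) : x = y := by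
  have := congrArg (sg b * ·) h
  simpa only [← mul_assoc, sg_mul_self, one_mul] using this

theorem topTri_not_mem (hR : R.IsValid) (hg : IsCornerEnum R g) (hV : Function.Injective R.V)
    {sz : Fin D → ℝ} (h : sz ∈ STPolytope R g) {a b : Fin D}
    (ha : 0 ≤ R.dir (g a - 1) 0 + R.dir (g a) 0) (hb : 0 ≤ R.dir (g b - 1) 0 + R.dir (g b) 0)
    (hlt : R.V (g a) 0 < R.V (g b) 0) {z : Pt} (hza : z ∈ R.topTri (g a) (sz a))
    (hzb : z ∈ R.topTri (g b) (sz b)) : False := by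
  obtain ⟨s, r, hs, hr, hsr, e⟩ := topTri_coords hza true
  obtain ⟨s', r', hs', hr', hsr', e'⟩ := topTri_coords hzb false
  have ka := slope_add_nonneg ha true
  have kb := slope_add_nonneg hb false
  simp only [Bool.not_true, Bool.not_false] at *
  rcases le_or_gt (R.slope true (g a)) 0 with h1 | h1
  · have := le_of_slope hR h1 (by rw [Bool.not_true]; linarith) (R.V_mem (g b))
    simp only [sg, cond_true] at this
    linarith
  rcases le_or_gt (R.slope false (g b)) 0 with h2 | h2
  · have := le_of_slope hR h2 (by rw [Bool.not_false]; linarith) (R.V_mem (g a))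
    simp only [sg, cond_false] at this
    linarith
  have := side_le hR hg hV h (β := true) h1 h2 (by simpa [sg] using hlt)
  simp only [sg, cond_true, cond_false, Bool.not_true] at this e e'
  nlinarith [mul_nonneg hs ka, mul_nonneg hs' kb, mul_pos (sub_pos.2 hsr) h1,
    mul_pos (sub_pos.2 hsr') h2]

theorem disjoint_topTri (hR : R.IsValid) (hg : IsCornerEnum R g) (hV : Function.Injective R.V)
    {sz : Fin D → ℝ} (h : sz ∈ STPolytope R g) {a b : Fin D} (hab : a ≠ b)
    (ha : 0 ≤ R.dir (g a - 1) 0 + R.dir (g a) 0) (hb : 0 ≤ R.dir (g b - 1) 0 + R.dir (g b) 0) :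
    Disjoint (R.topTri (g a) (sz a)) (R.topTri (g b) (sz b)) := by
  rw [Set.disjoint_left]
  intro z hza hzb
  rcases lt_trichotomy (R.V (g a) 0) (R.V (g b) 0) with hlt | heq | hlt
  · exact topTri_not_mem hR hg hV h ha hb hlt hza hzb
  · exact hab (corner_eq_of_top hg hV (V_top hR ha) (V_top hR hb) heq)
  · exact topTri_not_mem hR hg hV h hb ha hlt hzb hza

/-- A triangle at an upper corner meets a triangle at a lower corner only over the
projection of its hypotenuse. -/
theorem le_of_mem_both (hR : R.IsValid) (hg : IsCornerEnum R g) (hV : Function.Injective R.V)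
    {sz : Fin D → ℝ} (h : sz ∈ STPolytope R g) {a b : Fin D} (hab : a ≠ b)
    (ha : 0 ≤ R.dir (g a - 1) 0 + R.dir (g a) 0)
    (hb : 0 ≤ R.neg.dir (g b - 1) 0 + R.neg.dir (g b) 0) {z : Pt}
    (hza : z ∈ R.topTri (g a) (sz a)) (hzb : -z ∈ R.neg.topTri (g b) (sz b)) (β : Bool) :
    sg β * z 0 ≤ sg β * R.V (g a) 0 + sz a * R.slope β (g a) := by
  by_contra! hlt
  obtain ⟨s, r, hs, hr, hsr, e⟩ := topTri_coords hza β
  obtain ⟨s', r', hs', hr', hsr', e'⟩ := topTri_coords hzb (!β)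
  have ka := slope_add_nonneg ha β
  have kb := slope_add_nonneg hb β
  rw [sg_not, Bool.not_not] at e'
  change -sg β * -z 0 = -sg β * -R.V (g b) 0 + _ at e'
  have hneg : R.slope β (g a) < 0 := by
    by_contra! hn
    nlinarith [mul_nonneg hs ka, mul_nonneg (sub_pos.2 hsr).le hn]
  have hba : sg β * R.V (g b) 0 ≤ sg β * R.V (g a) 0 :=
    le_of_slope hR hneg.le (by linarith) (R.V_mem _)
  have hnega : 0 < R.neg.slope β (g a) := by rw [slope_neg]; linarith
  have hne : sg β * R.V (g b) 0 ≠ sg β * R.V (g a) 0 := by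
    intro heq
    refine hab (corner_eq_of_top hg.neg (injective_V_neg hV) (top_of_slope hR.neg hnega)
      (V_top hR.neg hb) ?_)
    change -R.V (g a) 0 = -R.V (g b) 0
    rw [sg_mul_inj heq]
  rcases le_or_gt (R.neg.slope (!β) (g b)) 0 with h1 | h1
  · have := le_of_slope hR.neg h1 (by rw [Bool.not_not]; linarith) (R.neg.V_mem (g a))
    rw [sg_not] at this
    change -sg β * -R.V (g a) 0 ≤ -sg β * -R.V (g b) 0 at this
    exact hne (le_antisymm hba (by linarith))
  · have := side_le hR.neg hg.neg (injective_V_neg hV) (stPolytope_neg h) (β := !β) h1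
      (by rwa [Bool.not_not]) (a := b) (b := a) ?_
    · rw [sg_not, Bool.not_not, slope_neg β (g a)] at this
      change -sg β * -R.V (g b) 0 + _ ≤ -sg β * -R.V (g a) 0 - _ at this
      nlinarith [mul_nonneg hs' kb, mul_pos (sub_pos.2 hsr') h1]
    · rw [sg_not]
      change -sg β * -R.V (g b) 0 < -sg β * -R.V (g a) 0
      have := lt_of_le_of_ne hba hne
      linarith

theorem ArmPt.eq_of_vertical (hR : R.IsValid) (hg : IsCornerEnum R g) {b : Bool} {a : Fin D}
    (h : R.dirAt b (g a) 0 = 0) {q : Pt} {t : ℝ} (hq : ArmPt R g b a q t) (c : Fin 2) :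
    q c = R.V (g a) c + t * R.dirAt b (g a) c := by
  obtain ⟨k, hk, s, -, -, hq, rfl⟩ := hq
  rw [armNum_eq_one hR hg h, Nat.lt_one_iff] at hk
  subst hk
  rw [armLen_zero, zero_add]
  exact hq c

theorem chord_add_nonneg_of_vertical (hR : R.IsValid) (hg : IsCornerEnum R g)
    {sz : Fin D → ℝ} (h : sz ∈ STPolytope R g) {a : Fin D} {β : Bool}
    (ha : R.dirAt β (g a) 0 = 0) (hκ : 0 ≤ R.dir (g a - 1) 0 + R.dir (g a) 0) {q q' : Pt}
    (hq : ArmPt R g β a q (sz a))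
    (hq' : ArmPt R.neg g (!β) (next β a) q' (sz (next β a))) : 0 ≤ q 1 + q' 1 := by
  have hn := next_armNum (g := g) β a
  have hk := armNum_eq_one hR hg ha
  rw [hk, Function.iterate_one] at hn
  have hD : R.neg.dirAt (!β) (g (next β a)) = R.dirAt β (g a) := by
    have := dirAt_not_next (R := R) β (g a)
    rw [hn] at this
    have e : R.neg.dirAt (!β) (g (next β a)) = fun k => -R.dirAt (!β) (g (next β a)) k := by
      funext k; cases β <;> simp [dirAt, u1, u2, neg]
    rw [e, this]
    simp
  have e1 := hq.eq_of_vertical hR hg ha 1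
  have e2 := hq'.eq_of_vertical hR.neg hg.neg (by rw [hD]; exact ha) 1
  have hl := pair_le hR h β a
  rw [hk, armLen_succ, armLen_zero, Function.iterate_zero, id, zero_add] at hl
  have e3 := V_next hR β (g a) 1
  have e4 := V_next hR β (g a) 0
  rw [hn] at e3 e4
  rw [ha] at e4
  have ht := le_topF hR (R.V_mem (g (next β a)))
  rw [e4, Int.cast_zero, mul_zero, add_zero, V_top hR hκ] at ht
  rw [hD] at e2
  change q' 1 = -R.V (g (next β a)) 1 + _ at e2
  have hlen := lenAt_pos hR β (g a)
  have hD1 : (R.dirAt β (g a) 1 : ℝ) ≤ 0 := by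
    by_contra! hc
    nlinarith [mul_pos hlen hc]
  rw [e1, e2, e3]
  nlinarith [mul_nonneg (sub_nonneg.2 hl) (neg_nonneg.2 hD1)]

theorem armLen_armNum_pos (hR : R.IsValid) (b : Bool) (a : Fin D) :
    0 < R.armLen b (g a) (armNum g b a) := by
  refine lt_of_lt_of_le ?_ (armLen_mono hR b (g a) (armNum_pos (g := g) b a))
  rw [Nat.succ_eq_add_one, armLen_succ, armLen_zero, zero_add]
  exact lenAt_pos hR b _

theorem slope_ne_zero (hR : R.IsValid) {b : Bool} {i : Fin d} (h : R.slope (!b) i = 0) :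
    R.slope b i ≠ 0 := by
  intro h'
  have := turn_pred hR i
  rw [← slope_true i, ← slope_false i] at this
  cases b <;> simp only [Bool.not_true, Bool.not_false] at h <;> rw [h, h'] at this <;> simp at this

/-- Over the end of the hypotenuse of a triangle at a lower corner, this hypotenuse is
below the hypotenuse of a triangle at an upper corner. -/
theorem chord_add_nonneg (hR : R.IsValid) (hg : IsCornerEnum R g) (hV : Function.Injective R.V)
    {sz : Fin D → ℝ} (h : sz ∈ STPolytope R g) {a b : Fin D} (hab : a ≠ b)
    (ha : 0 < R.dir (g a - 1) 0 + R.dir (g a) 0)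
    (hb : 0 < R.neg.dir (g b - 1) 0 + R.neg.dir (g b) 0) (hsa : 0 < sz a) (hsb : 0 < sz b)
    {β : Bool} {B : ℝ} (hB : sg β * B = sg β * R.V (g b) 0 - sz b * R.slope (!β) (g b))
    (hB1 : sg β * B ≤ sg β * R.V (g a) 0 + sz a * R.slope β (g a))
    (hB2 : sg (!β) * B ≤ sg (!β) * R.V (g a) 0 + sz a * R.slope (!β) (g a)) :
    0 ≤ R.chord (g a) (sz a) B + R.neg.chord (g b) (sz b) (-B) := by
  have hV' := injective_V_neg hV
  have h' := stPolytope_neg h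
  obtain ⟨q', hq'm, hq', hq'0, hq'1⟩ := exists_side_end hR.neg hg.neg hb.le hsb.le (h' b).2.2
    (fun b' => le_armLen hR.neg h' b' b) (!β)
  have c' := chord_end hb hq'0 hq'1
  have hq'B : q' 0 = -B := by
    apply sg_mul_inj (b := β)
    rw [hq'0, dirAt_eq_slope, slope_neg, sg_not]
    change sg β * (-R.V (g b) 0 + _) = _
    linear_combination hB + sz b * R.slope (!β) (g b) * sg_mul_self β
  rw [hq'B] at c'
  rw [c']
  have hm' : -q' ∈ R.carrier := mem_carrier_neg.1 hq'm
  have q'top := le_topF hR hm'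
  rw [Pi.neg_apply, Pi.neg_apply, hq'B, _root_.neg_neg] at q'top
  have ka := slope_add_nonneg ha.le β
  have side := exists_side_end hR hg ha.le hsa.le (h a).2.2 (fun b' => le_armLen hR h b' a)
  obtain ⟨q, -, hq, hq0, hq1⟩ := side β
  have c := chord_end ha hq0 hq1
  rw [dirAt_eq_slope] at hq0
  have topHelper : 0 < R.slope β (g a) →
      sg β * R.V (g a) 0 + sz a * R.slope β (g a) ≤ sg β * B →
      0 ≤ R.chord (g a) (sz a) B + q' 1 := by
    intro hs hle
    have e : q 0 = B := by
      apply sg_mul_inj (b := β)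
      rw [hq0]
      linear_combination (le_antisymm hle hB1) + sz a * R.slope β (g a) * sg_mul_self β
    rw [e] at c
    have ht := hq.top hR hg hs
    rw [e] at ht
    rw [c, ht]
    linarith
  rcases lt_trichotomy (R.slope (!β) (g b)) 0 with hlt | heq | hgt
  · have hn : 0 < R.neg.slope (!β) (g b) := by rw [slope_neg]; linarith
    have ht := hq'.top hR.neg hg.neg hn
    rw [hq'B, topF_neg, _root_.neg_neg] at ht
    obtain ⟨y, hy, y0, y1⟩ := chord_mem hR ha hsa
      (fun b' => by
        obtain ⟨q, hqm, -, h0, h1⟩ := side b'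
        exact ⟨q, hqm, h0, h1⟩) (x := B) (by
        intro b'
        cases b' <;> cases β <;> first | exact hB1 | exact hB2)
    have := botF_le hR hy
    rw [y0, y1] at this
    linarith
  · have hnb : R.slope β (g b) < 0 := by
      have := slope_add_nonneg hb.le β
      rw [slope_neg, slope_neg, heq] at this
      exact lt_of_le_of_ne (by linarith) (slope_ne_zero hR heq)
    have ext : ∀ z ∈ R.carrier, sg β * z 0 ≤ sg β * R.V (g b) 0 :=
      fun z hz => le_of_slope hR hnb.le heq.ge hz
    rw [heq, mul_zero, sub_zero] at hB
    rcases lt_or_ge 0 (R.slope β (g a)) with hpos | hnonpos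
    · refine topHelper hpos ?_
      have e1 := V_next_corner hR hg β a
      have e2 := ext _ (R.V_mem (g (next β a)))
      have e3 := mul_le_mul_of_nonneg_right (le_armLen hR h β a) hpos.le
      linarith
    · have e1 := le_of_slope hR hnonpos (by linarith) (R.V_mem (g b))
      have e2 := ext _ (R.V_mem (g a))
      have e3 : R.slope β (g a) = 0 := by
        refine le_antisymm hnonpos ?_
        by_contra! hc
        nlinarith [mul_pos hsa (neg_pos.2 hc)]
      have hba : next β a = b := by
        have s1 := slope_next hR hg β a
        rw [e3] at s1
        have v1 := V_next_corner hR hg β a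
        rw [e3, mul_zero, add_zero] at v1
        have v2 := V_next_corner hR hg β (next β a)
        have v3 := ext _ (R.V_mem (g (next β (next β a))))
        have s2 : R.slope β (g (next β a)) < 0 := by
          refine lt_of_le_of_ne ?_ (slope_ne_zero hR s1)
          by_contra! hc
          nlinarith [mul_pos (armLen_armNum_pos (g := g) hR β (next β a)) hc]
        refine corner_eq_of_top hg.neg hV' (top_of_slope hR.neg (b := β) ?_)
          (top_of_slope hR.neg (b := β) ?_) ?_
        · rw [slope_neg]; linarith
        · rw [slope_neg]; linarith
        · change -R.V _ 0 = -R.V _ 0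
          rw [sg_mul_inj (v1.trans (le_antisymm e2 e1))]
      subst hba
      have hd : R.dirAt β (g a) 0 = 0 := by
        have := dirAt_eq_slope (R := R) β (g a)
        rw [e3, mul_zero] at this
        exact_mod_cast this
      have e : q 0 = B := by
        apply sg_mul_inj (b := β)
        rw [hq0, e3, hB]
        linarith
      rw [e] at c
      rw [c]
      exact chord_add_nonneg_of_vertical hR hg h hd ha.le hq hq'
  · have hnb : R.slope β (g b) < 0 := by
      have := slope_add_nonneg hb.le β
      rw [slope_neg, slope_neg] at this
      linarith
    have ext : ∀ z ∈ R.carrier, sg β * z 0 ≤ sg β * R.V (g b) 0 :=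
      fun z hz => le_of_slope hR hnb.le hgt.le hz
    have e2 := ext _ (R.V_mem (g a))
    rcases lt_or_eq_of_le e2 with hlt | he
    · rcases lt_or_ge 0 (R.slope β (g a)) with hpos | hnonpos
      · refine topHelper hpos ?_
        rw [hB]
        exact side_le hR hg hV h hpos hgt hlt
      · have e1 := le_of_slope hR hnonpos (by linarith) (R.V_mem (g b))
        linarith
    · exact absurd (corner_eq_of_top hg hV (V_top hR ha.le) (top_of_slope hR hgt)
        (sg_mul_inj he)) hab

end corners

theorem pos_of_mem_topTri {i : Fin d} {lam : ℝ} {z : Pt} (hz : z ∈ R.topTri i lam) :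
    0 < lam := by
  obtain ⟨s, r, hs, hr, hsr, -⟩ := hz
  linarith

theorem dir_sum_pos (hR : R.IsValid) {i : Fin d} (h : 0 ≤ R.dir (i - 1) 0 + R.dir i 0)
    {lam : ℝ} {z : Pt} (hz : z ∈ R.topTri i lam)
    (hx : ∀ b, sg b * z 0 ≤ sg b * R.V i 0 + lam * R.slope b i) :
    0 < R.dir (i - 1) 0 + R.dir i 0 := by
  refine lt_of_le_of_ne h fun he => ?_
  obtain ⟨s, r, hs, hr, hsr, e⟩ := topTri_coords hz true
  have h1 := hx true
  have h2 := hx false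
  have h3 := slope_add (R := R) true i
  rw [← he, Int.cast_zero] at h3
  simp only [sg, cond_true, cond_false, Bool.not_true] at e h1 h2 h3
  have h4 : R.slope false i = -R.slope true i := by linarith
  have h5 : R.slope true i = 0 := by
    rw [h4] at e h2
    have h6 : (lam - s - r) * R.slope true i = 0 := by linarith
    exact (mul_eq_zero.1 h6).resolve_left (by linarith)
  exact slope_ne_zero hR (b := false) h5 (by rw [h4, h5, neg_zero])

section corners

variable {D : ℕ} [NeZero D] {g : Fin D → Fin d}

theorem disjoint_topTri_neg (hR : R.IsValid) (hg : IsCornerEnum R g)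
    (hV : Function.Injective R.V) {sz : Fin D → ℝ} (h : sz ∈ STPolytope R g) {a b : Fin D}
    (hab : a ≠ b) (ha : 0 ≤ R.dir (g a - 1) 0 + R.dir (g a) 0)
    (hb : 0 ≤ R.neg.dir (g b - 1) 0 + R.neg.dir (g b) 0) :
    Disjoint (R.topTri (g a) (sz a)) (-R.neg.topTri (g b) (sz b)) := by
  rw [Set.disjoint_left]
  intro z hza hzb
  rw [Set.mem_neg] at hzb
  have h' := stPolytope_neg h
  have hV' := injective_V_neg hV
  have Ja := le_of_mem_both hR hg hV h hab ha hb hza hzb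
  have Jb := le_of_mem_both hR.neg hg.neg hV' h' hab.symm hb
    (by rw [STRep.neg_neg]; exact ha) hzb (by rw [STRep.neg_neg, _root_.neg_neg]; exact hza)
  have ha' := dir_sum_pos hR ha hza Ja
  have hb' := dir_sum_pos hR.neg hb hzb Jb
  have hsa := pos_of_mem_topTri hza
  have hsb := pos_of_mem_topTri hzb
  have key : ∀ β, ∃ x, sg β * z 0 ≤ sg β * x ∧
      0 ≤ R.chord (g a) (sz a) x + R.neg.chord (g b) (sz b) (-x) := by
    intro β
    have j1 := Ja β
    have j2 := Ja (!β)
    have j3 := Jb β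
    have j4 := Jb (!β)
    simp only [slope_neg, sg_not] at j2 j3 j4
    change sg β * -z 0 ≤ sg β * -R.V (g b) 0 + _ at j3
    change -sg β * -z 0 ≤ -sg β * -R.V (g b) 0 + _ at j4
    obtain ⟨A, hA⟩ : ∃ A, sg β * A = sg β * R.V (g a) 0 + sz a * R.slope β (g a) :=
      ⟨sg β * (sg β * R.V (g a) 0 + sz a * R.slope β (g a)), by
        rw [← mul_assoc, sg_mul_self, one_mul]⟩
    obtain ⟨B, hB⟩ : ∃ B, sg β * B = sg β * R.V (g b) 0 - sz b * R.slope (!β) (g b) :=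
      ⟨sg β * (sg β * R.V (g b) 0 - sz b * R.slope (!β) (g b)), by
        rw [← mul_assoc, sg_mul_self, one_mul]⟩
    rcases le_total (sg β * B) (sg β * A) with hle | hle
    · refine ⟨B, by linarith, chord_add_nonneg hR hg hV h hab ha' hb' hsa hsb hB
        (by linarith) ?_⟩
      rw [sg_not]
      linarith
    · refine ⟨A, by linarith, ?_⟩
      have := chord_add_nonneg hR.neg hg.neg hV' h' hab.symm hb'
        (by rw [STRep.neg_neg]; exact ha') hsb hsa (β := !β) (B := -A)
        (by
          rw [sg_not, Bool.not_not, slope_neg]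
          change -sg β * -A = -sg β * -R.V (g a) 0 - _
          linarith)
        (by
          rw [sg_not, slope_neg]
          change -sg β * -A ≤ -sg β * -R.V (g b) 0 + _
          linarith)
        (by
          rw [Bool.not_not, slope_neg]
          change sg β * -A ≤ sg β * -R.V (g b) 0 + _
          linarith)
      rw [STRep.neg_neg, _root_.neg_neg] at this
      linarith
  obtain ⟨x, hx, gx⟩ := key false
  obtain ⟨y, hy, gy⟩ := key true
  simp only [sg, cond_true, cond_false] at hx hy
  have hc : ConcaveOn ℝ univ
      (R.chord (g a) (sz a) + R.neg.chord (g b) (sz b) ∘ (-LinearMap.id : ℝ →ₗ[ℝ] ℝ)) :=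
    (concaveOn_chord _ _ _).add ((concaveOn_chord _ _ _).comp_linearMap _)
  have := hc.min_le_of_mem_Icc (mem_univ x) (mem_univ y) (z := z 0) ⟨by linarith, by linarith⟩
  have h0 : 0 ≤ R.chord (g a) (sz a) (z 0) + R.neg.chord (g b) (sz b) (-z 0) :=
    (le_min gx gy).trans this
  have h1 := chord_lt hR hg ha' hza
  have h2 := chord_lt hR.neg hg.neg hb' hzb
  rw [Pi.neg_apply, Pi.neg_apply] at h2
  linarith

theorem disjoint_stdTri (hR : R.IsValid) (hg : IsCornerEnum R g)
    (hV : Function.Injective R.V) {sz : Fin D → ℝ} (h : sz ∈ STPolytope R g) {a b : Fin D}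
    (hab : a ≠ b) : Disjoint (R.stdTri (g a) (sz a)) (R.stdTri (g b) (sz b)) := by
  have flip : ∀ c, ¬ 0 ≤ R.dir (g c - 1) 0 + R.dir (g c) 0 →
      0 ≤ R.neg.dir (g c - 1) 0 + R.neg.dir (g c) 0 := fun c hc => by
    change 0 ≤ -R.dir (g c - 1) 0 + -R.dir (g c) 0
    omega
  unfold stdTri
  split_ifs with ha hb hb
  · exact disjoint_topTri hR hg hV h hab ha hb
  · exact disjoint_topTri_neg hR hg hV h hab ha (flip b hb)
  · exact (disjoint_topTri_neg hR hg hV h hab.symm hb (flip a ha)).symm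
  · have := disjoint_topTri hR.neg hg.neg (injective_V_neg hV) (stPolytope_neg h) hab
      (flip a ha) (flip b hb)
    rw [Set.disjoint_left] at this ⊢
    exact fun z h1 h2 => this h1 h2

end corners

end STRep

theorem convex_modelTriangle (lam : ℝ) : Convex ℝ (modelTriangle lam) := by
  rintro x ⟨x0, x1, hx⟩ y ⟨y0, y1, hy⟩ s r hs hr hsr
  refine ⟨?_, ?_, ?_⟩
  · simp only [Pi.add_apply, Pi.smul_apply, smul_eq_mul]; positivity
  · simp only [Pi.add_apply, Pi.smul_apply, smul_eq_mul]; positivity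
  · simp only [Pi.add_apply, Pi.smul_apply, smul_eq_mul]
    rcases hs.eq_or_lt with rfl | hs
    · rw [zero_add] at hsr
      subst hsr
      linarith
    · have h1 := mul_lt_mul_of_pos_left hx hs
      have h2 := mul_le_mul_of_nonneg_left hy.le hr
      have h3 : lam = s * lam + r * lam := by rw [← add_mul, hsr, one_mul]
      linarith

theorem volume_modelTriangle {lam : ℝ} (hl : 0 ≤ lam) :
    volume (modelTriangle lam) = ENNReal.ofReal (lam ^ 2 / 2) := by
  set S : Set (ℝ × ℝ) := {p | 0 ≤ p.1 ∧ 0 ≤ p.2 ∧ p.1 + p.2 < lam} with hS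
  have hm : MeasurableSet S :=
    (measurableSet_le measurable_const measurable_fst).inter
      ((measurableSet_le measurable_const measurable_snd).inter
        (measurableSet_lt (measurable_fst.add measurable_snd) measurable_const))
  have e : modelTriangle lam = MeasurableEquiv.finTwoArrow ⁻¹' S := rfl
  rw [e, (volume_preserving_finTwoArrow ℝ).measure_preimage hm.nullMeasurableSet,
    Measure.volume_eq_prod, Measure.prod_apply hm]
  have fib : ∀ x : ℝ, volume (Prod.mk x ⁻¹' S) =
      (Icc 0 lam).indicator (fun x => ENNReal.ofReal (lam - x)) x := by
    intro x
    by_cases hx : x ∈ Icc 0 lam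
    · rw [indicator_of_mem hx]
      have : Prod.mk x ⁻¹' S = Ico 0 (lam - x) := by
        ext y
        simp only [hS, mem_preimage, mem_ofPred_eq, mem_Ico, hx.1, true_and, lt_sub_iff_add_lt']
      rw [this, Real.volume_Ico, sub_zero]
    · rw [indicator_of_notMem hx]
      have : Prod.mk x ⁻¹' S = ∅ := by
        refine eq_empty_of_forall_notMem fun y hy => hx ?_
        obtain ⟨h1, h2, h3⟩ := hy
        simp only at h1 h2 h3
        exact ⟨h1, by linarith⟩
      rw [this, measure_empty]
  simp only [fib]
  rw [lintegral_indicator measurableSet_Icc, ← ofReal_integral_eq_lintegral_ofReal]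
  · rw [integral_Icc_eq_integral_Ioc, ← intervalIntegral.integral_of_le hl]
    congr 1
    rw [intervalIntegral.integral_sub (by simp) (by simp)]
    simp
    ring
  · exact (continuous_const.sub continuous_id).integrableOn_Icc
  · filter_upwards [ae_restrict_mem measurableSet_Icc] with x hx
    exact sub_nonneg.2 hx.2

theorem measurePreserving_stMap {m : ℕ} (c : Fin m → Pt) (n : ℤ) (t : ℝ) (u : Fin m → ℤ) :
    MeasurePreserving (stMap c n t u) := by
  have hφ : Measurable fun x : ℝ => (n : ℝ) * x + t + ∑ j, (u j : ℝ) * max (x - c j 0) 0 := by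
    fun_prop
  have h : MeasurePreserving (fun p : ℝ × ℝ =>
      (p.1, p.2 + (n * p.1 + t + ∑ j, (u j : ℝ) * max (p.1 - c j 0) 0))) volume volume :=
    (MeasurePreserving.id volume).skew_product
      (g := fun x y => y + (n * x + t + ∑ j, (u j : ℝ) * max (x - c j 0) 0))
      (measurable_snd.add (hφ.comp measurable_fst))
      (Filter.Eventually.of_forall fun x => map_add_right_eq_self volume _)
  have := ((volume_preserving_finTwoArrow ℝ).symm.comp h).comp (volume_preserving_finTwoArrow ℝ)
  refine Eq.subst (motive := fun f : Pt → Pt => MeasurePreserving f volume volume) ?_ this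
  funext x k
  fin_cases k
  · rfl
  · change x 1 + (n * x 0 + t + ∑ j, (u j : ℝ) * max (x 0 - c j 0) 0) =
      x 1 + n * x 0 + t + ∑ j, (u j : ℝ) * max (x 0 - c j 0) 0
    ring

theorem volume_sl2_image (M : Matrix.SpecialLinearGroup (Fin 2) ℤ) (p : Pt) (S : Set Pt) :
    volume ((fun x => sl2Apply M x + p) '' S) = volume S := by
  have e : (fun x => sl2Apply M x + p) '' S = (fun x => x + p) ''
      (Matrix.toLin' ((M : Matrix (Fin 2) (Fin 2) ℤ).map (Int.cast : ℤ → ℝ)) '' S) := by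
    rw [image_image]; rfl
  have hd : ((M : Matrix (Fin 2) (Fin 2) ℤ).map (Int.cast : ℤ → ℝ)).det = 1 := by
    have := congrArg (Int.cast : ℤ → ℝ) M.det_coe
    rw [Matrix.det_fin_two] at this ⊢
    simpa using this
  rw [e, image_add_right, measure_preimage_add_right, Measure.addHaar_image_linearMap,
    LinearMap.det_toLin', hd, abs_one, ENNReal.ofReal_one, one_mul]

theorem convex_sl2_image (M : Matrix.SpecialLinearGroup (Fin 2) ℤ) (p : Pt) {S : Set Pt}
    (hS : Convex ℝ S) : Convex ℝ ((fun x => sl2Apply M x + p) '' S) := by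
  have e : (fun x => sl2Apply M x + p) '' S = (fun x => p + x) ''
      (Matrix.toLin' ((M : Matrix (Fin 2) (Fin 2) ℤ).map (Int.cast : ℤ → ℝ)) '' S) := by
    rw [image_image]
    exact image_congr fun x _ => add_comm _ _
  rw [e]
  exact (hS.linear_image _).translate p

namespace STRep

variable {d m : ℕ} [NeZero d] {R : STRep d m}

theorem _root_.IsSTPackedTriangle.volume_eq {p : Pt} {lam : ℝ} {B : Set Pt}
    (h : IsSTPackedTriangle R p lam B) :
    NullMeasurableSet B ∧ volume B = ENNReal.ofReal (lam ^ 2 / 2) := by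
  obtain ⟨hl, -, -, n, t, u, -, ⟨M, hM⟩, -⟩ := h
  have hf := measurePreserving_stMap R.c n t u
  have hc : NullMeasurableSet (stMap R.c n t u '' B) volume := by
    rw [hM]
    exact (convex_sl2_image M _ (convex_modelTriangle lam)).nullMeasurableSet volume
  have e := preimage_image_eq B (stMap_injective (R := R) n t u)
  constructor
  · rw [← e]
    exact hc.preimage hf.quasiMeasurePreserving
  · rw [← e, hf.measure_preimage hc, hM, volume_sl2_image, volume_modelTriangle hl.le]

section corners

variable {D : ℕ} [NeZero D] {g : Fin D → Fin d}

theorem area_packing {sz : Fin D → ℝ} {P : Set Pt} (h : IsSTPacking R g sz P) :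
    area P = (∑ a, sz a ^ 2) / 2 := by
  obtain ⟨tri, rfl, htri, hdisj⟩ := h
  have hv : ∀ a, NullMeasurableSet (tri a) ∧
      volume (tri a) = ENNReal.ofReal (sz a ^ 2 / 2) := by
    intro a
    rcases htri a with ⟨h0, he⟩ | h
    · rw [he, h0]
      simp
    · exact h.volume_eq
  unfold area
  rw [measure_iUnion₀ (fun a b hab => (hdisj hab).aedisjoint) fun a => (hv a).1, tsum_fintype,
    Finset.sum_congr rfl fun a _ => (hv a).2, ← ENNReal.ofReal_sum_of_nonneg
    fun a _ => by positivity, ENNReal.toReal_ofReal (Finset.sum_nonneg fun a _ => by positivity),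
    Finset.sum_div]

theorem exists_packing (hR : R.IsValid) (hg : IsCornerEnum R g)
    (hV : Function.Injective R.V) {sz : Fin D → ℝ} (h : sz ∈ STPolytope R g) :
    ∃ P, IsSTPacking R g sz P := by
  refine ⟨_, fun a => if sz a = 0 then ∅ else R.stdTri (g a) (sz a), rfl, fun a => ?_,
    fun a b hab => ?_⟩
  · by_cases h0 : sz a = 0
    · exact Or.inl ⟨h0, if_pos h0⟩
    · simp only [if_neg h0]
      exact Or.inr (isSTPackedTriangle_stdTri hR hg h (lt_of_le_of_ne (h a).1 (Ne.symm h0)))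
  · simp only [Function.onFun]
    split_ifs
    · exact disjoint_bot_left
    · exact disjoint_bot_left
    · exact disjoint_bot_right
    · exact disjoint_stdTri hR hg hV h hab

theorem isCompact_stPolytope (R : STRep d m) (g : Fin D → Fin d) :
    IsCompact (STPolytope R g) := by
  refine (isCompact_Icc (a := (0 : Fin D → ℝ)) (b := stEdgeLen R g)).of_isClosed_subset ?_ ?_
  · simp only [STPolytope, AlphaBound, ofPred_forall, ofPred_and]
    refine isClosed_iInter fun a => ?_
    refine (isClosed_le continuous_const (continuous_apply a)).inter
      ((isClosed_le ((continuous_apply a).add (continuous_apply (a + 1)))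
        continuous_const).inter ?_)
    refine isClosed_iInter fun j => isClosed_iInter fun q => isClosed_iInter fun t =>
      isClosed_iInter fun _ => isClosed_iInter fun _ => isClosed_iInter fun _ => ?_
    exact isClosed_le (continuous_apply a) continuous_const
  · intro sz h
    exact ⟨fun a => (h a).1, fun a => by linarith [(h a).2.1, (h (a + 1)).1]⟩

theorem zero_mem_stPolytope (hR : R.IsValid) : (0 : Fin D → ℝ) ∈ STPolytope R g := fun a =>
  ⟨le_rfl, by simpa using stEdgeLen_nonneg (g := g) hR a, alphaBound_zero hR a⟩

end corners

end STRep

theorem mem_extremePoints_of_isMaxOn_sum_sq {ι : Type*} [Fintype ι] {A : Set (ι → ℝ)}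
    {q : ι → ℝ} (hq : q ∈ A) (h : IsMaxOn (fun x => ∑ a, x a ^ 2) A q) :
    q ∈ extremePoints ℝ A := by
  refine mem_extremePoints_iff_left.2 ⟨hq, ?_⟩
  rintro x hx y hy ⟨s, r, hs, hr, hsr, rfl⟩
  have h1 : ∑ a, x a ^ 2 ≤ ∑ a, (s • x + r • y) a ^ 2 := h hx
  have h2 : ∑ a, y a ^ 2 ≤ ∑ a, (s • x + r • y) a ^ 2 := h hy
  have h3 : ∑ a, (s • x + r • y) a ^ 2 =
      s * ∑ a, x a ^ 2 + r * ∑ a, y a ^ 2 - s * r * ∑ a, (x a - y a) ^ 2 := by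
    rw [Finset.mul_sum, Finset.mul_sum, Finset.mul_sum, ← Finset.sum_add_distrib,
      ← Finset.sum_sub_distrib]
    refine Finset.sum_congr rfl fun a _ => ?_
    simp only [Pi.add_apply, Pi.smul_apply, smul_eq_mul]
    have : r = 1 - s := by linarith
    subst this
    ring
  have h4 : ∑ a, (x a - y a) ^ 2 ≤ 0 := by
    by_contra! hc
    have := mul_pos (mul_pos hs hr) hc
    have e1 := mul_le_mul_of_nonneg_left h1 hs.le
    have e2 := mul_le_mul_of_nonneg_left h2 hr.le
    rw [h3] at e1 e2
    have e : r = 1 - s := by linarith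
    subst e
    linarith
  have h5 : x = y := by
    funext a
    have := (Finset.sum_eq_zero_iff_of_nonneg fun a _ => sq_nonneg (x a - y a)).1
      (le_antisymm h4 (Finset.sum_nonneg fun a _ => sq_nonneg _)) a (Finset.mem_univ a)
    exact sub_eq_zero.1 (pow_eq_zero_iff two_ne_zero |>.1 this)
  rw [← h5, ← add_smul, hsr, one_smul]

/-- The semitoric packing density of a semitoric polygon equals the
maximum of `‖q‖² / (2 · area Δ)` over the vertices (extreme points) of the polytope
`𝒫̃_ST = {λ : λ_a ≥ 0, λ_a + λ_{a+1} ≤ ℓ_a, λ_a ≤ α_a}`. -/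
theorem stmt13 {d m D : ℕ} [NeZero d] [NeZero D] (R : STRep d m) (hR : R.IsValid)
    (g : Fin D → Fin d) (hg : IsCornerEnum R g)
    (hlex : ∀ a : Fin D, a ≠ 0 →
      R.V (g 0) 0 < R.V (g a) 0 ∨
        (R.V (g 0) 0 = R.V (g a) 0 ∧ R.V (g 0) 1 < R.V (g a) 1)) :
    ∃ ρ : ℝ,
      IsGreatest {s : ℝ | ∃ q ∈ Set.extremePoints ℝ (STPolytope R g),
          s = (∑ a, q a ^ 2) / (2 * area R.carrier)} ρ ∧
      IsLUB {r : ℝ | ∃ sz P, IsSTPacking R g sz P ∧ r = area P / area R.carrier} ρ := by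
  obtain ⟨q, hq, hmax⟩ := (STRep.isCompact_stPolytope R g).exists_isMaxOn
    ⟨0, STRep.zero_mem_stPolytope hR⟩
    (f := fun x => ∑ a, x a ^ 2) (by fun_prop)
  have hle : ∀ x ∈ STPolytope R g, (∑ a, x a ^ 2) / (2 * area R.carrier) ≤
      (∑ a, q a ^ 2) / (2 * area R.carrier) := fun x hx =>
    div_le_div_of_nonneg_right (hmax hx) (mul_nonneg two_pos.le ENNReal.toReal_nonneg)
  refine ⟨(∑ a, q a ^ 2) / (2 * area R.carrier),
    ⟨⟨q, mem_extremePoints_of_isMaxOn_sum_sq hq hmax, rfl⟩, ?_⟩, ?_, ?_⟩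
  · rintro _ ⟨x, hx, rfl⟩
    exact hle x hx.1
  · rintro _ ⟨sz, P, hP, rfl⟩
    rw [STRep.area_packing hP, div_div]
    exact hle sz (STRep.mem_stPolytope_of_packing hR hg hP)
  · intro b hb
    obtain ⟨P, hP⟩ := STRep.exists_packing hR hg (STRep.injective_V hR hg hlex) hq
    have := hb ⟨q, P, hP, rfl⟩
    rwa [STRep.area_packing hP, div_div] at this
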